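/- Let n ≥ 3 and let (W,S) be the affine Coxeter system of type B̃_n: S = {0,1,...,n} with m(0,2) = 3, m(1,2) = 3, m(i,i+1) = 3 for 2 ≤ i ≤ n−2, m(n−1,n) = 4, and all other pairs commuting (m = 2). Then for every k ≥ 0 and every d ≥ 2, the homology module H_k(C_*(W)) has no Φ_d²-torsion: every element x ∈ H_k(C_*(W)) with Φ_d² · x = 0 already satisfies Φ_d · x = 0. -/

import Mathlib

open Polynomial CoxeterSystem

set_option synthInstance.maxHeartbeats 1000000
set_option maxHeartbeats 1000000

noncomputable section

/-- The ring `R = ℚ[q,q⁻¹]` of Laurent polynomials over `ℚ`. -/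
abbrev R : Type := LaurentPolynomial ℚ

/-- The image of the `d`-th cyclotomic polynomial `Φ_d` in `R`. -/
def cyc (d : ℕ) : R := Polynomial.toLaurent (Polynomial.cyclotomic d ℚ)

/-- The `R`-module `R/(Φ_d)`. -/
abbrev CycQuot (d : ℕ) := R ⧸ Ideal.span {cyc d}

variable {B : Type*} [Fintype B] [LinearOrder B] {W : Type*} [Group W]
  {M : CoxeterMatrix B} (cs : CoxeterSystem M W)

/-- The standard parabolic subgroup `W_σ` generated by `σ ⊆ S`. -/
def parabolic (σ : Finset B) : Subgroup W := Subgroup.closure (cs.simple '' σ)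

/-- The Poincaré polynomial `W_σ(q) = Σ_{w ∈ W_σ} q^{ℓ(w)}` of the standard parabolic
subgroup `W_σ` (defined to be `0` if `W_σ` is infinite). -/
def poin (σ : Finset B) : ℚ[X] :=
  letI := Classical.dec ((parabolic cs σ : Set W).Finite)
  if h : (parabolic cs σ : Set W).Finite then ∑ w ∈ h.toFinset, X ^ cs.length w else 0

/-- The set of simplices `σ ∈ K_W` with `|σ| = k`, i.e. the subsets of `S` of
cardinality `k` generating a finite standard parabolic subgroup. -/
abbrev KW (k : ℕ) := {σ : Finset B // σ.card = k ∧ (parabolic cs σ : Set W).Finite}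

noncomputable instance (k : ℕ) : Fintype (KW cs k) := Fintype.ofFinite _

/-- The coefficient of `e_τ` in `∂ e_σ`: it is
`(−1)^{#{t ∈ σ : t < s}} · W_σ(q)/W_{σ∖{s}}(q)` if `τ = σ ∖ {s}` for some `s ∈ σ`,
and `0` otherwise. -/
def bcoeff (σ τ : Finset B) : R :=
  ∑ s ∈ σ, if τ = σ.erase s then
      (-1 : R) ^ (σ.filter (fun t => t < s)).card *
        Polynomial.toLaurent (poin cs σ / poin cs τ)
    else 0

/-- The boundary map `∂ : C_{k+1} → C_k` of the weighted complex `C_*(W)`, where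
`C_k = ⊕_{σ ∈ K_W, |σ| = k} R·e_σ`. -/
def bdry (k : ℕ) : (KW cs (k + 1) → R) →ₗ[R] (KW cs k → R) :=
  Matrix.mulVecLin (Matrix.of fun (τ : KW cs k) (σ : KW cs (k + 1)) => bcoeff cs σ.1 τ.1)

/-- The submodule of cycles in degree `k` of the weighted complex. -/
def cycles : (k : ℕ) → Submodule R (KW cs k → R)
  | 0 => ⊤
  | (k + 1) => LinearMap.ker (bdry cs k)

/-- The `k`-th homology `H_k(C_*(W))` of the weighted complex: cycles modulo boundaries. -/
abbrev Hgy (k : ℕ) :=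
  cycles cs k ⧸ Submodule.comap (cycles cs k).subtype (LinearMap.range (bdry cs k))

end

section Exchange

variable {B : Type*} {W : Type*} [Group W] {M : CoxeterMatrix B} (cs : CoxeterSystem M W)

open Classical in
/-- The involution `(t, ε) ↦ (s t s, ε + [t = s])` attached to a simple reflection `s`. -/
noncomputable def signedConj (i : B) : Equiv.Perm (W × ZMod 2) :=
  Function.Involutive.toPerm
    (fun p => (cs.simple i * p.1 * cs.simple i, p.2 + if p.1 = cs.simple i then 1 else 0)) (by
    rintro ⟨t, ε⟩
    have h : cs.simple i * t * cs.simple i = cs.simple i ↔ t = cs.simple i := by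
      constructor
      · intro h
        have := congrArg (fun x => cs.simple i * x * cs.simple i) h
        simpa [mul_assoc] using this
      · rintro rfl; simp
    have h2 : ∀ x : ZMod 2, x + x = 0 := by decide
    by_cases ht : t = cs.simple i
    · subst ht
      simp [add_assoc, h2]
    · simp only [h, ht, if_false]
      simp [mul_assoc])

open Classical in
theorem signedConj_apply (i : B) (t : W) (ε : ZMod 2) :
    signedConj cs i (t, ε) =
      (cs.simple i * t * cs.simple i, ε + if t = cs.simple i then 1 else 0) := rfl

open Classical in
theorem signedConj_mul_pow_apply (i j : B) (m : ℕ) (t : W) (ε : ZMod 2) :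
    ((signedConj cs i * signedConj cs j) ^ m) (t, ε) =
      ((cs.simple i * cs.simple j) ^ m * t * ((cs.simple i * cs.simple j) ^ m)⁻¹,
        ε + ∑ l ∈ Finset.range (2 * m),
          if t = cs.simple j * (cs.simple i * cs.simple j) ^ l then 1 else 0) := by
  induction m with
  | zero => simp
  | succ m ih =>
    set a := cs.simple i * cs.simple j with ha
    have hinv : a⁻¹ = cs.simple j * cs.simple i := by simp [ha]
    have hconj : ∀ k : ℕ, a ^ k * cs.simple j = cs.simple j * (a ^ k)⁻¹ := by
      intro k
      induction k with
      | zero => simp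
      | succ k ihk =>
        rw [pow_succ', mul_assoc, ihk, mul_inv_rev]
        have : a * cs.simple j = cs.simple j * a⁻¹ := by
          rw [hinv, ha]; simp [mul_assoc]
        rw [← mul_assoc, this, mul_assoc, ← mul_inv_rev, ← mul_inv_rev, ← pow_succ', ← pow_succ]
    have key1 : (a ^ m * t * (a ^ m)⁻¹ = cs.simple j) ↔ t = cs.simple j * a ^ (2 * m) := by
      rw [mul_inv_eq_iff_eq_mul, ← eq_inv_mul_iff_mul_eq, two_mul, pow_add]
      have : (a ^ m)⁻¹ * (cs.simple j * a ^ m) = cs.simple j * (a ^ m * a ^ m) := by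
        have h := hconj m
        rw [← mul_assoc, ← mul_assoc]
        congr 1
        rw [inv_mul_eq_iff_eq_mul, ← mul_assoc, h]
        simp
      rw [this]
    have key2 : (cs.simple j * (a ^ m * t * (a ^ m)⁻¹) * cs.simple j = cs.simple i) ↔
        t = cs.simple j * a ^ (2 * m + 1) := by
      have h1 : (cs.simple j * (a ^ m * t * (a ^ m)⁻¹) * cs.simple j = cs.simple i) ↔
          a ^ m * t * (a ^ m)⁻¹ = cs.simple j * a := by
        constructor
        · intro h
          have := congrArg (fun x => cs.simple j * x * cs.simple j) h
          simpa [mul_assoc, ha] using this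
        · intro h
          rw [h, ha]; simp [mul_assoc]
      rw [h1, mul_inv_eq_iff_eq_mul, ← eq_inv_mul_iff_mul_eq]
      have : (a ^ m)⁻¹ * (cs.simple j * a * a ^ m) = cs.simple j * a ^ (2 * m + 1) := by
        have h := hconj m
        have e : a ^ (2 * m + 1) = a ^ m * (a * a ^ m) := by
          rw [← pow_succ', ← pow_add]; congr 1; ring
        rw [e, inv_mul_eq_iff_eq_mul, ← mul_assoc, ← mul_assoc, h]
        simp [mul_assoc]
        rw [← mul_assoc, ← ha]
      rw [this]
    rw [pow_succ', Equiv.Perm.mul_apply, ih, Equiv.Perm.mul_apply, signedConj_apply,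
      signedConj_apply, show 2 * (m + 1) = 2 * m + 1 + 1 by ring, Finset.sum_range_succ,
      Finset.sum_range_succ]
    simp only [key1, key2]
    refine Prod.ext ?_ ?_
    · have e : (a ^ (m + 1))⁻¹ = (a ^ m)⁻¹ * (cs.simple j * cs.simple i) := by
        rw [pow_succ', mul_inv_rev, hinv]
      rw [e, show a ^ (m + 1) = cs.simple i * cs.simple j * a ^ m from pow_succ' a m]
      simp only [mul_assoc]
    · simp only [add_assoc]

theorem signedConj_liftable : M.IsLiftable (signedConj cs) := by
  classical
  intro i j
  ext1 ⟨t, ε⟩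
  rw [signedConj_mul_pow_apply, two_mul, Finset.sum_range_add]
  have h2 : ∀ x : ZMod 2, x + x = 0 := by decide
  simp only [pow_add, cs.simple_mul_simple_pow, one_mul]
  rw [h2]
  simp

/-- The action of `W` on `W × ZMod 2` recording parities of inversions. -/
noncomputable def signedConjHom : W →* Equiv.Perm (W × ZMod 2) :=
  cs.lift ⟨signedConj cs, signedConj_liftable cs⟩

open Classical in
theorem signedConjHom_wordProd (ω : List B) (t : W) (ε : ZMod 2) :
    signedConjHom cs (cs.wordProd ω) (t, ε) =
      (cs.wordProd ω * t * (cs.wordProd ω)⁻¹, ε + ((cs.rightInvSeq ω).count t : ZMod 2)) := by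
  induction ω with
  | nil => simp
  | cons i ω ih =>
    have hs : signedConjHom cs (cs.simple i) = signedConj cs i :=
      cs.lift_apply_simple (signedConj_liftable cs) i
    rw [cs.wordProd_cons, map_mul, Equiv.Perm.mul_apply, ih, hs, signedConj_apply]
    refine Prod.ext ?_ ?_
    · simp [mul_assoc]
    · have : cs.rightInvSeq (i :: ω) =
          (cs.wordProd ω)⁻¹ * cs.simple i * cs.wordProd ω :: cs.rightInvSeq ω := rfl
      rw [this, List.count_cons]
      have e : (cs.wordProd ω * t * (cs.wordProd ω)⁻¹ = cs.simple i) ↔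
          ((cs.wordProd ω)⁻¹ * cs.simple i * cs.wordProd ω == t) = true := by
        rw [beq_iff_eq, mul_inv_eq_iff_eq_mul, mul_assoc, inv_mul_eq_iff_eq_mul, eq_comm]
      simp only [e]
      push_cast
      split_ifs <;> simp [add_assoc]

/-- The exchange property of Coxeter groups. -/
theorem exchange (ω : List B) (i : B)
    (h : cs.length (cs.wordProd ω * cs.simple i) < cs.length (cs.wordProd ω)) :
    ∃ j < ω.length, cs.wordProd ω * cs.simple i = cs.wordProd (ω.eraseIdx j) := by
  classical
  obtain ⟨α, hα, hαw⟩ := cs.exists_isReduced (cs.wordProd ω * cs.simple i)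
  have hw : cs.wordProd ω = cs.wordProd (α.concat i) := by
    rw [cs.wordProd_concat, ← hαw]; simp
  have hnot : cs.simple i ∉ cs.rightInvSeq α := by
    intro hm
    have := (cs.isRightInversion_of_mem_rightInvSeq hα hm).2
    rw [← hαw] at this
    simp at this
    omega
  have hc : (cs.rightInvSeq (α.concat i)).count (cs.simple i) = 1 := by
    rw [cs.rightInvSeq_concat, List.concat_eq_append, List.count_append, List.count_eq_zero.2]
    · simp
    · intro hm
      obtain ⟨t, ht, hts⟩ := List.mem_map.1 hm
      apply hnot
      have : t = cs.simple i := by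
        have h3 := congrArg (fun x => cs.simple i * x * cs.simple i) hts
        simpa [MulAut.conj_apply, mul_assoc] using h3
      rwa [← this]
  have e1 := signedConjHom_wordProd cs ω (cs.simple i) 0
  rw [hw, signedConjHom_wordProd, hc] at e1
  have e2 := (Prod.ext_iff.1 e1).2
  have hmem : cs.simple i ∈ cs.rightInvSeq ω := by
    by_contra hcon
    rw [List.count_eq_zero.2 hcon] at e2
    simp at e2
  obtain ⟨j, hj, hje⟩ := List.getElem_of_mem hmem
  refine ⟨j, by simpa using hj, ?_⟩
  rw [← cs.wordProd_mul_getD_rightInvSeq, List.getD_eq_getElem _ _ hj, hje]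

/-- Every word contains a reduced word with the same letters and the same product. -/
theorem exists_isReduced_subset (ω : List B) :
    ∃ α : List B, cs.IsReduced α ∧ cs.wordProd α = cs.wordProd ω ∧ α ⊆ ω := by
  induction ω using List.reverseRecOn with
  | nil => exact ⟨[], by simp [CoxeterSystem.IsReduced], rfl, by simp⟩
  | append_singleton ω i ih =>
    obtain ⟨α, hα, hαw, hsub⟩ := ih
    have hprod : cs.wordProd (ω ++ [i]) = cs.wordProd α * cs.simple i := by
      rw [cs.wordProd_append, hαw]; simp
    rcases cs.length_mul_simple (cs.wordProd α) i with h | h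
    · refine ⟨α ++ [i], ?_, by rw [hprod, cs.wordProd_append]; simp, ?_⟩
      · rw [CoxeterSystem.IsReduced, cs.wordProd_append, cs.wordProd_singleton, h, hα.eq]
        simp
      · intro x hx
        rcases List.mem_append.1 hx with hx | hx
        · exact List.mem_append_left _ (hsub hx)
        · exact List.mem_append_right _ hx
    · obtain ⟨j, hj, hje⟩ := exchange cs α i (by omega)
      refine ⟨α.eraseIdx j, ?_, by rw [hprod, hje], ?_⟩
      · have := List.length_eraseIdx_add_one hj
        rw [CoxeterSystem.IsReduced, ← hje]
        have := hα.eq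
        omega
      · intro x hx
        exact List.mem_append_left _ (hsub (List.mem_of_mem_eraseIdx hx))

end Exchange

section Parabolic

variable {B : Type*} {W : Type*} [Group W]
  {M : CoxeterMatrix B} (cs : CoxeterSystem M W)

theorem simple_mem_parabolic {σ : Finset B} {i : B} (hi : i ∈ σ) :
    cs.simple i ∈ parabolic cs σ :=
  Subgroup.subset_closure ⟨i, hi, rfl⟩

theorem parabolic_mono {J σ : Finset B} (h : J ⊆ σ) : parabolic cs J ≤ parabolic cs σ :=
  Subgroup.closure_mono (Set.image_mono (by exact_mod_cast h))

theorem wordProd_mem_parabolic {σ : Finset B} {ω : List B} (h : ∀ i ∈ ω, i ∈ σ) :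
    cs.wordProd ω ∈ parabolic cs σ := by
  induction ω with
  | nil => simp
  | cons i ω ih =>
    rw [cs.wordProd_cons]
    exact Subgroup.mul_mem _ (simple_mem_parabolic cs (h i (by simp)))
      (ih fun k hk => h k (by simp [hk]))

theorem exists_word_of_mem_parabolic {σ : Finset B} {w : W} (hw : w ∈ parabolic cs σ) :
    ∃ ω : List B, cs.IsReduced ω ∧ cs.wordProd ω = w ∧ ∀ i ∈ ω, i ∈ σ := by
  have : ∃ ω : List B, cs.wordProd ω = w ∧ ∀ i ∈ ω, i ∈ σ := by
    induction hw using Subgroup.closure_induction with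
    | mem x hx =>
      obtain ⟨i, hi, rfl⟩ := hx
      exact ⟨[i], by simp, by simpa using hi⟩
    | one => exact ⟨[], by simp, by simp⟩
    | mul x y _ _ hx hy =>
      obtain ⟨α, rfl, hα⟩ := hx
      obtain ⟨β, rfl, hβ⟩ := hy
      refine ⟨α ++ β, by rw [cs.wordProd_append], ?_⟩
      intro i hi
      rcases List.mem_append.1 hi with hi | hi
      exacts [hα i hi, hβ i hi]
    | inv x _ hx =>
      obtain ⟨α, rfl, hα⟩ := hx
      exact ⟨α.reverse, by simp, by simpa using hα⟩
  obtain ⟨ω, rfl, hω⟩ := this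
  obtain ⟨α, hα, hαw, hsub⟩ := exists_isReduced_subset cs ω
  exact ⟨α, hα, hαw, fun i hi => hω i (hsub hi)⟩

/-- Lengths add along a coset of a parabolic subgroup, from an element of minimal length. -/
theorem length_mul_of_minimal {J : Finset B} {u : W}
    (hu : ∀ v ∈ parabolic cs J, cs.length u ≤ cs.length (u * v)) {v : W}
    (hv : v ∈ parabolic cs J) : cs.length (u * v) = cs.length u + cs.length v := by
  obtain ⟨ω, hω, rfl, hJ⟩ := exists_word_of_mem_parabolic cs hv
  clear hv
  induction ω using List.reverseRecOn with
  | nil => simp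
  | append_singleton ω i ih =>
    have hω' : cs.IsReduced ω := by simpa using hω.take ω.length
    have ih' := ih hω' (fun k hk => hJ k (by simp [hk]))
    have hlen := hω.eq
    rw [List.length_append, List.length_singleton] at hlen
    rw [cs.wordProd_append, cs.wordProd_singleton] at hlen ⊢
    rw [← mul_assoc]
    rcases cs.length_mul_simple (u * cs.wordProd ω) i with h | h
    · rw [h, ih', hlen, hω'.eq]; ring
    · exfalso
      obtain ⟨α, hα, rfl⟩ := cs.exists_isReduced u
      rw [← cs.wordProd_append] at h
      obtain ⟨j, hj, hje⟩ := exchange cs (α ++ ω) i (by omega)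
      rw [List.eraseIdx_append] at hje
      split_ifs at hje with hjα
      · have hvJ : cs.wordProd ω * cs.simple i * (cs.wordProd ω)⁻¹ ∈ parabolic cs J :=
          Subgroup.mul_mem _ (Subgroup.mul_mem _
            (wordProd_mem_parabolic cs fun k hk => hJ k (by simp [hk]))
            (simple_mem_parabolic cs (hJ i (by simp))))
            (Subgroup.inv_mem _ (wordProd_mem_parabolic cs fun k hk => hJ k (by simp [hk])))
        have h1 := hu _ hvJ
        have h2 : cs.wordProd α * (cs.wordProd ω * cs.simple i * (cs.wordProd ω)⁻¹) =
            cs.wordProd (α.eraseIdx j) := by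
          rw [cs.wordProd_append, cs.wordProd_append] at hje
          rw [← mul_assoc, ← mul_assoc, hje]
          simp
        rw [h2, hα.eq] at h1
        have h3 := cs.length_wordProd_le (α.eraseIdx j)
        have := List.length_eraseIdx_add_one hjα
        omega
      · rw [cs.wordProd_append, cs.wordProd_append, mul_assoc] at hje
        have h2 := mul_left_cancel hje
        have h3 := cs.length_wordProd_le (ω.eraseIdx (j - α.length))
        have := List.length_eraseIdx_add_one (l := ω) (i := j - α.length)
          (by rw [List.length_append] at hj; omega)
        rw [h2] at hlen
        omega

/-- The Poincaré polynomial of a parabolic subgroup, from representatives of the left cosets of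
a smaller parabolic subgroup. -/
theorem poin_eq_mul_of_cosets {σ J : Finset B} (hJ : J ⊆ σ)
    (hfin : (parabolic cs J : Set W).Finite) {ι : Type*} [Fintype ι] (r : ι → W) (ht : ι → ℕ)
    (a₀ : ι) (h₀ : r a₀ = 1) (ht₀ : ht a₀ = 0) (hr : ∀ a, r a ∈ parabolic cs σ)
    (hl : ∀ a, cs.length (r a) ≤ ht a)
    (hcl : ∀ i ∈ σ, ∀ a, ∃ b, ht b ≤ ht a + 1 ∧ ∃ v ∈ parabolic cs J,
      cs.simple i * r a = r b * v)
    (hinj : ∀ a b, (r a)⁻¹ * r b ∈ parabolic cs J → a = b) :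
    (parabolic cs σ : Set W).Finite ∧ poin cs σ = poin cs J * ∑ a, X ^ ht a := by
  classical
  have cover : ∀ ω : List B, (∀ i ∈ ω, i ∈ σ) →
      ∃ b, ht b ≤ ω.length ∧ ∃ v ∈ parabolic cs J, cs.wordProd ω = r b * v := by
    intro ω
    induction ω with
    | nil => exact fun _ => ⟨a₀, by simp [ht₀], 1, Subgroup.one_mem _, by simp [h₀]⟩
    | cons i ω ih =>
      intro h
      obtain ⟨b, hb, v, hv, e⟩ := ih fun k hk => h k (by simp [hk])
      obtain ⟨c, hc, v', hv', e'⟩ := hcl i (h i (by simp)) b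
      refine ⟨c, by simp; omega, v' * v, Subgroup.mul_mem _ hv' hv, ?_⟩
      rw [cs.wordProd_cons, e, ← mul_assoc, e', mul_assoc]
  have hmin : ∀ a, ∀ v ∈ parabolic cs J, ht a ≤ cs.length (r a * v) := by
    intro a v hv
    obtain ⟨ω, hω, e, hωσ⟩ := exists_word_of_mem_parabolic cs
      (Subgroup.mul_mem _ (hr a) (parabolic_mono cs hJ hv))
    obtain ⟨b, hb, v', hv', e'⟩ := cover ω hωσ
    have : a = b := by
      apply hinj
      have h2 : (r a)⁻¹ * r b = v * v'⁻¹ := by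
        rw [inv_mul_eq_iff_eq_mul, ← mul_assoc, ← e, e']; simp
      rw [h2]
      exact Subgroup.mul_mem _ hv (Subgroup.inv_mem _ hv')
    rw [this, ← this, ← e, hω.eq]
    rwa [this]
  have hlen : ∀ a, cs.length (r a) = ht a := fun a =>
    le_antisymm (hl a) (by simpa using hmin a 1 (Subgroup.one_mem _))
  have hadd : ∀ a, ∀ v ∈ parabolic cs J, cs.length (r a * v) = ht a + cs.length v := by
    intro a v hv
    rw [length_mul_of_minimal cs (fun v' hv' => by rw [hlen]; exact hmin a v' hv') hv, hlen]
  set T : Finset W := (Finset.univ ×ˢ hfin.toFinset).image fun p : ι × W => r p.1 * p.2 with hT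
  have hset : (parabolic cs σ : Set W) = T := by
    ext w
    simp only [hT, Finset.coe_image, Set.mem_image, SetLike.mem_coe, Finset.coe_product,
      Finset.coe_univ, Set.Finite.coe_toFinset, Set.mem_prod, Set.mem_univ, true_and, Prod.exists]
    constructor
    · intro hw
      obtain ⟨ω, -, rfl, hωσ⟩ := exists_word_of_mem_parabolic cs hw
      obtain ⟨b, -, v, hv, e⟩ := cover ω hωσ
      exact ⟨b, v, hv, e.symm⟩
    · rintro ⟨a, v, hv, rfl⟩
      exact Subgroup.mul_mem _ (hr a) (parabolic_mono cs hJ hv)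
  have hσ : (parabolic cs σ : Set W).Finite := by rw [hset]; exact T.finite_toSet
  refine ⟨hσ, ?_⟩
  have hσT : hσ.toFinset = T := by
    rw [← Finset.coe_inj, Set.Finite.coe_toFinset, hset]
  rw [poin, poin, dif_pos hσ, dif_pos hfin, hσT, hT, Finset.sum_image, Finset.sum_product,
    Finset.mul_sum]
  · refine Finset.sum_congr rfl fun a _ => ?_
    rw [Finset.sum_mul]
    refine Finset.sum_congr rfl fun v hv => ?_
    rw [hadd a v (by simpa using hv), pow_add, mul_comm]
  · rintro ⟨a, v⟩ hav ⟨b, v'⟩ hbv e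
    simp only [Finset.coe_product, Finset.coe_univ, Set.Finite.coe_toFinset, Set.mem_prod,
      Set.mem_univ, true_and, SetLike.mem_coe] at hav hbv e
    have hab : a = b := by
      apply hinj
      have h2 : (r a)⁻¹ * r b = v * v'⁻¹ := by
        rw [inv_mul_eq_iff_eq_mul, ← mul_assoc, e]; simp
      rw [h2]
      exact Subgroup.mul_mem _ hav (Subgroup.inv_mem _ hbv)
    subst hab
    rw [mul_left_cancel e]

theorem parabolic_empty_finite : (parabolic cs (∅ : Finset B) : Set W).Finite := by
  simp [parabolic]

theorem poin_empty : poin cs (∅ : Finset B) = 1 := by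
  rw [poin, dif_pos (parabolic_empty_finite cs)]
  have : (parabolic_empty_finite cs).toFinset = {1} := by
    rw [← Finset.coe_inj, Set.Finite.coe_toFinset]; simp [parabolic]
  rw [this]; simp

end Parabolic

section AffineB

/-- The affine signed transposition on `ℤ × ℤ`, thought of as the action on functionals. -/
def signedSwap (a b c : ℤ) (p : ℤ × ℤ) : ℤ × ℤ :=
  if p.1 = a then (b, p.2 + c) else if p.1 = b then (a, p.2 - c)
  else if p.1 = -a then (-b, p.2 - c) else if p.1 = -b then (-a, p.2 + c) else p

theorem signedSwap_invol {a b c : ℤ} (ha : a ≠ 0) (hb : b ≠ 0) (h : a ≠ b)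
    (p : ℤ × ℤ) : signedSwap a b c (signedSwap a b c p) = p := by
  obtain ⟨x, k⟩ := p
  simp only [signedSwap]
  grind

theorem signedSwap_comm {a b c a' b' c' : ℤ}
    (h1 : a ≠ a') (h2 : a ≠ b') (h3 : b ≠ a') (h4 : b ≠ b')
    (h5 : a ≠ -a') (h6 : a ≠ -b') (h7 : b ≠ -a') (h8 : b ≠ -b') (p : ℤ × ℤ) :
    signedSwap a b c (signedSwap a' b' c' p) = signedSwap a' b' c' (signedSwap a b c p) := by
  obtain ⟨x, k⟩ := p
  by_cases x = a
  · simp only [signedSwap]; grind (splits := 40)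
  by_cases x = b
  · simp only [signedSwap]; grind (splits := 40)
  by_cases x = -a
  · simp only [signedSwap]; grind (splits := 40)
  by_cases x = -b
  · simp only [signedSwap]; grind (splits := 40)
  by_cases x = a'
  · simp only [signedSwap]; grind (splits := 40)
  by_cases x = b'
  · simp only [signedSwap]; grind (splits := 40)
  by_cases x = -a'
  · simp only [signedSwap]; grind (splits := 40)
  by_cases x = -b'
  · simp only [signedSwap]; grind (splits := 40)
  simp only [signedSwap]; grind (splits := 40)

theorem signedSwap_braid {a b b' c c' : ℤ} (ha : a ≠ 0) (hb : b ≠ 0) (hb' : b' ≠ 0)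
    (h1 : a ≠ b) (h2 : a ≠ b') (h3 : b ≠ b')
    (h5 : a ≠ -b) (h6 : a ≠ -b') (h7 : b ≠ -b') (p : ℤ × ℤ) :
    signedSwap a b c (signedSwap b b' c' (signedSwap a b c p)) =
      signedSwap b b' c' (signedSwap a b c (signedSwap b b' c' p)) := by
  obtain ⟨x, k⟩ := p
  by_cases x = a
  · simp only [signedSwap]; grind (splits := 40)
  by_cases x = b
  · simp only [signedSwap]; grind (splits := 40)
  by_cases x = b'
  · simp only [signedSwap]; grind (splits := 40)
  by_cases x = -a
  · simp only [signedSwap]; grind (splits := 40)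
  by_cases x = -b
  · simp only [signedSwap]; grind (splits := 40)
  by_cases x = -b'
  · simp only [signedSwap]; grind (splits := 40)
  simp only [signedSwap]; grind (splits := 40)

theorem signedSwap_braid_four {a b : ℤ} (ha : a ≠ 0) (hb : b ≠ 0) (h1 : a ≠ b) (h2 : a ≠ -b)
    (p : ℤ × ℤ) :
    signedSwap a b 0 (signedSwap b (-b) 0 (signedSwap a b 0 (signedSwap b (-b) 0 p))) =
      signedSwap b (-b) 0 (signedSwap a b 0 (signedSwap b (-b) 0 (signedSwap a b 0 p))) := by
  obtain ⟨x, k⟩ := p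
  by_cases x = a
  · simp only [signedSwap]; grind (splits := 40)
  by_cases x = b
  · simp only [signedSwap]; grind (splits := 40)
  by_cases x = -a
  · simp only [signedSwap]; grind (splits := 40)
  by_cases x = -b
  · simp only [signedSwap]; grind (splits := 40)
  simp only [signedSwap]; grind (splits := 40)

theorem signedSwap_comm_fork (p : ℤ × ℤ) :
    signedSwap (-1) 2 (-1) (signedSwap 1 2 0 p) = signedSwap 1 2 0 (signedSwap (-1) 2 (-1) p) := by
  obtain ⟨x, k⟩ := p
  by_cases x = 1
  · simp only [signedSwap]; grind (splits := 40)
  by_cases x = 2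
  · simp only [signedSwap]; grind (splits := 40)
  by_cases x = -1
  · simp only [signedSwap]; grind (splits := 40)
  by_cases x = -2
  · simp only [signedSwap]; grind (splits := 40)
  simp only [signedSwap]; grind (splits := 40)

/-- The parameters of the signed swap attached to the `i`-th node. -/
def nodeFst (i : ℕ) : ℤ := if i = 0 then -1 else i

/-- The parameters of the signed swap attached to the `i`-th node. -/
def nodeSnd (n i : ℕ) : ℤ := if i = 0 then 2 else if i = n then -n else i + 1

/-- The parameters of the signed swap attached to the `i`-th node. -/
def nodeShift (i : ℕ) : ℤ := if i = 0 then -1 else 0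

/-- The affine signed permutation attached to the `i`-th node of `B̃ₙ`. -/
def nodeSwap (n i : ℕ) : ℤ × ℤ → ℤ × ℤ := signedSwap (nodeFst i) (nodeSnd n i) (nodeShift i)

theorem nodeSwap_invol {n : ℕ} (hn : 3 ≤ n) (i : ℕ) : Function.Involutive (nodeSwap n i) := by
  intro p
  apply signedSwap_invol <;> simp only [nodeFst, nodeSnd] <;> split_ifs <;> omega

/-- The Coxeter matrix entries of `B̃ₙ` above the diagonal. -/
def affBEntry (n i j : ℕ) : ℕ :=
  if (i = 0 ∧ j = 2) ∨ (i = 1 ∧ j = 2) ∨ (2 ≤ i ∧ i ≤ n - 2 ∧ j = i + 1) then 3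
  else if i = n - 1 ∧ j = n then 4
  else 2

theorem nodeSwap_rel {n : ℕ} (hn : 3 ≤ n) {i j : ℕ} (hij : i < j) (hj : j ≤ n) (p : ℤ × ℤ) :
    (nodeSwap n i ∘ nodeSwap n j)^[affBEntry n i j] p = p := by
  have hi' := nodeSwap_invol hn i
  have hj' := nodeSwap_invol hn j
  unfold affBEntry
  split_ifs with h1 h2
  · have : ∀ p, nodeSwap n i (nodeSwap n j (nodeSwap n i p)) =
        nodeSwap n j (nodeSwap n i (nodeSwap n j p)) := by
      intro p
      by_cases h0 : i = 0
      · have : nodeSwap n j = signedSwap 2 3 0 := by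
          simp only [nodeSwap, nodeFst, nodeSnd, nodeShift]
          grind
        rw [this]
        subst h0
        apply signedSwap_braid <;> norm_num [nodeFst, nodeSnd]
      · have h2 : nodeSwap n i = signedSwap i (i + 1) 0 := by
          simp only [nodeSwap, nodeFst, nodeSnd, nodeShift]
          grind
        have h3 : nodeSwap n j = signedSwap (i + 1) (i + 2) 0 := by
          simp only [nodeSwap, nodeFst, nodeSnd, nodeShift]
          grind
        rw [h2, h3]
        apply signedSwap_braid <;> omega
    simp only [Function.iterate_succ, Function.iterate_zero, Function.comp_apply, id]
    rw [this, hj', hi', hj']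
  · obtain ⟨rfl, rfl⟩ := h2
    have h2 : nodeSwap j (j - 1) = signedSwap (j - 1) j 0 := by
      simp only [nodeSwap, nodeFst, nodeSnd, nodeShift]
      grind
    have h3 : nodeSwap j j = signedSwap j (-j) 0 := by
      simp only [nodeSwap, nodeFst, nodeSnd, nodeShift]
      grind
    have : ∀ p, nodeSwap j (j - 1) (nodeSwap j j (nodeSwap j (j - 1) (nodeSwap j j p))) =
        nodeSwap j j (nodeSwap j (j - 1) (nodeSwap j j (nodeSwap j (j - 1) p))) := by
      intro p
      rw [h2, h3]
      apply signedSwap_braid_four <;> omega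
    simp only [Function.iterate_succ, Function.iterate_zero, Function.comp_apply, id]
    rw [this, hi', hj', hi', hj']
  · have : ∀ p, nodeSwap n i (nodeSwap n j p) = nodeSwap n j (nodeSwap n i p) := by
      intro p
      by_cases h01 : i = 0 ∧ j = 1
      · obtain ⟨rfl, rfl⟩ := h01
        have h3 : nodeSwap n 1 = signedSwap 1 2 0 := by
          simp only [nodeSwap, nodeFst, nodeSnd, nodeShift]
          grind
        rw [h3]
        exact signedSwap_comm_fork p
      · apply signedSwap_comm <;> simp only [nodeFst, nodeSnd] <;> split_ifs <;> omega
    simp only [Function.iterate_succ, Function.iterate_zero, Function.comp_apply, id]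
    rw [this, hi', hj']

variable {n : ℕ} {W : Type*} [Group W] {Mat : CoxeterMatrix (Fin (n + 1))}
  (cs : CoxeterSystem Mat W)

/-- The simple reflection attached to the node `i`. -/
noncomputable def node (i : ℕ) : W := cs.simple (Fin.ofNat (n + 1) i)

theorem node_val (i : Fin (n + 1)) : node cs i.val = cs.simple i := by
  simp [node]

theorem node_mul_self (i : ℕ) : node cs i * node cs i = 1 := by simp [node]

theorem node_inv (i : ℕ) : (node cs i)⁻¹ = node cs i := by simp [node]

theorem node_rel (hM : ∀ i j : Fin (n + 1), i.val < j.val → Mat.M i j = affBEntry n i.val j.val)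
    {i j : ℕ} (hij : i < j) (hj : j ≤ n) : (node cs i * node cs j) ^ affBEntry n i j = 1 := by
  have h := hM ⟨i, by omega⟩ ⟨j, by omega⟩ hij
  have hi : Fin.ofNat (n + 1) i = ⟨i, by omega⟩ := by
    ext; simp [Fin.ofNat, Nat.mod_eq_of_lt (show i < n + 1 by omega)]
  have hj : Fin.ofNat (n + 1) j = ⟨j, by omega⟩ := by
    ext; simp [Fin.ofNat, Nat.mod_eq_of_lt (show j < n + 1 by omega)]
  rw [node, node, hi, hj, ← h]
  exact cs.simple_mul_simple_pow _ _

theorem node_comm (hM : ∀ i j : Fin (n + 1), i.val < j.val → Mat.M i j = affBEntry n i.val j.val)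
    {i j : ℕ} (hij : i < j) (hj : j ≤ n) (h : affBEntry n i j = 2) :
    node cs i * node cs j = node cs j * node cs i := by
  have := node_rel cs hM hij hj
  rw [h, sq] at this
  rw [← mul_inv_eq_one, mul_inv_rev, node_inv, node_inv, this]

theorem node_braid (hM : ∀ i j : Fin (n + 1), i.val < j.val → Mat.M i j = affBEntry n i.val j.val)
    {i j : ℕ} (hij : i < j) (hj : j ≤ n) (h : affBEntry n i j = 3) :
    node cs i * node cs j * node cs i = node cs j * node cs i * node cs j := by
  have := node_rel cs hM hij hj
  rw [h, pow_three] at this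
  rw [← mul_inv_eq_one, mul_inv_rev, mul_inv_rev, node_inv, node_inv, ← this]
  simp only [mul_assoc]

theorem node_braid_four
    (hM : ∀ i j : Fin (n + 1), i.val < j.val → Mat.M i j = affBEntry n i.val j.val)
    {i j : ℕ} (hij : i < j) (hj : j ≤ n) (h : affBEntry n i j = 4) :
    node cs i * node cs j * node cs i * node cs j =
      node cs j * node cs i * node cs j * node cs i := by
  have := node_rel cs hM hij hj
  rw [h, pow_succ, pow_three] at this
  rw [← mul_inv_eq_one]
  simp only [mul_inv_rev, node_inv]
  rw [← this]
  simp only [mul_assoc]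

theorem nodePerm_liftable (hn : 3 ≤ n)
    (hM : ∀ i j : Fin (n + 1), i.val < j.val → Mat.M i j = affBEntry n i.val j.val) :
    Mat.IsLiftable fun i : Fin (n + 1) => (nodeSwap_invol hn i.val).toPerm := by
  have key : ∀ i j : Fin (n + 1), i.val < j.val →
      ((nodeSwap_invol hn i.val).toPerm * (nodeSwap_invol hn j.val).toPerm) ^ Mat.M i j = 1 := by
    intro i j hij
    ext1 p
    rw [hM i j hij, ← Equiv.Perm.iterate_eq_pow]
    exact nodeSwap_rel hn hij (by omega) p
  intro i j
  rcases lt_trichotomy i.val j.val with h | h | h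
  · exact key i j h
  · obtain rfl : i = j := Fin.ext h
    rw [Mat.diagonal, pow_one]
    ext1 p
    exact nodeSwap_invol hn _ p
  · have h2 := key j i h
    rw [Mat.symmetric j i] at h2
    have h3 := congrArg (fun x => x⁻¹) h2
    simp only [← inv_pow, mul_inv_rev, inv_one] at h3
    exact h3

/-- The action of the affine Weyl group on `ℤ × ℤ`. -/
noncomputable def nodeAction (hn : 3 ≤ n)
    (hM : ∀ i j : Fin (n + 1), i.val < j.val → Mat.M i j = affBEntry n i.val j.val) :
    W →* Equiv.Perm (ℤ × ℤ) :=
  cs.lift ⟨_, nodePerm_liftable hn hM⟩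

theorem nodeAction_node (hn : 3 ≤ n)
    (hM : ∀ i j : Fin (n + 1), i.val < j.val → Mat.M i j = affBEntry n i.val j.val)
    {i : ℕ} (hi : i ≤ n) (p : ℤ × ℤ) : nodeAction cs hn hM (node cs i) p = nodeSwap n i p := by
  have h := cs.lift_apply_simple (nodePerm_liftable hn hM) (Fin.ofNat (n + 1) i)
  rw [nodeAction, node, h]
  simp [Nat.mod_eq_of_lt (show i < n + 1 by omega)]

/-- A product of consecutive simple reflections. -/
noncomputable def chain {G : Type*} [Group G] (a : ℕ → G) : ℕ → G
  | 0 => 1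
  | i + 1 => a (i + 1) * chain a i

theorem nodeAction_chain_up (hn : 3 ≤ n)
    (hM : ∀ i j : Fin (n + 1), i.val < j.val → Mat.M i j = affBEntry n i.val j.val)
    {ε : ℤ} (hε : ε = 1 ∨ ε = -1) (z : ℤ) (i : ℕ) (hi : i + 1 ≤ n) :
    nodeAction cs hn hM (chain (node cs) i) (ε, z) = (ε * ((i : ℤ) + 1), z) := by
  induction i with
  | zero => simp [chain]
  | succ i ih =>
    rw [chain, map_mul, Equiv.Perm.mul_apply, ih (by omega), nodeAction_node _ _ _ (by omega),
      nodeSwap, signedSwap, nodeFst, nodeSnd, nodeShift]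
    rcases hε with rfl | rfl <;> grind

theorem parabolic_univ_infinite (hn : 3 ≤ n)
    (hM : ∀ i j : Fin (n + 1), i.val < j.val → Mat.M i j = affBEntry n i.val j.val) :
    ¬ (parabolic cs Finset.univ : Set W).Finite := by
  intro hfin
  have htop : parabolic cs Finset.univ = ⊤ := by
    rw [parabolic, Finset.coe_univ, Set.image_univ, cs.subgroup_closure_range_simple]
  set ρ := nodeAction cs hn hM with hρ
  set w := chain (node cs) (n - 1) with hw
  have hw1 : ∀ ε : ℤ, ε = 1 ∨ ε = -1 → ∀ z, ρ w (ε, z) = (ε * n, z) := by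
    intro ε hε z
    rw [hρ, nodeAction_chain_up cs hn hM hε z (n - 1) (by omega)]
    congr 2
    omega
  have hg : ∀ z, ρ (w⁻¹ * node cs n * w * node cs 0 * node cs 1) (1, z) = (1, z + 1) := by
    intro z
    have e1 : ρ (node cs 1) (1, z) = (2, z) := by
      rw [hρ, nodeAction_node _ _ _ (by omega), nodeSwap, signedSwap, nodeFst, nodeSnd, nodeShift]
      grind
    have e2 : ρ (node cs 0) (2, z) = (-1, z + 1) := by
      rw [hρ, nodeAction_node _ _ _ (by omega), nodeSwap, signedSwap, nodeFst, nodeSnd, nodeShift]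
      grind
    have e3 : ρ (node cs n) (-1 * n, z + 1) = ((n : ℤ), z + 1) := by
      rw [hρ, nodeAction_node _ _ _ le_rfl, nodeSwap, signedSwap, nodeFst, nodeSnd, nodeShift]
      grind
    simp only [map_mul, Equiv.Perm.mul_apply]
    rw [e1, e2, hw1 _ (Or.inr rfl), e3, map_inv, Equiv.Perm.inv_eq_iff_eq, hw1 _ (Or.inl rfl)]
    simp
  set g := w⁻¹ * node cs n * w * node cs 0 * node cs 1
  have hpow : ∀ k : ℕ, ρ (g ^ k) (1, 0) = (1, (k : ℤ)) := by
    intro k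
    induction k with
    | zero => simp
    | succ k ih =>
      rw [pow_succ', map_mul, Equiv.Perm.mul_apply, ih, hg]
      simp
  rw [htop] at hfin
  refine Set.infinite_of_injective_forall_mem (f := fun k : ℕ => g ^ k) ?_ (fun _ => Subgroup.mem_top _) hfin
  intro a b hab
  have := congrArg (fun x => ρ x (1, 0)) hab
  simp only [hpow] at this
  simpa using this

end AffineB

section Chain

variable {G : Type*} [Group G]

theorem chain_succ_right (a : ℕ → G) (i : ℕ) :
    chain a (i + 1) = chain (fun j => a (j + 1)) i * a 1 := by
  induction i with
  | zero => simp [chain]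
  | succ i ih => rw [chain, ih, chain, mul_assoc]

theorem chain_comm {a : ℕ → G} {h : G} {i : ℕ} (H : ∀ j, 1 ≤ j → j ≤ i → h * a j = a j * h) :
    h * chain a i = chain a i * h := by
  induction i with
  | zero => simp [chain]
  | succ i ih =>
    rw [chain, ← mul_assoc, H (i + 1) (by omega) le_rfl, mul_assoc,
      ih fun j h1 h2 => H j h1 (by omega), mul_assoc]

/-- The relations of a symmetric group, for generators `a 1, …, a k`. -/
structure IsBraidChain (a : ℕ → G) (k : ℕ) : Prop where
  mul_self : ∀ j, a j * a j = 1
  comm : ∀ i j, 1 ≤ i → i + 1 < j → j ≤ k → a i * a j = a j * a i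
  braid : ∀ i, 1 ≤ i → i < k → a i * a (i + 1) * a i = a (i + 1) * a i * a (i + 1)

theorem IsBraidChain.reverse {a : ℕ → G} {k : ℕ} (ha : IsBraidChain a k) :
    IsBraidChain (fun j => a (k + 1 - j)) k where
  mul_self j := ha.mul_self _
  comm i j h1 h2 h3 := (ha.comm (k + 1 - j) (k + 1 - i) (by omega) (by omega) (by omega)).symm
  braid i h1 h2 := by
    have := ha.braid (k - i) (by omega) (by omega)
    rw [show k - i + 1 = k + 1 - i by omega] at this
    rw [show k + 1 - (i + 1) = k - i by omega]
    exact this.symm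

theorem IsBraidChain.mul_chain_of_gt {a : ℕ → G} {k : ℕ} (ha : IsBraidChain a k) {i j : ℕ}
    (h1 : i + 1 < j) (h2 : j ≤ k) : a j * chain a i = chain a i * a j :=
  chain_comm fun l h3 _ => (ha.comm l j h3 (by omega) h2).symm

theorem IsBraidChain.mul_chain_of_lt {a : ℕ → G} {k : ℕ} (ha : IsBraidChain a k) {i j : ℕ}
    (h1 : 1 ≤ j) (h2 : j < i) (h3 : i ≤ k) : a j * chain a i = chain a i * a (j + 1) := by
  induction i, h2 using Nat.le_induction with
  | base =>
    obtain ⟨j, rfl⟩ : ∃ l, j = l + 1 := ⟨j - 1, by omega⟩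
    rw [Nat.succ_eq_add_one, chain, chain, ← mul_assoc, ← mul_assoc,
      ha.braid (j + 1) (by omega) (by omega), mul_assoc,
      ha.mul_chain_of_gt (show j + 1 < j + 1 + 1 by omega) h3]
    simp only [mul_assoc]
  | succ i hi ih =>
    rw [chain, ← mul_assoc, ha.comm j (i + 1) h1 (by omega) h3, mul_assoc, ih (by omega),
      mul_assoc]

theorem IsBraidChain.mul_chain {a : ℕ → G} {k : ℕ} (ha : IsBraidChain a k) {H : Subgroup G}
    (hH : ∀ j, 2 ≤ j → j ≤ k → a j ∈ H) {i j : ℕ} (h1 : 1 ≤ j) (h2 : j ≤ k) (hi : i ≤ k) :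
    ∃ l ≤ k, l ≤ i + 1 ∧ ∃ v ∈ H, a j * chain a i = chain a l * v := by
  rcases lt_trichotomy j i with h | h | h
  · exact ⟨i, hi, by omega, a (j + 1), hH _ (by omega) (by omega), ha.mul_chain_of_lt h1 h hi⟩
  · subst h
    obtain ⟨j, rfl⟩ : ∃ l, j = l + 1 := ⟨j - 1, by omega⟩
    refine ⟨j, by omega, by omega, 1, H.one_mem, ?_⟩
    rw [chain, ← mul_assoc, ha.mul_self]
    simp
  · rcases Nat.lt_or_ge (i + 1) j with h' | h'
    · exact ⟨i, hi, by omega, a j, hH _ (by omega) h2, ha.mul_chain_of_gt h' h2⟩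
    · obtain rfl : j = i + 1 := by omega
      exact ⟨i + 1, h2, le_rfl, 1, H.one_mem, by rw [chain, mul_one]⟩

/-- The product `a (k - i + 1) ⋯ a k * g * a k ⋯ a 1`. -/
noncomputable def bounce (a : ℕ → G) (g : G) (k i : ℕ) : G :=
  chain (fun j => a (k + 1 - j)) i * g * chain a k

theorem bounce_zero (a : ℕ → G) (g : G) (k : ℕ) : bounce a g k 0 = g * chain a k := by
  simp [bounce, chain]

theorem bounce_succ (a : ℕ → G) (g : G) (k i : ℕ) :
    bounce a g k (i + 1) = a (k - i) * bounce a g k i := by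
  simp only [bounce, chain, mul_assoc]
  congr 2
  omega

theorem IsBraidChain.mul_bounce {a : ℕ → G} {k : ℕ} (ha : IsBraidChain a k) {g : G}
    (hg : ∀ j, 1 ≤ j → j < k → g * a j = a j * g) {H : Subgroup G}
    (hH : ∀ j, 2 ≤ j → j ≤ k → a j ∈ H) {i j : ℕ} (h1 : 1 ≤ j) (h2 : j ≤ k) (hi : i ≤ k) :
    ∃ l ≤ k, l ≤ i + 1 ∧ ∃ v ∈ H, a j * bounce a g k i = bounce a g k l * v := by
  rcases Nat.lt_or_ge j (k - i) with h | h
  · refine ⟨i, hi, by omega, a (j + 1), hH _ (by omega) (by omega), ?_⟩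
    have c : a j * chain (fun j => a (k + 1 - j)) i = chain (fun j => a (k + 1 - j)) i * a j :=
      chain_comm fun l h3 h4 => ha.comm j (k + 1 - l) h1 (by omega) (by omega)
    rw [bounce, ← mul_assoc, ← mul_assoc, c, mul_assoc (chain _ i) (a j) g,
      ← hg j h1 (by omega), ← mul_assoc, mul_assoc, ha.mul_chain_of_lt h1 (by omega) le_rfl,
      ← mul_assoc]
  rcases Nat.lt_or_ge (k - i) j with h' | h'
  · rcases Nat.lt_or_ge (k - i + 1) j with h3 | h3
    · refine ⟨i, hi, by omega, a j, hH _ (by omega) h2, ?_⟩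
      have := ha.reverse.mul_chain_of_lt (i := i) (j := k + 1 - j) (by omega) (by omega) hi
      simp only [show k + 1 - (k + 1 - j) = j by omega,
        show k + 1 - (k + 1 - j + 1) = j - 1 by omega] at this
      rw [bounce, ← mul_assoc, ← mul_assoc, this, mul_assoc (chain _ i) (a (j - 1)) g,
        ← hg (j - 1) (by omega) (by omega), ← mul_assoc, mul_assoc,
        ha.mul_chain_of_lt (by omega) (by omega) le_rfl, ← mul_assoc,
        show j - 1 + 1 = j by omega]
    · obtain ⟨i, rfl⟩ : ∃ l, i = l + 1 := ⟨i - 1, by omega⟩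
      refine ⟨i, by omega, by omega, 1, H.one_mem, ?_⟩
      rw [bounce_succ, show j = k - i by omega, ← mul_assoc, ha.mul_self]
      simp
  · refine ⟨i + 1, by omega, le_rfl, 1, H.one_mem, ?_⟩
    rw [bounce_succ, mul_one]
    congr 2
    omega

theorem mul_bounce_of_swap {a : ℕ → G} {k : ℕ} {g h h' : G}
    (hh : ∀ j, 1 ≤ j → j < k → h * a j = a j * h)
    (hh' : ∀ j, 1 ≤ j → j < k → h' * a j = a j * h')
    (hs : h * (a k * g * a k) = a k * g * a k * h') {i : ℕ} (h1 : 1 ≤ i) (h2 : i ≤ k) :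
    h * bounce a g k i = bounce a g k i * h' := by
  obtain ⟨i, rfl⟩ : ∃ l, i = l + 1 := ⟨i - 1, by omega⟩
  obtain ⟨k, rfl⟩ : ∃ l, k = l + 1 := ⟨k - 1, by omega⟩
  have e : bounce a g (k + 1) (i + 1) =
      chain (fun j => a (k + 1 - j)) i * (a (k + 1) * g * a (k + 1)) * chain a k := by
    rw [bounce, chain_succ_right, chain]
    simp only [mul_assoc, Nat.add_sub_cancel, Nat.add_sub_add_right]
  have c1 : h * chain (fun j => a (k + 1 - j)) i = chain (fun j => a (k + 1 - j)) i * h :=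
    chain_comm fun j h3 h4 => hh (k + 1 - j) (by omega) (by omega)
  have c2 : h' * chain a k = chain a k * h' := chain_comm fun j h3 h4 => hh' j h3 (by omega)
  rw [e, ← mul_assoc, ← mul_assoc, c1, mul_assoc (chain _ i) h, hs, ← mul_assoc,
    mul_assoc _ h', c2, ← mul_assoc]

end Chain

section NodeCosets

variable {n : ℕ} {W : Type*} [Group W] {Mat : CoxeterMatrix (Fin (n + 1))}
  (cs : CoxeterSystem Mat W)

/-- The set of nodes attached to a set of natural numbers. -/
def toFin (n : ℕ) (τ : Finset ℕ) : Finset (Fin (n + 1)) := Finset.univ.filter fun i => i.val ∈ τ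

theorem mem_toFin {τ : Finset ℕ} {i : Fin (n + 1)} : i ∈ toFin n τ ↔ i.val ∈ τ := by
  simp [toFin]

theorem node_mem_parabolic {τ : Finset ℕ} {i : ℕ} (hi : i ∈ τ) (hin : i ≤ n) :
    node cs i ∈ parabolic cs (toFin n τ) := by
  apply simple_mem_parabolic
  rw [mem_toFin]
  simpa [Nat.mod_eq_of_lt (show i < n + 1 by omega)] using hi

/-- `w` is a product of at most `l` simple reflections from `τ`. -/
def HasWord (τ : Finset ℕ) (l : ℕ) (w : W) : Prop :=
  ∃ ω : List ℕ, ω.length ≤ l ∧ (∀ i ∈ ω, i ∈ τ) ∧ (ω.map (node cs)).prod = w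

theorem HasWord.one (τ : Finset ℕ) : HasWord cs τ 0 1 := ⟨[], by simp⟩

variable {cs} in
theorem HasWord.mul {τ : Finset ℕ} {l i : ℕ} {w : W} (h : HasWord cs τ l w) (hi : i ∈ τ) :
    HasWord cs τ (l + 1) (node cs i * w) := by
  obtain ⟨ω, h1, h2, rfl⟩ := h
  refine ⟨i :: ω, by simpa using h1, ?_, by simp⟩
  intro j hj
  rcases List.mem_cons.1 hj with rfl | hj
  exacts [hi, h2 j hj]

variable {cs} in
theorem HasWord.length_le {τ : Finset ℕ} {l : ℕ} {w : W} (h : HasWord cs τ l w) :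
    cs.length w ≤ l := by
  obtain ⟨ω, h1, h2, rfl⟩ := h
  have : (ω.map (node cs)).prod = cs.wordProd (ω.map (Fin.ofNat (n + 1))) := by
    simp only [CoxeterSystem.wordProd, List.map_map]
    rfl
  rw [this]
  exact (cs.length_wordProd_le _).trans (by simpa using h1)

variable {cs} in
theorem HasWord.mem_parabolic {τ : Finset ℕ} (hτ : ∀ x ∈ τ, x ≤ n) {l : ℕ} {w : W}
    (h : HasWord cs τ l w) : w ∈ parabolic cs (toFin n τ) := by
  obtain ⟨ω, h1, h2, rfl⟩ := h
  apply Subgroup.list_prod_mem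
  intro x hx
  obtain ⟨i, hi, rfl⟩ := List.mem_map.1 hx
  exact node_mem_parabolic cs (h2 i hi) (hτ i (h2 i hi))

theorem HasWord.chain {τ : Finset ℕ} {c : ℕ → ℕ} {i : ℕ} (hc : ∀ j, 1 ≤ j → j ≤ i → c j ∈ τ) :
    HasWord cs τ i (chain (fun j => node cs (c j)) i) := by
  induction i with
  | zero => exact HasWord.one cs τ
  | succ i ih => exact (ih fun j h1 h2 => hc j h1 (by omega)).mul (hc _ (by omega) le_rfl)

variable {cs} in
theorem HasWord.bounce {τ : Finset ℕ} {c : ℕ → ℕ} {k l : ℕ} {g : W}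
    (hc : ∀ j, 1 ≤ j → j ≤ k → c j ∈ τ)
    (hg : HasWord cs τ l (g * _root_.chain (fun j => node cs (c j)) k)) {i : ℕ} (hi : i ≤ k) :
    HasWord cs τ (l + i) (bounce (fun j => node cs (c j)) g k i) := by
  induction i with
  | zero => rwa [bounce_zero]
  | succ i ih =>
    rw [bounce_succ]
    exact (ih (by omega)).mul (hc _ (by omega) (by omega))

theorem poin_of_nodes {σ J : Finset ℕ} (hJ : J ⊆ σ) (hσ : ∀ x ∈ σ, x ≤ n)
    (hfin : (parabolic cs (toFin n J) : Set W).Finite) {ι : Type*} [Fintype ι]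
    (r : ι → W) (ht : ι → ℕ) (a₀ : ι) (h₀ : r a₀ = 1) (ht₀ : ht a₀ = 0)
    (hw : ∀ a, HasWord cs σ (ht a) (r a))
    (hcl : ∀ i ∈ σ, ∀ a, ∃ b, ht b ≤ ht a + 1 ∧ ∃ v ∈ parabolic cs (toFin n J),
      node cs i * r a = r b * v)
    {Y : Type*} (ψ : W →* Equiv.Perm Y) (y : Y) (hy : ∀ i ∈ J, ψ (node cs i) y = y)
    (hinj : Function.Injective fun a => ψ (r a) y) :
    (parabolic cs (toFin n σ) : Set W).Finite ∧
      poin cs (toFin n σ) = poin cs (toFin n J) * ∑ a, X ^ ht a := by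
  have hfix : ∀ v ∈ parabolic cs (toFin n J), ψ v y = y := by
    intro v hv
    induction hv using Subgroup.closure_induction with
    | mem x hx =>
      obtain ⟨i, hi, rfl⟩ := hx
      rw [← node_val]
      exact hy _ (mem_toFin.1 hi)
    | one => simp
    | mul x z _ _ hx hz => rw [map_mul, Equiv.Perm.mul_apply, hz, hx]
    | inv x _ hx => rw [map_inv, Equiv.Perm.inv_eq_iff_eq, hx]
  refine poin_eq_mul_of_cosets cs (fun i hi => mem_toFin.2 (hJ (mem_toFin.1 hi))) hfin r ht a₀ h₀
    ht₀ (fun a => (hw a).mem_parabolic hσ) (fun a => (hw a).length_le) ?_ ?_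
  · intro i hi a
    rw [← node_val]
    exact hcl i (mem_toFin.1 hi) a
  · intro a b hab
    apply hinj
    have := hfix _ hab
    rw [map_mul, map_inv, Equiv.Perm.mul_apply, Equiv.Perm.inv_eq_iff_eq] at this
    exact this.symm

theorem poin_chain {σ J : Finset ℕ} (hJ : J ⊆ σ) (hσ : ∀ x ∈ σ, x ≤ n)
    (hfin : (parabolic cs (toFin n J) : Set W).Finite) {c : ℕ → ℕ} {k : ℕ}
    (hc : IsBraidChain (fun j => node cs (c j)) k) (hcσ : ∀ j, 1 ≤ j → j ≤ k → c j ∈ σ)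
    (hcJ : ∀ j, 2 ≤ j → j ≤ k → c j ∈ J)
    (hfar : ∀ i ∈ σ, (∃ j, 1 ≤ j ∧ j ≤ k ∧ i = c j) ∨
      (i ∈ J ∧ ∀ j, 1 ≤ j → j ≤ k → node cs i * node cs (c j) = node cs (c j) * node cs i))
    {Y : Type*} (ψ : W →* Equiv.Perm Y) (y : Y) (hy : ∀ i ∈ J, ψ (node cs i) y = y)
    (P : ℕ → Y) (hP : ∀ i ≤ k, ψ (chain (fun j => node cs (c j)) i) y = P i)
    (hinj : ∀ i ≤ k, ∀ j ≤ k, P i = P j → i = j) :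
    (parabolic cs (toFin n σ) : Set W).Finite ∧
      poin cs (toFin n σ) = poin cs (toFin n J) * ∑ i ∈ Finset.range (k + 1), X ^ i := by
  rw [Finset.sum_range]
  refine poin_of_nodes cs hJ hσ hfin (fun a : Fin (k + 1) => chain (fun j => node cs (c j)) a)
    (fun a => a) 0 rfl rfl (fun a => HasWord.chain cs fun j h1 h2 => hcσ j h1 (by omega)) ?_ ψ y hy
    ?_
  · intro i hi a
    rcases hfar i hi with ⟨j, h1, h2, rfl⟩ | ⟨h1, h2⟩
    · obtain ⟨l, hl, hl', v, hv, e⟩ := hc.mul_chain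
        (fun j h1 h2 => node_mem_parabolic cs (hcJ j h1 h2) (hσ _ (hJ (hcJ j h1 h2)))) h1 h2
        (show a.val ≤ k by omega)
      exact ⟨⟨l, by omega⟩, hl', v, hv, e⟩
    · exact ⟨a, by omega, _, node_mem_parabolic cs h1 (hσ _ hi),
        chain_comm fun j h3 h4 => h2 j h3 (by omega)⟩
  · intro a b hab
    simp only [hP _ (show a.val ≤ k by omega), hP _ (show b.val ≤ k by omega)] at hab
    exact Fin.ext (hinj _ (by omega) _ (by omega) hab)

theorem poin_bounce {σ J : Finset ℕ} (hJ : J ⊆ σ) (hσ : ∀ x ∈ σ, x ≤ n)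
    (hfin : (parabolic cs (toFin n J) : Set W).Finite) {c : ℕ → ℕ} {k m : ℕ}
    (hc : IsBraidChain (fun j => node cs (c j)) k) (hcσ : ∀ j, 1 ≤ j → j ≤ k → c j ∈ σ)
    (hcJ : ∀ j, 2 ≤ j → j ≤ k → c j ∈ J) (hm : m ∈ J)
    (hmc : ∀ j, 1 ≤ j → j < k → node cs m * node cs (c j) = node cs (c j) * node cs m)
    (hmk : node cs m * (node cs (c k) * node cs m * node cs (c k)) =
      node cs (c k) * node cs m * node cs (c k) * node cs m)
    (hfar : ∀ i ∈ σ, (∃ j, 1 ≤ j ∧ j ≤ k ∧ i = c j) ∨ i = m ∨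
      (i ∈ J ∧ node cs i * node cs m = node cs m * node cs i ∧
        ∀ j, 1 ≤ j → j ≤ k → node cs i * node cs (c j) = node cs (c j) * node cs i))
    {Y : Type*} (ψ : W →* Equiv.Perm Y) (y : Y) (hy : ∀ i ∈ J, ψ (node cs i) y = y)
    (P Q : ℕ → Y) (hP : ∀ i ≤ k, ψ (chain (fun j => node cs (c j)) i) y = P i)
    (hQ : ∀ i ≤ k, ψ (bounce (fun j => node cs (c j)) (node cs m) k i) y = Q i)
    (hinj : ∀ i ≤ k, ∀ j ≤ k, P i = P j → i = j) (hinj' : ∀ i ≤ k, ∀ j ≤ k, Q i = Q j → i = j)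
    (hPQ : ∀ i ≤ k, ∀ j ≤ k, P i ≠ Q j) :
    (parabolic cs (toFin n σ) : Set W).Finite ∧
      poin cs (toFin n σ) =
        poin cs (toFin n J) * ∑ i ∈ Finset.range (2 * (k + 1)), X ^ i := by
  have hH : ∀ j, 2 ≤ j → j ≤ k → node cs (c j) ∈ parabolic cs (toFin n J) := fun j h1 h2 =>
    node_mem_parabolic cs (hcJ j h1 h2) (hσ _ (hJ (hcJ j h1 h2)))
  have hsum : ∑ i ∈ Finset.range (2 * (k + 1)), (X : ℚ[X]) ^ i =
      ∑ a : Fin (k + 1) ⊕ Fin (k + 1), X ^ Sum.elim (fun i => i.val) (fun i => k + 1 + i.val) a := by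
    rw [two_mul, Finset.sum_range_add, Fintype.sum_sum_type, Finset.sum_range, Finset.sum_range]
    rfl
  rw [hsum]
  refine poin_of_nodes cs hJ hσ hfin
    (Sum.elim (fun a : Fin (k + 1) => chain (fun j => node cs (c j)) a)
      (fun a : Fin (k + 1) => bounce (fun j => node cs (c j)) (node cs m) k a))
    _ (Sum.inl 0) rfl rfl ?_ ?_ ψ y hy ?_
  · rintro (a | a)
    · exact HasWord.chain cs (i := a.val) fun j h1 h2 => hcσ j h1 (by omega)
    · exact HasWord.bounce hcσ ((HasWord.chain cs hcσ).mul (hJ hm)) (by omega)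
  · intro i hi a
    rcases hfar i hi with ⟨j, h1, h2, rfl⟩ | rfl | ⟨h1, h2, h3⟩
    · rcases a with a | a
      · obtain ⟨l, hl, hl', v, hv, e⟩ := hc.mul_chain hH h1 h2 (show a.val ≤ k by omega)
        exact ⟨Sum.inl ⟨l, by omega⟩, hl', v, hv, e⟩
      · obtain ⟨l, hl, hl', v, hv, e⟩ := hc.mul_bounce hmc hH h1 h2 (show a.val ≤ k by omega)
        exact ⟨Sum.inr ⟨l, by omega⟩, by simp; omega, v, hv, e⟩
    · rcases a with a | a
      · rcases Nat.lt_or_ge a.val k with h | h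
        · exact ⟨Sum.inl a, by omega, _, node_mem_parabolic cs hm (hσ _ hi),
            chain_comm (i := a.val) fun j h3 h4 => hmc j h3 (by omega)⟩
        · refine ⟨Sum.inr 0, by simp; omega, 1, Subgroup.one_mem _, ?_⟩
          have : a.val = k := by omega
          simp [bounce_zero, this]
      · rcases Nat.eq_zero_or_pos a.val with h | h
        · refine ⟨Sum.inl ⟨k, by omega⟩, by simp; omega, 1, Subgroup.one_mem _, ?_⟩
          simp [h, bounce_zero, ← mul_assoc, node_mul_self]
        · exact ⟨Sum.inr a, by omega, _, node_mem_parabolic cs hm (hσ _ hi),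
            mul_bounce_of_swap hmc hmc hmk h (by omega)⟩
    · have hmem := node_mem_parabolic cs h1 (hσ _ hi)
      have hch : ∀ l ≤ k, node cs i * chain (fun j => node cs (c j)) l =
          chain (fun j => node cs (c j)) l * node cs i := fun l hl =>
        chain_comm fun j h5 h6 => h3 j h5 (by omega)
      have hch' : ∀ l ≤ k, node cs i * chain (fun j => node cs (c (k + 1 - j))) l =
          chain (fun j => node cs (c (k + 1 - j))) l * node cs i := fun l hl =>
        chain_comm fun j h5 h6 => h3 (k + 1 - j) (by omega) (by omega)
      rcases a with a | a
      · exact ⟨Sum.inl a, by omega, _, hmem, hch _ (by omega)⟩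
      · refine ⟨Sum.inr a, by omega, _, hmem, ?_⟩
        simp only [Sum.elim_inr, bounce]
        rw [← mul_assoc, ← mul_assoc, hch' _ (by omega), mul_assoc (chain _ _) _ (node cs m), h2,
          ← mul_assoc, mul_assoc, hch _ le_rfl, ← mul_assoc]
  · rintro (a | a) (b | b) hab
    · simp only [Sum.elim_inl, hP _ (show a.val ≤ k by omega),
        hP _ (show b.val ≤ k by omega)] at hab
      rw [Fin.ext (hinj _ (by omega) _ (by omega) hab)]
    · simp only [Sum.elim_inl, Sum.elim_inr, hP _ (show a.val ≤ k by omega),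
        hQ _ (show b.val ≤ k by omega)] at hab
      exact absurd hab (hPQ _ (by omega) _ (by omega))
    · simp only [Sum.elim_inl, Sum.elim_inr, hQ _ (show a.val ≤ k by omega),
        hP _ (show b.val ≤ k by omega)] at hab
      exact absurd hab.symm (hPQ _ (by omega) _ (by omega))
    · simp only [Sum.elim_inr, hQ _ (show a.val ≤ k by omega),
        hQ _ (show b.val ≤ k by omega)] at hab
      rw [Fin.ext (hinj' _ (by omega) _ (by omega) hab)]

theorem poin_fork {σ J : Finset ℕ} (hJ : J ⊆ σ) (hσ : ∀ x ∈ σ, x ≤ n)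
    (hfin : (parabolic cs (toFin n J) : Set W).Finite) {c : ℕ → ℕ} {k m m' : ℕ} (hk : 1 ≤ k)
    (hc : IsBraidChain (fun j => node cs (c j)) k) (hcσ : ∀ j, 1 ≤ j → j ≤ k → c j ∈ σ)
    (hcJ : ∀ j, 2 ≤ j → j ≤ k → c j ∈ J) (hm : m ∈ J) (hm' : m' ∈ J)
    (hmm : node cs m * node cs m' = node cs m' * node cs m)
    (hmc : ∀ j, 1 ≤ j → j < k → node cs m * node cs (c j) = node cs (c j) * node cs m)
    (hmc' : ∀ j, 1 ≤ j → j < k → node cs m' * node cs (c j) = node cs (c j) * node cs m')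
    (hmk : node cs m * node cs (c k) * node cs m = node cs (c k) * node cs m * node cs (c k))
    (hmk' : node cs m' * node cs (c k) * node cs m' = node cs (c k) * node cs m' * node cs (c k))
    (hfar : ∀ i ∈ σ, (∃ j, 1 ≤ j ∧ j ≤ k ∧ i = c j) ∨ i = m ∨ i = m' ∨
      (i ∈ J ∧ node cs i * node cs m = node cs m * node cs i ∧
        node cs i * node cs m' = node cs m' * node cs i ∧
        ∀ j, 1 ≤ j → j ≤ k → node cs i * node cs (c j) = node cs (c j) * node cs i))
    {Y : Type*} (ψ : W →* Equiv.Perm Y) (y : Y) (hy : ∀ i ∈ J, ψ (node cs i) y = y)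
    (P Q : ℕ → Y) (z z' : Y) (hP : ∀ i ≤ k, ψ (chain (fun j => node cs (c j)) i) y = P i)
    (hQ : ∀ i ≤ k, ψ (bounce (fun j => node cs (c j)) (node cs m * node cs m') k i) y = Q i)
    (hz : ψ (node cs m * chain (fun j => node cs (c j)) k) y = z)
    (hz' : ψ (node cs m' * chain (fun j => node cs (c j)) k) y = z')
    (hinj : ∀ i ≤ k, ∀ j ≤ k, P i = P j → i = j) (hinj' : ∀ i ≤ k, ∀ j ≤ k, Q i = Q j → i = j)
    (hPQ : ∀ i ≤ k, ∀ j ≤ k, P i ≠ Q j) (hPz : ∀ i ≤ k, P i ≠ z) (hPz' : ∀ i ≤ k, P i ≠ z')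
    (hQz : ∀ i ≤ k, Q i ≠ z) (hQz' : ∀ i ≤ k, Q i ≠ z') (hzz : z ≠ z') :
    (parabolic cs (toFin n σ) : Set W).Finite ∧
      poin cs (toFin n σ) = poin cs (toFin n J) *
        ((1 + X ^ (k + 1)) * ∑ i ∈ Finset.range (k + 2), X ^ i) := by
  have hH : ∀ j, 2 ≤ j → j ≤ k → node cs (c j) ∈ parabolic cs (toFin n J) := fun j h1 h2 =>
    node_mem_parabolic cs (hcJ j h1 h2) (hσ _ (hJ (hcJ j h1 h2)))
  have hg : ∀ j, 1 ≤ j → j < k → node cs m * node cs m' * node cs (c j) =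
      node cs (c j) * (node cs m * node cs m') := by
    intro j h1 h2
    rw [mul_assoc, hmc' j h1 h2, ← mul_assoc, hmc j h1 h2, mul_assoc]
  have hsw : ∀ m m', node cs m * node cs m' = node cs m' * node cs m →
      node cs m * node cs (c k) * node cs m = node cs (c k) * node cs m * node cs (c k) →
      node cs m' * node cs (c k) * node cs m' = node cs (c k) * node cs m' * node cs (c k) →
      node cs m * (node cs (c k) * (node cs m * node cs m') * node cs (c k)) =
        node cs (c k) * (node cs m * node cs m') * node cs (c k) * node cs m' := by
    intro m m' h1 h2 h3
    calc _ = node cs m * node cs (c k) * node cs m * (node cs m' * node cs (c k)) := by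
          simp only [mul_assoc]
      _ = node cs (c k) * node cs m * (node cs (c k) * node cs m' * node cs (c k)) := by
          rw [h2]; simp only [mul_assoc]
      _ = _ := by rw [← h3]; simp only [mul_assoc]
  have hE : ∀ m m', node cs m' ∈ parabolic cs (toFin n J) → node cs m ∈ parabolic cs (toFin n J) →
      node cs m * node cs m' = node cs m' * node cs m →
      (∀ j, 1 ≤ j → j < k → node cs m * node cs (c j) = node cs (c j) * node cs m) →
      node cs m * node cs (c k) * node cs m = node cs (c k) * node cs m * node cs (c k) →
      ∀ j, 1 ≤ j → j ≤ k → ∃ v ∈ parabolic cs (toFin n J),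
        node cs (c j) * (node cs m * chain (fun j => node cs (c j)) k) =
          node cs m * chain (fun j => node cs (c j)) k * v := by
    intro m m' _ hmem h1 h2 h3 j h4 h5
    rcases Nat.lt_or_ge j k with h | h
    · refine ⟨_, hH (j + 1) (by omega) (by omega), ?_⟩
      rw [← mul_assoc, ← h2 j h4 h, mul_assoc, hc.mul_chain_of_lt h4 h le_rfl, mul_assoc]
    · obtain rfl : j = k := by omega
      obtain ⟨k, rfl⟩ : ∃ l, j = l + 1 := ⟨j - 1, by omega⟩
      refine ⟨_, hmem, ?_⟩
      have h6 : node cs m * chain (fun j => node cs (c j)) k =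
          chain (fun j => node cs (c j)) k * node cs m :=
        chain_comm fun j h7 h8 => h2 j h7 (by omega)
      rw [chain, ← mul_assoc, ← mul_assoc, ← h3, mul_assoc _ (node cs m), h6]
      simp only [mul_assoc]
  have hsum : ((1 + X ^ (k + 1)) * ∑ i ∈ Finset.range (k + 2), X ^ i : ℚ[X]) =
      ∑ a : Fin (k + 1) ⊕ Bool ⊕ Fin (k + 1),
        X ^ Sum.elim (fun i => i.val) (Sum.elim (fun _ => k + 1) (fun i => k + 2 + i.val)) a := by
    rw [Fintype.sum_sum_type, Fintype.sum_sum_type, one_add_mul]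
    simp only [Sum.elim_inl, Sum.elim_inr, Fintype.sum_bool, pow_add]
    rw [← Finset.mul_sum, ← Finset.sum_range fun i => (X : ℚ[X]) ^ i]
    have h1 := Finset.sum_range_succ (fun i => (X : ℚ[X]) ^ i) (k + 1)
    have h2 := geom_sum_succ (x := (X : ℚ[X])) (n := k + 1)
    linear_combination h1 + X ^ (k + 1) * h2
  rw [hsum]
  refine poin_of_nodes cs hJ hσ hfin
    (Sum.elim (fun a : Fin (k + 1) => chain (fun j => node cs (c j)) a)
      (Sum.elim (fun b : Bool => (bif b then node cs m else node cs m') *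
          chain (fun j => node cs (c j)) k)
        (fun a : Fin (k + 1) => bounce (fun j => node cs (c j)) (node cs m * node cs m') k a)))
    _ (Sum.inl 0) rfl rfl ?_ ?_ ψ y hy ?_
  · rintro (a | b | a)
    · exact HasWord.chain cs (i := a.val) fun j h1 h2 => hcσ j h1 (by omega)
    · cases b
      · exact (HasWord.chain cs hcσ).mul (hJ hm')
      · exact (HasWord.chain cs hcσ).mul (hJ hm)
    · refine HasWord.bounce hcσ ?_ (by omega)
      rw [mul_assoc]
      exact ((HasWord.chain cs hcσ).mul (hJ hm')).mul (hJ hm)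
  · intro i hi a
    rcases hfar i hi with ⟨j, h1, h2, rfl⟩ | h | h | ⟨h1, h2, h2', h3⟩
    · rcases a with a | b | a
      · obtain ⟨l, hl, hl', v, hv, e⟩ := hc.mul_chain hH h1 h2 (show a.val ≤ k by omega)
        exact ⟨Sum.inl ⟨l, by omega⟩, hl', v, hv, e⟩
      · refine ⟨Sum.inr (Sum.inl b), by simp, ?_⟩
        have hmemm := node_mem_parabolic cs hm (hσ _ (hJ hm))
        have hmemm' := node_mem_parabolic cs hm' (hσ _ (hJ hm'))
        cases b
        · exact hE m' m hmemm hmemm' hmm.symm hmc' hmk' j h1 h2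
        · exact hE m m' hmemm' hmemm hmm hmc hmk j h1 h2
      · obtain ⟨l, hl, hl', v, hv, e⟩ := hc.mul_bounce hg hH h1 h2 (show a.val ≤ k by omega)
        exact ⟨Sum.inr (Sum.inr ⟨l, by omega⟩), by simp; omega, v, hv, e⟩
    · subst h
      rcases a with a | b | a
      · rcases Nat.lt_or_ge a.val k with h | h
        · exact ⟨Sum.inl a, by omega, _, node_mem_parabolic cs hm (hσ _ hi),
            chain_comm (i := a.val) fun j h3 h4 => hmc j h3 (by omega)⟩
        · refine ⟨Sum.inr (Sum.inl true), by simp; omega, 1, Subgroup.one_mem _, ?_⟩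
          have : a.val = k := by omega
          simp [this]
      · cases b
        · refine ⟨Sum.inr (Sum.inr 0), by simp, 1, Subgroup.one_mem _, ?_⟩
          simp [bounce_zero, mul_assoc]
        · refine ⟨Sum.inl ⟨k, by omega⟩, by simp; omega, 1, Subgroup.one_mem _, ?_⟩
          simp [← mul_assoc, node_mul_self]
      · rcases Nat.eq_zero_or_pos a.val with h | h
        · refine ⟨Sum.inr (Sum.inl false), by simp; omega, 1, Subgroup.one_mem _, ?_⟩
          simp [h, bounce_zero, ← mul_assoc, node_mul_self]
        · exact ⟨Sum.inr (Sum.inr a), by omega, _, node_mem_parabolic cs hm' (hσ _ (hJ hm')),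
            mul_bounce_of_swap hmc hmc' (hsw _ _ hmm hmk hmk') h (by omega)⟩
    · subst h
      rcases a with a | b | a
      · rcases Nat.lt_or_ge a.val k with h | h
        · exact ⟨Sum.inl a, by omega, _, node_mem_parabolic cs hm' (hσ _ hi),
            chain_comm (i := a.val) fun j h3 h4 => hmc' j h3 (by omega)⟩
        · refine ⟨Sum.inr (Sum.inl false), by simp; omega, 1, Subgroup.one_mem _, ?_⟩
          have : a.val = k := by omega
          simp [this]
      · cases b
        · refine ⟨Sum.inl ⟨k, by omega⟩, by simp; omega, 1, Subgroup.one_mem _, ?_⟩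
          simp [← mul_assoc, node_mul_self]
        · refine ⟨Sum.inr (Sum.inr 0), by simp, 1, Subgroup.one_mem _, ?_⟩
          simp [bounce_zero, ← mul_assoc, hmm]
      · rcases Nat.eq_zero_or_pos a.val with h | h
        · refine ⟨Sum.inr (Sum.inl true), by simp; omega, 1, Subgroup.one_mem _, ?_⟩
          simp [h, bounce_zero, ← mul_assoc, node_mul_self, hmm]
        · refine ⟨Sum.inr (Sum.inr a), by omega, _, node_mem_parabolic cs hm (hσ _ (hJ hm)), ?_⟩
          simp only [Sum.elim_inr]
          rw [hmm]
          exact mul_bounce_of_swap hmc' hmc (hsw _ _ hmm.symm hmk' hmk) h (by omega)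
    · have hmem := node_mem_parabolic cs h1 (hσ _ hi)
      have hch : ∀ l ≤ k, node cs i * chain (fun j => node cs (c j)) l =
          chain (fun j => node cs (c j)) l * node cs i := fun l hl =>
        chain_comm fun j h5 h6 => h3 j h5 (by omega)
      have hch' : ∀ l ≤ k, node cs i * chain (fun j => node cs (c (k + 1 - j))) l =
          chain (fun j => node cs (c (k + 1 - j))) l * node cs i := fun l hl =>
        chain_comm fun j h5 h6 => h3 (k + 1 - j) (by omega) (by omega)
      have h4 : node cs i * (node cs m * node cs m') = node cs m * node cs m' * node cs i := by
        rw [← mul_assoc, h2, mul_assoc, h2', mul_assoc]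
      rcases a with a | b | a
      · exact ⟨Sum.inl a, by omega, _, hmem, hch _ (by omega)⟩
      · refine ⟨Sum.inr (Sum.inl b), by omega, _, hmem, ?_⟩
        cases b
        · simp only [Sum.elim_inr, Sum.elim_inl, cond_false]
          rw [← mul_assoc, h2', mul_assoc, hch _ le_rfl, mul_assoc]
        · simp only [Sum.elim_inr, Sum.elim_inl, cond_true]
          rw [← mul_assoc, h2, mul_assoc, hch _ le_rfl, mul_assoc]
      · refine ⟨Sum.inr (Sum.inr a), by omega, _, hmem, ?_⟩
        simp only [Sum.elim_inr, bounce]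
        rw [← mul_assoc, ← mul_assoc, hch' _ (by omega), mul_assoc (chain _ _) _ (_ * _), h4,
          ← mul_assoc, mul_assoc, hch _ le_rfl, ← mul_assoc]
  · have hEv : ∀ b : Bool, ψ ((bif b then node cs m else node cs m') *
        chain (fun j => node cs (c j)) k) y = bif b then z else z' := by
      rintro (_ | _)
      · exact hz'
      · exact hz
    have hPE : ∀ b : Bool, ∀ i ≤ k, P i ≠ bif b then z else z' := by
      rintro (_ | _)
      · exact hPz'
      · exact hPz
    have hQE : ∀ b : Bool, ∀ i ≤ k, Q i ≠ bif b then z else z' := by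
      rintro (_ | _)
      · exact hQz'
      · exact hQz
    rintro (a | a | a) (b | b | b) hab
    · simp only [Sum.elim_inl, hP _ (show a.val ≤ k by omega),
        hP _ (show b.val ≤ k by omega)] at hab
      rw [Fin.ext (hinj _ (by omega) _ (by omega) hab)]
    · simp only [Sum.elim_inl, Sum.elim_inr, hP _ (show a.val ≤ k by omega), hEv] at hab
      exact absurd hab (hPE _ _ (by omega))
    · simp only [Sum.elim_inl, Sum.elim_inr, hP _ (show a.val ≤ k by omega),
        hQ _ (show b.val ≤ k by omega)] at hab
      exact absurd hab (hPQ _ (by omega) _ (by omega))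
    · simp only [Sum.elim_inl, Sum.elim_inr, hP _ (show b.val ≤ k by omega), hEv] at hab
      exact absurd hab.symm (hPE _ _ (by omega))
    · simp only [Sum.elim_inl, Sum.elim_inr, hEv] at hab
      cases a <;> cases b
      · rfl
      · exact absurd hab.symm hzz
      · exact absurd hab hzz
      · rfl
    · simp only [Sum.elim_inl, Sum.elim_inr, hQ _ (show b.val ≤ k by omega), hEv] at hab
      exact absurd hab.symm (hQE _ _ (by omega))
    · simp only [Sum.elim_inl, Sum.elim_inr, hQ _ (show a.val ≤ k by omega),
        hP _ (show b.val ≤ k by omega)] at hab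
      exact absurd hab.symm (hPQ _ (by omega) _ (by omega))
    · simp only [Sum.elim_inl, Sum.elim_inr, hQ _ (show a.val ≤ k by omega), hEv] at hab
      exact absurd hab (hQE _ _ (by omega))
    · simp only [Sum.elim_inr, hQ _ (show a.val ≤ k by omega),
        hQ _ (show b.val ≤ k by omega)] at hab
      rw [Fin.ext (hinj' _ (by omega) _ (by omega) hab)]

end NodeCosets

section AffineBCosets

open scoped Pointwise

variable {n : ℕ} {W : Type*} [Group W] {Mat : CoxeterMatrix (Fin (n + 1))}
  (cs : CoxeterSystem Mat W)

/-- The node in position `p` of the path of nodes that starts at `b`, where `b` is `0` or `1`. -/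
def pathNode (b p : ℕ) : ℕ := if p = 1 then b else p

/-- The signed coordinate that the path of nodes starting at `b` moves to `p`. -/
def pathCoord (b p : ℕ) : ℤ := if p = 1 ∧ b = 0 then -1 else p

theorem pathNode_comm (hM : ∀ i j : Fin (n + 1), i.val < j.val → Mat.M i j = affBEntry n i.val j.val)
    {b p q : ℕ} (hb : b ≤ 1) (hp : 1 ≤ p) (hpq : p + 1 < q) (hq : q ≤ n) :
    node cs (pathNode b p) * node cs (pathNode b q) =
      node cs (pathNode b q) * node cs (pathNode b p) := by
  unfold pathNode
  apply node_comm cs hM <;> (try unfold affBEntry) <;> split_ifs <;> omega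

theorem pathNode_braid
    (hM : ∀ i j : Fin (n + 1), i.val < j.val → Mat.M i j = affBEntry n i.val j.val)
    {b p : ℕ} (hb : b ≤ 1) (hp : 1 ≤ p) (hq : p + 1 < n) :
    node cs (pathNode b p) * node cs (pathNode b (p + 1)) * node cs (pathNode b p) =
      node cs (pathNode b (p + 1)) * node cs (pathNode b p) * node cs (pathNode b (p + 1)) := by
  unfold pathNode
  apply node_braid cs hM <;> (try unfold affBEntry) <;> split_ifs <;> omega

theorem pathChain (hM : ∀ i j : Fin (n + 1), i.val < j.val → Mat.M i j = affBEntry n i.val j.val)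
    {b x k : ℕ} (hb : b ≤ 1) (hx : 1 ≤ x) (hk : x + k ≤ n ∨ k ≤ 1 ∧ x ≤ n) :
    IsBraidChain (fun j => node cs (pathNode b (x + j - 1))) k where
  mul_self j := node_mul_self cs _
  comm i j h1 h2 h3 := by
    apply pathNode_comm cs hM <;> omega
  braid i h1 h2 := by
    have := pathNode_braid cs hM (b := b) (p := x + i - 1) hb (by omega) (by omega)
    rwa [show x + i - 1 + 1 = x + (i + 1) - 1 by omega] at this

theorem nodeSwap_pathCoord {b p : ℕ} (hb : b ≤ 1) (hp : 1 ≤ p) (hpn : p < n) (y : ℤ × ℤ)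
    (hy : y.1 = pathCoord b p) : (nodeSwap n (pathNode b p) y).1 = pathCoord b (p + 1) := by
  obtain ⟨u, z⟩ := y
  simp only at hy
  subst hy
  simp only [nodeSwap, signedSwap, nodeFst, nodeSnd, nodeShift, pathNode, pathCoord]
  grind

theorem nodeSwap_neg_pathCoord {b p : ℕ} (hb : b ≤ 1) (hp : 1 ≤ p) (hpn : p < n) (y : ℤ × ℤ)
    (hy : y.1 = -pathCoord b (p + 1)) : (nodeSwap n (pathNode b p) y).1 = -pathCoord b p := by
  obtain ⟨u, z⟩ := y
  simp only at hy
  subst hy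
  simp only [nodeSwap, signedSwap, nodeFst, nodeSnd, nodeShift, pathNode, pathCoord]
  grind

theorem nodeAction_pathChain (hn : 3 ≤ n)
    (hM : ∀ i j : Fin (n + 1), i.val < j.val → Mat.M i j = affBEntry n i.val j.val)
    {b x : ℕ} (hb : b ≤ 1) (hx : 1 ≤ x) {i : ℕ} (hi : x + i ≤ n) :
    (nodeAction cs hn hM (chain (fun j => node cs (pathNode b (x + j - 1))) i)
      (pathCoord b x, 0)).1 = pathCoord b (x + i) := by
  induction i with
  | zero => simp [chain]
  | succ i ih =>
    rw [chain, map_mul, Equiv.Perm.mul_apply, nodeAction_node]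
    · have := nodeSwap_pathCoord (n := n) hb (show 1 ≤ x + i by omega) (by omega) _ (ih (by omega))
      rwa [show x + (i + 1) - 1 = x + i by omega]
    · unfold pathNode; split_ifs <;> omega

theorem nodeSwap_fix {i x : ℕ} (hn : 3 ≤ n) {b : ℕ} (hx : 1 ≤ x) (hxi : x < i) (z : ℤ) :
    nodeSwap n i (pathCoord b x, z) = (pathCoord b x, z) := by
  simp only [nodeSwap, signedSwap, nodeFst, nodeSnd, nodeShift, pathCoord]
  grind

theorem pathCoord_inj {b x y : ℕ} (h : pathCoord b x = pathCoord b y) : x = y := by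
  unfold pathCoord at h
  split_ifs at h <;> omega

theorem pathCoord_ne_neg {b x y : ℕ} (hx : 1 ≤ x) : pathCoord b x ≠ -pathCoord b y := by
  unfold pathCoord
  split_ifs <;> omega

theorem mem_image_pathNode {b : ℕ} {τ : Finset ℕ} (p : ℕ) (hp : p ∈ τ) :
    pathNode b p ∈ τ.image (pathNode b) := Finset.mem_image_of_mem _ hp

/-- Adding a leftmost node whose run of neighbours stops before a gap. -/
theorem poin_insert_path (hn : 3 ≤ n)
    (hM : ∀ i j : Fin (n + 1), i.val < j.val → Mat.M i j = affBEntry n i.val j.val)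
    {b x g : ℕ} (hb : b ≤ 1) (hx : 1 ≤ x) (hxg : x < g) (hg : g ≤ n ∨ x = n ∧ g = n + 1)
    {J : Finset ℕ} (hJ : ∀ y ∈ J, x < y ∧ y ≤ n) (hrun : ∀ y, x < y → y < g → y ∈ J)
    (hgap : g ∉ J) (hfin : (parabolic cs (toFin n (J.image (pathNode b))) : Set W).Finite) :
    (parabolic cs (toFin n ((insert x J).image (pathNode b))) : Set W).Finite ∧
      poin cs (toFin n ((insert x J).image (pathNode b))) =
        poin cs (toFin n (J.image (pathNode b))) * ∑ i ∈ Finset.range (g - x + 1), X ^ i := by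
  have hmem : ∀ p, x ≤ p → p < g → p ∈ insert x J := fun p h1 h2 => by
    rcases h1.eq_or_lt with rfl | h
    · exact Finset.mem_insert_self _ _
    · exact Finset.mem_insert_of_mem (hrun p h h2)
  refine poin_chain cs (k := g - x) (c := fun j => pathNode b (x + j - 1))
    (Finset.image_subset_image (Finset.subset_insert _ _)) ?_ hfin
    (pathChain cs hM hb hx (by omega)) ?_ ?_ ?_ (nodeAction cs hn hM) (pathCoord b x, 0) ?_ _
    (fun i _ => rfl) ?_
  · intro y hy
    obtain ⟨p, hp, rfl⟩ := Finset.mem_image.1 hy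
    have : p ≤ n := by
      rcases Finset.mem_insert.1 hp with rfl | hp
      · omega
      · exact (hJ p hp).2
    unfold pathNode; split_ifs <;> omega
  · exact fun j h1 h2 => mem_image_pathNode _ (hmem _ (by omega) (by omega))
  · exact fun j h1 h2 => mem_image_pathNode _ (hrun _ (by omega) (by omega))
  · intro i hi
    obtain ⟨p, hp, rfl⟩ := Finset.mem_image.1 hi
    rcases Nat.lt_or_ge p g with h | h
    · left
      have : x ≤ p := by
        rcases Finset.mem_insert.1 hp with rfl | hp
        · exact le_rfl
        · exact (hJ p hp).1.le
      exact ⟨p - x + 1, by omega, by omega, by congr 1; omega⟩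
    · right
      have hpJ : p ∈ J := Finset.mem_of_mem_insert_of_ne hp (by omega)
      refine ⟨mem_image_pathNode _ hpJ, fun j h1 h2 => ?_⟩
      have : p ≠ g := fun e => hgap (e ▸ hpJ)
      exact (pathNode_comm cs hM hb (by omega) (by omega) (hJ p hpJ).2).symm
  · intro i hi
    obtain ⟨p, hp, rfl⟩ := Finset.mem_image.1 hi
    have := hJ p hp
    have e : pathNode b p = p := by unfold pathNode; split_ifs <;> omega
    rw [e, nodeAction_node _ _ _ this.2, nodeSwap_fix hn hx this.1]
  · intro i hi j hj hij
    rcases hg with hg | ⟨rfl, rfl⟩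
    · have h1 := nodeAction_pathChain cs hn hM hb hx (i := i) (by omega)
      have h2 := nodeAction_pathChain cs hn hM hb hx (i := j) (by omega)
      rw [hij] at h1
      have := pathCoord_inj (h1.symm.trans h2)
      omega
    · have h1 : nodeAction cs hn hM (chain (fun j => node cs (pathNode b (x + j - 1))) 1)
          (pathCoord b x, 0) ≠ (pathCoord b x, 0) := by
        have e : pathNode b x = x := by unfold pathNode; split_ifs <;> omega
        have e' : pathCoord b x = x := by unfold pathCoord; split_ifs <;> omega
        simp only [chain, mul_one, Nat.add_sub_cancel, zero_add]
        rw [e, e', nodeAction_node _ _ _ le_rfl]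
        simp only [nodeSwap, signedSwap, nodeFst, nodeSnd, nodeShift]
        grind
      have h0 : nodeAction cs hn hM (chain (fun j => node cs (pathNode b (x + j - 1))) 0)
          (pathCoord b x, 0) = (pathCoord b x, 0) := by simp [chain]
      rcases (show i = 0 ∨ i = 1 by omega) with rfl | rfl <;>
        rcases (show j = 0 ∨ j = 1 by omega) with rfl | rfl
      · rfl
      · exact absurd (hij.symm.trans h0) h1
      · exact absurd (hij.trans h0) h1
      · rfl

/-- Adding a leftmost node whose run of neighbours reaches the end of the path. -/
theorem poin_insert_tail (hn : 3 ≤ n)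
    (hM : ∀ i j : Fin (n + 1), i.val < j.val → Mat.M i j = affBEntry n i.val j.val)
    {b x : ℕ} (hb : b ≤ 1) (hx : 1 ≤ x) (hxn : x < n) {J : Finset ℕ} (hJ : ∀ y, y ∈ J ↔ x < y ∧ y ≤ n)
    (hfin : (parabolic cs (toFin n (J.image (pathNode b))) : Set W).Finite) :
    (parabolic cs (toFin n ((insert x J).image (pathNode b))) : Set W).Finite ∧
      poin cs (toFin n ((insert x J).image (pathNode b))) =
        poin cs (toFin n (J.image (pathNode b))) *
          ∑ i ∈ Finset.range (2 * (n + 1 - x)), X ^ i := by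
  have hmem : ∀ p, p ∈ insert x J ↔ x ≤ p ∧ p ≤ n := fun p => by
    rw [Finset.mem_insert, hJ]; omega
  have hpn : pathNode b n = n := by unfold pathNode; split_ifs <;> omega
  have hQ : ∀ i ≤ n - x, (nodeAction cs hn hM
      (bounce (fun j => node cs (pathNode b (x + j - 1))) (node cs n) (n - x) i)
      (pathCoord b x, 0)).1 = -pathCoord b (n - i) := by
    intro i hi
    induction i with
    | zero =>
      have h1 := nodeAction_pathChain cs hn hM hb hx (i := n - x) (by omega)
      rw [bounce_zero, map_mul, Equiv.Perm.mul_apply, nodeAction_node _ _ _ le_rfl]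
      generalize nodeAction cs hn hM _ _ = y at h1 ⊢
      obtain ⟨u, z⟩ := y
      simp only at h1
      subst h1
      simp only [nodeSwap, signedSwap, nodeFst, nodeSnd, nodeShift, pathCoord]
      grind
    | succ i ih =>
      rw [bounce_succ, map_mul, Equiv.Perm.mul_apply, nodeAction_node]
      · have := nodeSwap_neg_pathCoord hb (n := n) (p := n - (i + 1)) (by omega) (by omega) _
          ((ih (by omega)).trans (by congr 2; omega))
        rwa [show x + (n - x - i) - 1 = n - (i + 1) by omega]
      · unfold pathNode; split_ifs <;> omega
  rw [show n + 1 - x = n - x + 1 by omega]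
  refine poin_bounce cs (k := n - x) (m := n) (c := fun j => pathNode b (x + j - 1))
    (Finset.image_subset_image (Finset.subset_insert _ _)) ?_ hfin
    (pathChain cs hM hb hx (by omega)) ?_ ?_ ?_ ?_ ?_ ?_ (nodeAction cs hn hM) (pathCoord b x, 0) ?_
    _ _ (fun i _ => rfl) (fun i _ => rfl) ?_ ?_ ?_
  · intro y hy
    obtain ⟨p, hp, rfl⟩ := Finset.mem_image.1 hy
    have := (hmem p).1 hp
    unfold pathNode; split_ifs <;> omega
  · exact fun j h1 h2 => mem_image_pathNode _ ((hmem _).2 (by omega))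
  · exact fun j h1 h2 => mem_image_pathNode _ ((hJ _).2 (by omega))
  · exact hpn ▸ mem_image_pathNode _ ((hJ n).2 (by omega))
  · intro j h1 h2
    have := pathNode_comm cs hM hb (p := x + j - 1) (q := n) (by omega) (by omega) le_rfl
    rw [hpn] at this
    exact this.symm
  · have := node_braid_four cs hM (i := n - 1) (j := n) (by omega) le_rfl
      (by unfold affBEntry; split_ifs <;> omega)
    have e : pathNode b (x + (n - x) - 1) = n - 1 := by unfold pathNode; split_ifs <;> omega
    rw [e, this]
    simp only [mul_assoc]
  · intro i hi
    obtain ⟨p, hp, rfl⟩ := Finset.mem_image.1 hi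
    have := (hmem p).1 hp
    rcases this.2.eq_or_lt with rfl | h
    · exact Or.inr (Or.inl hpn)
    · exact Or.inl ⟨p - x + 1, by omega, by omega, by congr 1; omega⟩
  · intro i hi
    obtain ⟨p, hp, rfl⟩ := Finset.mem_image.1 hi
    have := (hJ p).1 hp
    have e : pathNode b p = p := by unfold pathNode; split_ifs <;> omega
    rw [e, nodeAction_node _ _ _ this.2, nodeSwap_fix hn hx this.1]
  · intro i hi j hj hij
    have h1 := nodeAction_pathChain cs hn hM hb hx (i := i) (by omega)
    have h2 := nodeAction_pathChain cs hn hM hb hx (i := j) (by omega)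
    rw [hij] at h1
    have := pathCoord_inj (h1.symm.trans h2)
    omega
  · intro i hi j hj hij
    have h1 := hQ i hi
    rw [hij] at h1
    have := pathCoord_inj (neg_injective (h1.symm.trans (hQ j hj)))
    omega
  · intro i hi j hj hij
    have h1 := nodeAction_pathChain cs hn hM hb hx (i := i) (by omega)
    rw [hij] at h1
    exact pathCoord_ne_neg (by omega) (h1.symm.trans (hQ j hj))

theorem node_far (hM : ∀ i j : Fin (n + 1), i.val < j.val → Mat.M i j = affBEntry n i.val j.val)
    {p m q : ℕ} (hm : 2 ≤ m) (hp : p < m) (hmq : m < q) (hq : q ≤ n) :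
    node cs q * node cs p = node cs p * node cs q := by
  refine (node_comm cs hM (by omega) hq ?_).symm
  unfold affBEntry
  split_ifs <;> omega

/-- Adding the node after the end of a diagram of type `D`. -/
theorem poin_insert_fork (hn : 3 ≤ n)
    (hM : ∀ i j : Fin (n + 1), i.val < j.val → Mat.M i j = affBEntry n i.val j.val)
    {m : ℕ} (hm3 : 3 ≤ m) (hmn : m ≤ n) {J : Finset ℕ} (hJ : ∀ y ∈ J, m < y ∧ y ≤ n)
    (hfin : (parabolic cs (toFin n (Finset.range (m - 1) ∪ J)) : Set W).Finite) :
    (parabolic cs (toFin n (Finset.range m ∪ J)) : Set W).Finite ∧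
      poin cs (toFin n (Finset.range m ∪ J)) =
        poin cs (toFin n (Finset.range (m - 1) ∪ J)) *
          ((1 + X ^ (m - 1)) * ∑ i ∈ Finset.range m, X ^ i) := by
  have hmemσ : ∀ i, i < m → i ∈ Finset.range m ∪ J := fun i hi =>
    Finset.mem_union_left _ (Finset.mem_range.2 hi)
  have hmemJ : ∀ i, i < m - 1 → i ∈ Finset.range (m - 1) ∪ J := fun i hi =>
    Finset.mem_union_left _ (Finset.mem_range.2 hi)
  have h01 : node cs 0 * node cs 1 = node cs 1 * node cs 0 :=
    node_comm cs hM (by omega) (by omega) (by unfold affBEntry; split_ifs <;> omega)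
  have hc : IsBraidChain (fun j => node cs (m - j)) (m - 2) :=
    { mul_self := fun j => node_mul_self cs _
      comm := fun i j h1 h2 h3 => by
        refine (node_comm cs hM (by omega) (by omega) ?_).symm
        unfold affBEntry; split_ifs <;> omega
      braid := fun i h1 h2 => by
        have := node_braid cs hM (i := m - (i + 1)) (j := m - i) (by omega) (by omega)
          (by unfold affBEntry; split_ifs <;> omega)
        exact this.symm }
  have hP : ∀ i ≤ m - 2, (nodeAction cs hn hM (chain (fun j => node cs (m - j)) i) ((m : ℤ), 0)).1 =
      m - i := by
    intro i hi
    induction i with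
    | zero => simp [chain]
    | succ i ih =>
      have h1 := ih (by omega)
      rw [chain, map_mul, Equiv.Perm.mul_apply, nodeAction_node _ _ _ (by omega)]
      generalize nodeAction cs hn hM _ _ = y at h1 ⊢
      obtain ⟨u, z⟩ := y
      simp only at h1
      subst h1
      simp only [nodeSwap, signedSwap, nodeFst, nodeSnd, nodeShift]
      grind
  have hP2 := hP (m - 2) le_rfl
  have hz : (nodeAction cs hn hM (node cs 0 * chain (fun j => node cs (m - j)) (m - 2))
      ((m : ℤ), 0)).1 = -1 := by
    rw [map_mul, Equiv.Perm.mul_apply, nodeAction_node _ _ _ (by omega)]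
    generalize nodeAction cs hn hM _ _ = y at hP2 ⊢
    obtain ⟨u, z⟩ := y
    simp only at hP2
    subst hP2
    simp only [nodeSwap, signedSwap, nodeFst, nodeSnd, nodeShift]
    grind
  have hz' : (nodeAction cs hn hM (node cs 1 * chain (fun j => node cs (m - j)) (m - 2))
      ((m : ℤ), 0)).1 = 1 := by
    rw [map_mul, Equiv.Perm.mul_apply, nodeAction_node _ _ _ (by omega)]
    generalize nodeAction cs hn hM _ _ = y at hP2 ⊢
    obtain ⟨u, z⟩ := y
    simp only at hP2
    subst hP2
    simp only [nodeSwap, signedSwap, nodeFst, nodeSnd, nodeShift]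
    grind
  have hQ : ∀ i ≤ m - 2, (nodeAction cs hn hM
      (bounce (fun j => node cs (m - j)) (node cs 0 * node cs 1) (m - 2) i) ((m : ℤ), 0)).1 =
        -(2 + i) := by
    intro i hi
    induction i with
    | zero =>
      rw [bounce_zero, mul_assoc, map_mul, Equiv.Perm.mul_apply, nodeAction_node _ _ _ (by omega)]
      generalize nodeAction cs hn hM _ _ = y at hz' ⊢
      obtain ⟨u, z⟩ := y
      simp only at hz'
      subst hz'
      simp only [nodeSwap, signedSwap, nodeFst, nodeSnd, nodeShift]
      grind
    | succ i ih =>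
      have h1 := ih (by omega)
      rw [bounce_succ, map_mul, Equiv.Perm.mul_apply, nodeAction_node _ _ _ (by omega),
        show m - (m - 2 - i) = i + 2 by omega]
      generalize nodeAction cs hn hM _ _ = y at h1 ⊢
      obtain ⟨u, z⟩ := y
      simp only at h1
      subst h1
      simp only [nodeSwap, signedSwap, nodeFst, nodeSnd, nodeShift]
      grind
  have key := poin_fork cs (n := n) (k := m - 2) (m := 0) (m' := 1) (c := fun j => m - j)
    (σ := Finset.range m ∪ J) (J := Finset.range (m - 1) ∪ J)
    (Finset.union_subset_union_left (Finset.range_mono (by omega))) ?_ hfin (by omega) hc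
    (fun j h1 h2 => hmemσ _ (by omega)) (fun j h1 h2 => hmemJ _ (by omega)) (hmemJ _ (by omega))
    (hmemJ _ (by omega)) h01 ?_ ?_ ?_ ?_ ?_ (nodeAction cs hn hM) ((m : ℤ), 0) ?_ _ _ _ _
    (fun i _ => rfl) (fun i _ => rfl) rfl rfl ?_ ?_ ?_ ?_ ?_ ?_ ?_ ?_
  · rwa [show m - 2 + 1 = m - 1 by omega, show m - 2 + 2 = m by omega] at key
  · intro x hx
    rcases Finset.mem_union.1 hx with h | h
    · have := Finset.mem_range.1 h
      omega
    · exact (hJ x h).2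
  · intro j h1 h2
    refine node_comm cs hM (by omega) (by omega) ?_
    unfold affBEntry; split_ifs <;> omega
  · intro j h1 h2
    refine node_comm cs hM (by omega) (by omega) ?_
    unfold affBEntry; split_ifs <;> omega
  · refine node_braid cs hM (by omega) (by omega) ?_
    unfold affBEntry; split_ifs <;> omega
  · refine node_braid cs hM (by omega) (by omega) ?_
    unfold affBEntry; split_ifs <;> omega
  · intro i hi
    rcases Finset.mem_union.1 hi with h | h
    · have := Finset.mem_range.1 h
      rcases Nat.lt_or_ge i 2 with h2 | h2
      · omega
      · exact Or.inl ⟨m - i, by omega, by omega, by omega⟩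
    · have := hJ i h
      refine Or.inr (Or.inr (Or.inr ⟨Finset.mem_union_right _ h, ?_, ?_, fun j h1 h2 => ?_⟩)) <;>
        exact node_far cs hM (show 2 ≤ m by omega) (by omega) this.1 this.2
  · intro i hi
    have h1 : i < m - 1 ∨ m < i ∧ i ≤ n := by
      rcases Finset.mem_union.1 hi with h | h
      · exact Or.inl (Finset.mem_range.1 h)
      · exact Or.inr (hJ i h)
    rw [nodeAction_node _ _ _ (by omega)]
    simp only [nodeSwap, signedSwap, nodeFst, nodeSnd, nodeShift]
    grind
  · intro i hi j hj hij
    have h1 := hP i hi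
    rw [hij, hP j hj] at h1
    omega
  · intro i hi j hj hij
    have h1 := hQ i hi
    rw [hij, hQ j hj] at h1
    omega
  · intro i hi j hj hij
    have h1 := hP i hi
    rw [hij, hQ j hj] at h1
    omega
  · intro i hi hij
    have h1 := hP i hi
    rw [hij, hz] at h1
    omega
  · intro i hi hij
    have h1 := hP i hi
    rw [hij, hz'] at h1
    omega
  · intro i hi hij
    have h1 := hQ i hi
    rw [hij, hz] at h1
    omega
  · intro i hi hij
    have h1 := hQ i hi
    rw [hij, hz'] at h1
    omega
  · intro hij
    rw [hij, hz'] at hz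
    omega

/-- The base `{0, 1}` of the diagrams of type `D`. -/
theorem poin_insert_pair (hn : 3 ≤ n)
    (hM : ∀ i j : Fin (n + 1), i.val < j.val → Mat.M i j = affBEntry n i.val j.val)
    {J : Finset ℕ} (hJ : ∀ y ∈ J, 2 < y ∧ y ≤ n)
    (hfin : (parabolic cs (toFin n (insert 1 J)) : Set W).Finite) :
    (parabolic cs (toFin n (Finset.range 2 ∪ J)) : Set W).Finite ∧
      poin cs (toFin n (Finset.range 2 ∪ J)) =
        poin cs (toFin n (insert 1 J)) * ∑ i ∈ Finset.range 2, X ^ i := by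
  have h01 : node cs 1 * node cs 0 = node cs 0 * node cs 1 :=
    (node_comm cs hM (by omega) (by omega) (by unfold affBEntry; split_ifs <;> omega)).symm
  refine poin_chain cs (k := 1) (c := fun _ => 0) (σ := Finset.range 2 ∪ J) (J := insert 1 J)
    ?_ ?_ hfin ⟨fun j => node_mul_self cs _, by omega, by omega⟩ ?_ ?_ ?_
    ((MulAction.toPermHom (Equiv.Perm (ℤ × ℤ)) (Set (ℤ × ℤ))).comp (nodeAction cs hn hM))
    {((1 : ℤ), (0 : ℤ)), (2, 0)} ?_ _ (fun i _ => rfl) ?_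
  · intro x hx
    rcases Finset.mem_insert.1 hx with rfl | h
    · simp
    · exact Finset.mem_union_right _ h
  · intro x hx
    rcases Finset.mem_union.1 hx with h | h
    · have := Finset.mem_range.1 h
      omega
    · exact (hJ x h).2
  · intro j _ _
    simp
  · omega
  · intro i hi
    rcases Finset.mem_union.1 hi with h | h
    · have := Finset.mem_range.1 h
      rcases (show i = 0 ∨ i = 1 by omega) with rfl | rfl
      · exact Or.inl ⟨1, le_rfl, le_rfl, rfl⟩
      · exact Or.inr ⟨Finset.mem_insert_self _ _, fun _ _ _ => h01⟩
    · have := hJ i h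
      exact Or.inr ⟨Finset.mem_insert_of_mem h, fun j _ _ =>
        node_far cs hM (show 2 ≤ 2 by omega) (by omega) this.1 this.2⟩
  · intro i hi
    have h1 : i = 1 ∨ 2 < i ∧ i ≤ n := by
      rcases Finset.mem_insert.1 hi with h | h
      · exact Or.inl h
      · exact Or.inr (hJ i h)
    rw [MonoidHom.comp_apply, MulAction.toPermHom_apply, MulAction.toPerm_apply]
    rw [← Set.image_smul, Set.image_pair]
    simp only [Equiv.Perm.smul_def]
    rw [nodeAction_node _ _ _ (by omega), nodeAction_node _ _ _ (by omega)]
    rcases h1 with rfl | h1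
    · rw [Set.pair_comm]
      congr 1 <;> simp only [nodeSwap, signedSwap, nodeFst, nodeSnd, nodeShift] <;> grind
    · congr 1 <;> simp only [nodeSwap, signedSwap, nodeFst, nodeSnd, nodeShift] <;> grind
  · have hne : (MulAction.toPermHom (Equiv.Perm (ℤ × ℤ)) (Set (ℤ × ℤ))).comp (nodeAction cs hn hM)
        (chain (fun _ => node cs 0) 1) {((1 : ℤ), (0 : ℤ)), (2, 0)} ≠ {(1, 0), (2, 0)} := by
      rw [chain, chain, mul_one, MonoidHom.comp_apply, MulAction.toPermHom_apply,
        MulAction.toPerm_apply, ← Set.image_smul, Set.image_pair]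
      simp only [Equiv.Perm.smul_def]
      rw [nodeAction_node _ _ _ (by omega), nodeAction_node _ _ _ (by omega)]
      intro h
      have h2 : nodeSwap n 0 (2, 0) ∈ ({(1, 0), (2, 0)} : Set (ℤ × ℤ)) := h ▸ by simp
      simp [nodeSwap, signedSwap, nodeFst, nodeSnd, nodeShift] at h2
    have h0 : (MulAction.toPermHom (Equiv.Perm (ℤ × ℤ)) (Set (ℤ × ℤ))).comp (nodeAction cs hn hM)
        (chain (fun _ => node cs 0) 0) {((1 : ℤ), (0 : ℤ)), (2, 0)} = {(1, 0), (2, 0)} := by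
      simp [chain]
    intro i hi j hj hij
    rcases (show i = 0 ∨ i = 1 by omega) with rfl | rfl <;>
      rcases (show j = 0 ∨ j = 1 by omega) with rfl | rfl
    · rfl
    · exact absurd (hij.symm.trans h0) hne
    · exact absurd (hij.trans h0) hne
    · rfl

end AffineBCosets

section Multiplicity

/-- The cyclotomic polynomial `Φ_d` divides `p` exactly `k` times. -/
def HasMult (d : ℕ) (p : ℚ[X]) (k : ℕ) : Prop :=
  ∃ u : ℚ[X], p = cyclotomic d ℚ ^ k * u ∧ IsCoprime u (cyclotomic d ℚ)

theorem HasMult.one (d : ℕ) : HasMult d 1 0 := ⟨1, by simp, isCoprime_one_left⟩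

theorem HasMult.mul {d : ℕ} {p q : ℚ[X]} {k l : ℕ} (hp : HasMult d p k) (hq : HasMult d q l) :
    HasMult d (p * q) (k + l) := by
  obtain ⟨u, rfl, hu⟩ := hp
  obtain ⟨v, rfl, hv⟩ := hq
  exact ⟨u * v, by ring, hu.mul_left hv⟩

theorem HasMult.le_of_dvd {d : ℕ} (hd : 0 < d) {p q : ℚ[X]} {k l : ℕ} (hp : HasMult d p k)
    (hq : HasMult d q l) (h : p ∣ q) : k ≤ l := by
  obtain ⟨u, rfl, hu⟩ := hp
  obtain ⟨v, rfl, hv⟩ := hq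
  by_contra! hlt
  have h1 : cyclotomic d ℚ ^ (l + 1) ∣ cyclotomic d ℚ ^ l * v :=
    (pow_dvd_pow _ hlt).trans ((Dvd.intro _ rfl).trans h)
  rw [pow_succ] at h1
  have h2 := (mul_dvd_mul_iff_left (pow_ne_zero l (cyclotomic_ne_zero d ℚ))).1 h1
  exact (cyclotomic.irreducible_rat hd).not_isUnit (hv.isUnit_of_dvd' h2 dvd_rfl)

/-- The indicator of divisibility by `d`. -/
def dvdInd (d m : ℕ) : ℕ := if d ∣ m then 1 else 0

theorem hasMult_prod_cyclotomic {d : ℕ} (hd : 0 < d) (s : Finset ℕ) :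
    HasMult d (∏ e ∈ s, cyclotomic e ℚ) (if d ∈ s then 1 else 0) := by
  have hcop : ∀ t : Finset ℕ, d ∉ t → IsCoprime (∏ e ∈ t, cyclotomic e ℚ) (cyclotomic d ℚ) := by
    intro t ht
    refine IsCoprime.prod_left fun e he => cyclotomic.isCoprime_rat ?_
    rintro rfl
    exact ht he
  split_ifs with h
  · refine ⟨∏ e ∈ s.erase d, cyclotomic e ℚ, ?_, hcop _ (Finset.notMem_erase d s)⟩
    rw [pow_one, Finset.mul_prod_erase s (fun e => cyclotomic e ℚ) h]
  · exact ⟨_, by simp, hcop s h⟩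

theorem hasMult_geom {d m : ℕ} (hd : 2 ≤ d) (hm : 1 ≤ m) :
    HasMult d (∑ i ∈ Finset.range m, X ^ i) (dvdInd d m) := by
  rw [← prod_cyclotomic_eq_geom_sum (by omega)]
  have := hasMult_prod_cyclotomic (d := d) (by omega) (m.divisors.erase 1)
  convert this using 1
  have : d ∈ m.divisors.erase 1 ↔ d ∣ m := by
    rw [Finset.mem_erase, Nat.mem_divisors]
    exact ⟨fun h => h.2.1, fun h => ⟨by omega, h, by omega⟩⟩
  simp only [dvdInd, this]

theorem hasMult_one_add_X_pow {d m : ℕ} (hd : 2 ≤ d) (hm : 1 ≤ m) :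
    HasMult d (1 + X ^ m) (dvdInd d (2 * m) - dvdInd d m) := by
  have hsub : m.divisors ⊆ (2 * m).divisors :=
    Nat.divisors_subset_of_dvd (by omega) (Dvd.intro_left 2 rfl)
  have hprod : (1 + X ^ m : ℚ[X]) = ∏ e ∈ (2 * m).divisors \ m.divisors, cyclotomic e ℚ := by
    have h1 := prod_cyclotomic_eq_X_pow_sub_one (n := m) (by omega) ℚ
    have h2 := prod_cyclotomic_eq_X_pow_sub_one (n := 2 * m) (by omega) ℚ
    have h3 := Finset.prod_sdiff hsub (f := fun e => cyclotomic e ℚ)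
    have h4 : (X ^ m - 1 : ℚ[X]) ≠ 0 := X_pow_sub_C_ne_zero (by omega) 1
    apply mul_right_cancel₀ h4
    rw [← h1, h3, h2, h1]
    ring
  rw [hprod]
  convert hasMult_prod_cyclotomic (d := d) (by omega) ((2 * m).divisors \ m.divisors)
    using 1
  have h1 : d ∣ m → d ∣ 2 * m := fun h => h.mul_left 2
  simp only [Finset.mem_sdiff, Nat.mem_divisors, dvdInd]
  have h2 : 2 * m ≠ 0 := by omega
  have h3 : m ≠ 0 := by omega
  by_cases h4 : d ∣ m <;> by_cases h5 : d ∣ 2 * m <;> simp_all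

end Multiplicity

section Divisibility

variable {B : Type*} {W : Type*} [Group W] {M : CoxeterMatrix B} (cs : CoxeterSystem M W)

theorem poin_dvd {J σ : Finset B} (hJ : J ⊆ σ) (hfin : (parabolic cs σ : Set W).Finite) :
    (parabolic cs J : Set W).Finite ∧ poin cs J ∣ poin cs σ := by
  have hfJ : (parabolic cs J : Set W).Finite := hfin.subset (parabolic_mono cs hJ)
  refine ⟨hfJ, ?_⟩
  have : Finite (parabolic cs σ) := hfin
  let Q := parabolic cs σ ⧸ (parabolic cs J).subgroupOf (parabolic cs σ)
  let _ : Fintype Q := Fintype.ofFinite Q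
  have hmin : ∀ a : Q, ∃ g : parabolic cs σ, (g : Q) = a ∧
      ∀ g' : parabolic cs σ, (g' : Q) = a → cs.length (g : W) ≤ cs.length (g' : W) := by
    intro a
    obtain ⟨g₀, h₀⟩ := QuotientGroup.mk_surjective a
    obtain ⟨g, hg, hg'⟩ := Set.exists_min_image {g : parabolic cs σ | (g : Q) = a}
      (fun g => cs.length (g : W)) (Set.toFinite _) ⟨g₀, h₀⟩
    exact ⟨g, hg, hg'⟩
  choose r hr hrmin using hmin
  have h1 := hrmin ((1 : parabolic cs σ) : Q) 1 rfl
  have h2 := poin_eq_mul_of_cosets cs hJ hfJ (fun a : Q => (r a : W)) (fun a => cs.length (r a : W))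
    ((1 : parabolic cs σ) : Q) ?_ ?_ (fun a => (r a).2) (fun a => le_rfl) ?_ ?_
  · rw [h2.2]
    exact Dvd.intro _ rfl
  · have : cs.length (r ((1 : parabolic cs σ) : Q) : W) = 0 := by simpa using h1
    exact cs.length_eq_zero_iff.1 this
  · simpa using h1
  · intro i hi a
    let g : parabolic cs σ := ⟨cs.simple i, simple_mem_parabolic cs hi⟩ * r a
    have hg : cs.length (g : W) ≤ cs.length (r a : W) + 1 := by
      have := cs.length_mul_le (cs.simple i) (r a : W)
      rw [cs.length_simple] at this
      change cs.length (cs.simple i * (r a : W)) ≤ _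
      omega
    refine ⟨(g : Q), (hrmin _ g rfl).trans hg, (r (g : Q) : W)⁻¹ * g, ?_, ?_⟩
    · have := QuotientGroup.eq.1 (hr (g : Q))
      exact this
    · rw [mul_inv_cancel_left]
      rfl
  · intro a b hab
    rw [← hr a, ← hr b]
    exact QuotientGroup.eq.2 (by simpa [Subgroup.mem_subgroupOf] using hab)

end Divisibility

section Hits

/-- The node in position `x` of the path of nodes contributes a factor `Φ_d` to the Poincaré
polynomial of `τ`. -/
def hit (n d : ℕ) (τ : Finset ℕ) (x : ℕ) : Prop :=
  (∃ g, x < g ∧ g ≤ n ∧ g ∉ τ ∧ (∀ y, x ≤ y → y < g → y ∈ τ) ∧ d ∣ g - x + 1) ∨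
    (∀ y, x ≤ y → y ≤ n → y ∈ τ) ∧ d ∣ 2 * (n + 1 - x)

open Classical in
/-- The positions after `lo` that contribute a factor `Φ_d`. -/
noncomputable def hits (n d : ℕ) (τ : Finset ℕ) (lo : ℕ) : Finset ℕ :=
  (Finset.Ioc lo n).filter (hit n d τ)

theorem mem_hits {n d : ℕ} {τ : Finset ℕ} {lo x : ℕ} :
    x ∈ hits n d τ lo ↔ lo < x ∧ x ≤ n ∧ hit n d τ x := by
  simp [hits, and_assoc]

theorem hit.mem {n d : ℕ} {τ : Finset ℕ} {x : ℕ} (h : hit n d τ x) (hx : x ≤ n) : x ∈ τ := by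
  rcases h with ⟨g, h1, h2, h3, h4, h5⟩ | ⟨h1, h2⟩
  exacts [h4 x le_rfl h1, h1 x le_rfl hx]

theorem hit_of_eq_above {n d : ℕ} {τ τ' : Finset ℕ} {x : ℕ}
    (h : ∀ y, x ≤ y → y ≤ n → (y ∈ τ ↔ y ∈ τ')) (hx : hit n d τ x) : hit n d τ' x := by
  rcases hx with ⟨g, h1, h2, h3, h4, h5⟩ | ⟨h1, h2⟩
  · exact Or.inl ⟨g, h1, h2, fun h6 => h3 ((h g h1.le h2).2 h6),
      fun y h6 h7 => (h y h6 (by omega)).1 (h4 y h6 h7), h5⟩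
  · exact Or.inr ⟨fun y h6 h7 => (h y h6 h7).1 (h1 y h6 h7), h2⟩

theorem hits_congr {n d : ℕ} {τ τ' : Finset ℕ} {lo : ℕ}
    (h : ∀ y, lo < y → y ≤ n → (y ∈ τ ↔ y ∈ τ')) : hits n d τ lo = hits n d τ' lo := by
  ext x
  simp only [mem_hits]
  refine ⟨fun ⟨h1, h2, h3⟩ => ⟨h1, h2, hit_of_eq_above (fun y h4 h5 => h y (by omega) h5) h3⟩,
    fun ⟨h1, h2, h3⟩ => ⟨h1, h2, hit_of_eq_above (fun y h4 h5 => (h y (by omega) h5).symm) h3⟩⟩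

theorem hit_iff_of_gap {n d : ℕ} {τ : Finset ℕ} {x g : ℕ} (h1 : x < g) (h2 : g ≤ n) (h3 : g ∉ τ)
    (h4 : ∀ y, x ≤ y → y < g → y ∈ τ) : hit n d τ x ↔ d ∣ g - x + 1 := by
  refine ⟨fun h => ?_, fun h => Or.inl ⟨g, h1, h2, h3, h4, h⟩⟩
  rcases h with ⟨g', h1', h2', h3', h4', h5⟩ | ⟨h, h'⟩
  · have : g = g' := by
      rcases Nat.lt_trichotomy g g' with h | h | h
      · exact absurd (h4' g h1.le h) h3
      · exact h
      · exact absurd (h4 g' h1'.le h) h3'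
    rwa [this]
  · exact absurd (h g h1.le h2) h3

theorem hit_iff_of_tail {n d : ℕ} {τ : Finset ℕ} {x : ℕ} (h4 : ∀ y, x ≤ y → y ≤ n → y ∈ τ) :
    hit n d τ x ↔ d ∣ 2 * (n + 1 - x) := by
  refine ⟨fun h => ?_, fun h => Or.inr ⟨h4, h⟩⟩
  rcases h with ⟨g', h1', h2', h3', h4', h5⟩ | ⟨h, hdvd⟩
  · exact absurd (h4 g' h1'.le h2') h3'
  · exact hdvd

/-- A set either fills the rest of the path after `x` or has a first gap there. -/
theorem exists_gap (n : ℕ) (τ : Finset ℕ) (x : ℕ) :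
    (∀ y, x < y → y ≤ n → y ∈ τ) ∨
      ∃ g, x < g ∧ g ≤ n ∧ g ∉ τ ∧ ∀ y, x < y → y < g → y ∈ τ := by
  classical
  by_cases h : ∃ g, x < g ∧ g ≤ n ∧ g ∉ τ
  · right
    obtain ⟨h1, h2, h3⟩ := Nat.find_spec h
    refine ⟨Nat.find h, h1, h2, h3, fun y h4 h5 => ?_⟩
    by_contra h6
    exact Nat.find_min h h5 ⟨h4, by omega, h6⟩
  · left
    push Not at h
    exact h

theorem card_hits_insert {n d a : ℕ} {s : Finset ℕ} (ha : ∀ x ∈ s, a < x) (ha1 : 1 ≤ a)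
    (han : a ≤ n) {m : ℕ} (hm : hit n d (insert a s) a ↔ d ∣ m) :
    (hits n d (insert a s) 0).card = (hits n d s 0).card + dvdInd d m := by
  have has : a ∉ s := fun h => lt_irrefl _ (ha a h)
  have hna : a ∉ hits n d s 0 := fun h => has ((mem_hits.1 h).2.2.mem (mem_hits.1 h).2.1)
  have key : ∀ x, x ≠ a → (x ∈ hits n d (insert a s) 0 ↔ x ∈ hits n d s 0) := by
    intro x hx
    simp only [mem_hits]
    constructor
    · rintro ⟨h1, h2, h3⟩
      have h4 : a < x := ha x (Finset.mem_of_mem_insert_of_ne (h3.mem h2) hx)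
      refine ⟨h1, h2, hit_of_eq_above (fun y h5 h6 => ?_) h3⟩
      rw [Finset.mem_insert]
      exact ⟨fun h => h.resolve_left (by omega), Or.inr⟩
    · rintro ⟨h1, h2, h3⟩
      have h4 : a < x := ha x (h3.mem h2)
      refine ⟨h1, h2, hit_of_eq_above (fun y h5 h6 => ?_) h3⟩
      rw [Finset.mem_insert]
      exact ⟨Or.inr, fun h => h.resolve_left (by omega)⟩
  unfold dvdInd
  split_ifs with h
  · rw [← Finset.card_insert_of_notMem hna]
    congr 1
    ext x
    rw [Finset.mem_insert]
    by_cases hx : x = a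
    · subst hx
      simp only [true_or, iff_true]
      exact mem_hits.2 ⟨ha1, han, hm.2 h⟩
    · rw [key x hx]
      simp [hx]
  · rw [add_zero]
    congr 1
    ext x
    by_cases hx : x = a
    · subst hx
      exact ⟨fun h' => absurd (hm.1 (mem_hits.1 h').2.2) h, fun h' => absurd h' hna⟩
    · exact key x hx

/-- The multiplicity of `Φ_d` in the Poincaré polynomial of type `D_m`. -/
def forkMult (d m : ℕ) : ℕ := ((Finset.Ioc 0 (m - 1)).filter fun i => d ∣ 2 * i).card + dvdInd d m

/-- The smallest natural number outside of `σ`. -/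
noncomputable def firstGap (σ : Finset ℕ) : ℕ := sInf {g | g ∉ σ}

theorem firstGap_eq {σ : Finset ℕ} {g : ℕ} (h1 : g ∉ σ) (h2 : ∀ y < g, y ∈ σ) : firstGap σ = g := by
  apply le_antisymm
  · exact Nat.sInf_le h1
  · by_contra! h
    exact Nat.sInf_mem (s := {g | g ∉ σ}) ⟨g, h1⟩ (h2 _ h)

/-- The multiplicity of `Φ_d` in the Poincaré polynomial of `σ`. -/
noncomputable def vmult (n d : ℕ) (σ : Finset ℕ) : ℕ :=
  if 0 ∈ σ ∧ 1 ∈ σ then forkMult d (firstGap σ) + (hits n d σ (firstGap σ)).card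
  else (hits n d (σ.image (max 1)) 0).card

theorem vmult_of_fork {n d : ℕ} {σ : Finset ℕ} {g : ℕ} (hg2 : 2 ≤ g) (h1 : g ∉ σ)
    (h2 : ∀ y < g, y ∈ σ) : vmult n d σ = forkMult d g + (hits n d σ g).card := by
  rw [vmult, if_pos ⟨h2 0 (by omega), h2 1 (by omega)⟩, firstGap_eq h1 h2]

theorem vmult_of_path {n d : ℕ} {σ : Finset ℕ} (h : ¬(0 ∈ σ ∧ 1 ∈ σ)) :
    vmult n d σ = (hits n d (σ.image (max 1)) 0).card := by
  rw [vmult, if_neg h]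

theorem vmult_of_zero_notMem {n d : ℕ} {σ : Finset ℕ} (h : 0 ∉ σ) :
    vmult n d σ = (hits n d σ 0).card := by
  rw [vmult_of_path fun h' => h h'.1]
  congr 1
  apply hits_congr
  intro y hy _
  rw [Finset.mem_image]
  constructor
  · rintro ⟨x, hx, rfl⟩
    have : x ≠ 0 := fun h' => h (h' ▸ hx)
    rwa [max_eq_right (by omega)]
  · exact fun h' => ⟨y, h', by omega⟩

end Hits

section AffineBMultiplicity

variable {n : ℕ} {W : Type*} [Group W] {Mat : CoxeterMatrix (Fin (n + 1))}
  (cs : CoxeterSystem Mat W)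

theorem poin_hasMult_path (hn : 3 ≤ n)
    (hM : ∀ i j : Fin (n + 1), i.val < j.val → Mat.M i j = affBEntry n i.val j.val)
    {b d : ℕ} (hb : b ≤ 1) (hd : 2 ≤ d) (τ : Finset ℕ) (hτ : ∀ y ∈ τ, 1 ≤ y ∧ y ≤ n) :
    (parabolic cs (toFin n (τ.image (pathNode b))) : Set W).Finite ∧
      HasMult d (poin cs (toFin n (τ.image (pathNode b)))) (hits n d τ 0).card := by
  induction τ using Finset.induction_on_min with
  | empty =>
    have h1 : toFin n ((∅ : Finset ℕ).image (pathNode b)) = ∅ := by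
      ext i
      simp [mem_toFin]
    have h2 : hits n d ∅ 0 = ∅ := by
      ext x
      simp only [mem_hits, Finset.notMem_empty, iff_false]
      exact fun h => Finset.notMem_empty _ (h.2.2.mem h.2.1)
    rw [h1, h2, poin_empty]
    exact ⟨parabolic_empty_finite cs, HasMult.one d⟩
  | insert a s ha ih =>
    obtain ⟨hf, hmul⟩ := ih fun y hy => hτ y (Finset.mem_insert_of_mem hy)
    have ha1 := hτ a (Finset.mem_insert_self _ _)
    have hs : ∀ y ∈ s, a < y ∧ y ≤ n := fun y hy =>
      ⟨ha y hy, (hτ y (Finset.mem_insert_of_mem hy)).2⟩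
    have hrun : ∀ g, (∀ y, a < y → y < g → y ∈ s) → ∀ y, a ≤ y → y < g → y ∈ insert a s := by
      intro g h y h1 h2
      rcases h1.eq_or_lt with rfl | h1
      · exact Finset.mem_insert_self _ _
      · exact Finset.mem_insert_of_mem (h y h1 h2)
    rcases exists_gap n s a with h | ⟨g, h1, h2, h3, h4⟩
    · have htail : ∀ y, a ≤ y → y ≤ n → y ∈ insert a s := fun y h1 h2 =>
        hrun (n + 1) (fun y h3 h4 => h y h3 (by omega)) y h1 (by omega)
      rw [card_hits_insert ha ha1.1 ha1.2 (hit_iff_of_tail htail)]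
      rcases ha1.2.eq_or_lt with rfl | hlt
      · obtain ⟨h1, h2⟩ := poin_insert_path cs hn hM hb ha1.1 (Nat.lt_succ_self a) (Or.inr ⟨rfl, rfl⟩)
          hs (by omega) (fun h5 => by have := hs _ h5; omega) hf
        rw [h2]
        refine ⟨h1, hmul.mul ?_⟩
        have := hasMult_geom hd (m := 2 * (a + 1 - a)) (by omega)
        simpa using this
      · obtain ⟨h1, h2⟩ := poin_insert_tail cs hn hM hb ha1.1 hlt
          (fun y => ⟨hs y, fun h1 => h y h1.1 h1.2⟩) hf
        rw [h2]
        exact ⟨h1, hmul.mul (hasMult_geom hd (by omega))⟩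
    · have hg : g ∉ insert a s := by
        rw [Finset.mem_insert]
        rintro (h | h)
        · omega
        · exact h3 h
      rw [card_hits_insert ha ha1.1 ha1.2 (hit_iff_of_gap h1 h2 hg (hrun g h4))]
      obtain ⟨h5, h6⟩ := poin_insert_path cs hn hM hb ha1.1 h1 (Or.inl h2) hs h4 h3 hf
      rw [h6]
      exact ⟨h5, hmul.mul (hasMult_geom hd (by omega))⟩

theorem forkMult_succ {d m : ℕ} (hm : 1 ≤ m) :
    forkMult d (m + 1) = forkMult d m + (dvdInd d (2 * m) - dvdInd d m + dvdInd d (m + 1)) := by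
  have h1 : Finset.Ioc 0 m = insert m (Finset.Ioc 0 (m - 1)) := by
    ext x
    simp only [Finset.mem_insert, Finset.mem_Ioc]
    omega
  have h2 : d ∣ m → d ∣ 2 * m := fun h => h.mul_left 2
  unfold forkMult dvdInd
  rw [Nat.add_sub_cancel, h1, Finset.filter_insert]
  by_cases h3 : d ∣ 2 * m
  · rw [if_pos h3, Finset.card_insert_of_notMem (by grind)]
    split_ifs <;> omega
  · rw [if_neg h3]
    split_ifs <;> omega

theorem poin_hasMult_fork (hn : 3 ≤ n)
    (hM : ∀ i j : Fin (n + 1), i.val < j.val → Mat.M i j = affBEntry n i.val j.val)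
    {d m : ℕ} (hd : 2 ≤ d) (hm : 2 ≤ m) (hmn : m ≤ n) (J : Finset ℕ)
    (hJ : ∀ y ∈ J, m < y ∧ y ≤ n) :
    (parabolic cs (toFin n (Finset.range m ∪ J)) : Set W).Finite ∧
      HasMult d (poin cs (toFin n (Finset.range m ∪ J))) (forkMult d m + (hits n d J 0).card) := by
  induction m, hm using Nat.le_induction with
  | base =>
    have him : (insert 1 J).image (pathNode 1) = insert 1 J := by
      have : pathNode 1 = id := by
        funext p
        unfold pathNode
        split_ifs with h
        · exact h.symm
        · rfl
      rw [this, Finset.image_id]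
    obtain ⟨h1, h2⟩ := poin_hasMult_path cs hn hM le_rfl hd (insert 1 J) (by
      intro y hy
      rcases Finset.mem_insert.1 hy with rfl | h
      · omega
      · have := hJ y h
        omega)
    rw [him] at h1 h2
    obtain ⟨h3, h4⟩ := poin_insert_pair cs hn hM hJ h1
    refine ⟨h3, ?_⟩
    rw [h4]
    have h5 := card_hits_insert (n := n) (d := d) (a := 1) (s := J) (m := 2)
      (fun x hx => by have := hJ x hx; omega) le_rfl (by omega)
      (hit_iff_of_gap (g := 2) (by omega) (by omega)
        (fun h => by
          rcases Finset.mem_insert.1 h with h | h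
          · omega
          · have := hJ 2 h
            omega)
        (fun y h6 h7 => by
          obtain rfl : y = 1 := by omega
          exact Finset.mem_insert_self _ _))
    have h6 := h2.mul (hasMult_geom hd (m := 2) (by omega))
    convert h6 using 1
    have h7 := forkMult_succ (d := d) (m := 1) le_rfl
    have h8 : dvdInd d 1 = 0 := if_neg fun h => by have := Nat.le_of_dvd one_pos h; omega
    have h9 : forkMult d 1 = 0 := by simp [forkMult, h8]
    rw [h9, h8] at h7
    simp only [mul_one, Nat.reduceAdd] at h7
    rw [h5, h7]
    omega
  | succ m hm ih =>
    obtain ⟨h1, h2⟩ := ih (by omega) fun y hy => ⟨by have := hJ y hy; omega, (hJ y hy).2⟩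
    obtain ⟨h3, h4⟩ := poin_insert_fork cs hn hM (m := m + 1) (by omega) hmn hJ h1
    refine ⟨h3, ?_⟩
    rw [h4, Nat.add_sub_cancel]
    convert h2.mul ((hasMult_one_add_X_pow hd (m := m) (by omega)).mul
      (hasMult_geom hd (m := m + 1) (by omega))) using 1
    rw [forkMult_succ (by omega)]
    omega

/-- Proper parabolic subgroups are finite and `Φ_d` has multiplicity `vmult` in their Poincaré
polynomials. -/
theorem poin_hasMult (hn : 3 ≤ n)
    (hM : ∀ i j : Fin (n + 1), i.val < j.val → Mat.M i j = affBEntry n i.val j.val)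
    {d : ℕ} (hd : 2 ≤ d) {σ : Finset ℕ} (hσ : σ ⊂ Finset.range (n + 1)) :
    (parabolic cs (toFin n σ) : Set W).Finite ∧
      HasMult d (poin cs (toFin n σ)) (vmult n d σ) := by
  have hle : ∀ y ∈ σ, y ≤ n := fun y hy => by
    have := Finset.mem_range.1 (hσ.subset hy)
    omega
  by_cases h01 : 0 ∈ σ ∧ 1 ∈ σ
  · obtain ⟨z, hz, hz'⟩ := Finset.exists_of_ssubset hσ
    have hz2 : 1 < z := by
      by_contra! h
      rcases (show z = 0 ∨ z = 1 by omega) with rfl | rfl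
      exacts [hz' h01.1, hz' h01.2]
    rcases exists_gap n σ 1 with h | ⟨g, h1, h2, h3, h4⟩
    · exact absurd (h z hz2 (by have := Finset.mem_range.1 hz; omega)) hz'
    · have h5 : ∀ y < g, y ∈ σ := by
        intro y hy
        rcases (show y = 0 ∨ y = 1 ∨ 1 < y by omega) with rfl | rfl | h
        exacts [h01.1, h01.2, h4 y h hy]
      have h6 : Finset.range g ∪ σ.filter (g < ·) = σ := by
        ext y
        simp only [Finset.mem_union, Finset.mem_range, Finset.mem_filter]
        refine ⟨fun h => h.elim (h5 y) And.left, fun h => ?_⟩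
        rcases Nat.lt_trichotomy y g with h7 | rfl | h7
        exacts [Or.inl h7, absurd h h3, Or.inr ⟨h, h7⟩]
      have h7 := poin_hasMult_fork cs hn hM hd h1 h2 (σ.filter (g < ·)) fun y hy =>
        ⟨(Finset.mem_filter.1 hy).2, hle y (Finset.mem_filter.1 hy).1⟩
      rw [h6] at h7
      convert h7 using 2
      rw [vmult_of_fork h1 h3 h5]
      congr 2
      ext x
      simp only [mem_hits]
      constructor
      · rintro ⟨h8, h9, h10⟩
        exact ⟨by omega, h9, hit_of_eq_above
          (fun y h11 h12 => by simp [Finset.mem_filter, show g < y by omega]) h10⟩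
      · rintro ⟨h8, h9, h10⟩
        have h11 := (Finset.mem_filter.1 (h10.mem h9)).2
        exact ⟨h11, h9, hit_of_eq_above
          (fun y h11 h12 => by simp [Finset.mem_filter, show g < y by omega]) h10⟩
  · rw [vmult_of_path h01]
    have h1 : (σ.image (max 1)).image (pathNode (if 0 ∈ σ then 0 else 1)) = σ := by
      rw [Finset.image_image]
      ext y
      simp only [Finset.mem_image, Function.comp_apply, pathNode]
      constructor
      · rintro ⟨x, hx, rfl⟩
        by_cases h0 : 0 ∈ σ
        · have : x ≠ 1 := fun h => h01 ⟨h0, h ▸ hx⟩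
          rw [if_pos h0]
          split_ifs with h2
          · obtain rfl : x = 0 := by omega
            exact h0
          · rwa [show max 1 x = x by omega]
        · have : x ≠ 0 := fun h => h0 (h ▸ hx)
          rw [if_neg h0]
          split_ifs with h2
          · obtain rfl : x = 1 := by omega
            exact hx
          · rwa [show max 1 x = x by omega]
      · intro hy
        refine ⟨y, hy, ?_⟩
        by_cases h0 : 0 ∈ σ
        · have : y ≠ 1 := fun h => h01 ⟨h0, h ▸ hy⟩
          rw [if_pos h0]
          split_ifs <;> omega
        · have : y ≠ 0 := fun h => h0 (h ▸ hy)
          rw [if_neg h0]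
          split_ifs <;> omega
    have h2 := poin_hasMult_path cs hn hM (b := if 0 ∈ σ then 0 else 1) (by split_ifs <;> omega) hd
      (σ.image (max 1)) (by
        intro y hy
        obtain ⟨x, hx, rfl⟩ := Finset.mem_image.1 hy
        have := hle x hx
        omega)
    rwa [h1] at h2

end AffineBMultiplicity

section SubsetChains

variable {B : Type*} [LinearOrder B] {A : Type*} [CommRing A]

/-- The sign of `s` relative to `σ`. -/
def sgn (A : Type*) [CommRing A] (s : B) (σ : Finset B) : A :=
  (-1) ^ (σ.filter (fun t => t < s)).card

theorem sgn_mul_self (s : B) (σ : Finset B) : sgn A s σ * sgn A s σ = 1 := by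
  rw [sgn, ← pow_add, ← two_mul, pow_mul]
  simp

theorem sgn_insert {s t : B} {σ : Finset B} (ht : t ∉ σ) :
    sgn A s (insert t σ) = if t < s then -sgn A s σ else sgn A s σ := by
  unfold sgn
  rw [Finset.filter_insert]
  split_ifs with h
  · rw [Finset.card_insert_of_notMem (by simp [ht]), pow_succ]
    ring
  · rfl

theorem sgn_swap {s t : B} {σ : Finset B} (hs : s ∉ σ) (ht : t ∉ σ) (hst : s ≠ t) :
    sgn A s σ * sgn A t (insert s σ) = -(sgn A t σ * sgn A s (insert t σ)) := by
  rw [sgn_insert hs, sgn_insert ht]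
  rcases lt_or_gt_of_ne hst with h | h
  · rw [if_pos h, if_neg h.not_gt]
    ring
  · rw [if_neg h.not_gt, if_pos h]
    ring

/-- The cone operator with apex `t`. -/
def cone (t : B) (F : Finset B → A) (σ : Finset B) : A :=
  if t ∈ σ then sgn A t (σ.erase t) * F (σ.erase t) else 0

variable [Fintype B]

/-- The boundary of the full simplex, on functions of simplices. -/
def dBdry (F : Finset B → A) (τ : Finset B) : A := ∑ s ∈ τᶜ, sgn A s τ * F (insert s τ)

theorem dBdry_add (F G : Finset B → A) : dBdry (F + G) = dBdry F + dBdry G := by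
  funext τ
  simp [dBdry, mul_add, Finset.sum_add_distrib]

theorem dBdry_sub (F G : Finset B → A) : dBdry (F - G) = dBdry F - dBdry G := by
  funext τ
  simp [dBdry, mul_sub, Finset.sum_sub_distrib]

theorem dBdry_smul (a : A) (F : Finset B → A) : dBdry (a • F) = a • dBdry F := by
  funext τ
  simp only [dBdry, Pi.smul_apply, smul_eq_mul, Finset.mul_sum]
  exact Finset.sum_congr rfl fun s _ => by ring

theorem dBdry_dBdry (F : Finset B → A) : dBdry (dBdry F) = 0 := by
  funext τ
  simp only [dBdry, Finset.mul_sum, Pi.zero_apply]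
  rw [Finset.sum_sigma']
  refine Finset.sum_involution (fun p _ => ⟨p.2, p.1⟩) ?_ ?_ ?_ ?_
  · rintro ⟨s, t⟩ h
    simp only [Finset.mem_sigma, Finset.mem_compl, Finset.mem_insert, not_or] at h
    obtain ⟨hs, hts, ht⟩ := h
    simp only
    have h1 := sgn_swap (A := A) hs ht (Ne.symm hts)
    rw [Finset.insert_comm t s]
    linear_combination F (insert s (insert t τ)) * h1
  · rintro ⟨s, t⟩ h _ heq
    simp only [Finset.mem_sigma, Finset.mem_compl, Finset.mem_insert, not_or] at h
    simp only [Sigma.mk.injEq] at heq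
    exact h.2.1 heq.1
  · rintro ⟨s, t⟩ h
    simp only [Finset.mem_sigma, Finset.mem_compl, Finset.mem_insert, not_or] at h ⊢
    exact ⟨h.2.2, fun e => h.2.1 e.symm, h.1⟩
  · rintro ⟨s, t⟩ _
    rfl

theorem dBdry_cone (t : B) (F : Finset B → A) : dBdry (cone t F) = F - cone t (dBdry F) := by
  funext τ
  simp only [Pi.sub_apply]
  by_cases ht : t ∈ τ
  · obtain ⟨ρ, hρ, rfl⟩ : ∃ ρ, t ∉ ρ ∧ insert t ρ = τ :=
      ⟨τ.erase t, Finset.notMem_erase t τ, Finset.insert_erase ht⟩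
    rw [cone, if_pos ht, Finset.erase_insert hρ]
    unfold dBdry
    have h1 : ρᶜ = insert t (insert t ρ)ᶜ := by
      ext x
      simp only [Finset.mem_compl, Finset.mem_insert, not_or]
      by_cases hx : x = t
      · subst hx; simp [hρ]
      · simp [hx]
    rw [h1, Finset.sum_insert (by simp), mul_add, ← mul_assoc, sgn_mul_self, one_mul, sub_add_cancel_left,
      Finset.mul_sum, ← Finset.sum_neg_distrib]
    refine Finset.sum_congr rfl fun s hs => ?_
    simp only [Finset.mem_compl, Finset.mem_insert, not_or] at hs
    have h2 : (insert s (insert t ρ)).erase t = insert s ρ := by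
      rw [Finset.insert_comm, Finset.erase_insert]
      simp [hρ, Ne.symm hs.1]
    rw [cone, if_pos (by simp), h2]
    have h4 : sgn A s (insert t ρ) * sgn A t (insert s ρ) = -(sgn A t ρ * sgn A s ρ) := by
      rw [sgn_insert hρ, sgn_insert hs.2]
      rcases lt_or_gt_of_ne hs.1 with h | h
      · rw [if_neg h.not_gt, if_pos h]
        ring
      · rw [if_pos h, if_neg h.not_gt]
        ring
    linear_combination F (insert s ρ) * h4
  · rw [cone, if_neg ht, sub_zero]
    unfold dBdry
    rw [Finset.sum_eq_single t]
    · rw [cone, if_pos (Finset.mem_insert_self _ _), Finset.erase_insert ht, ← mul_assoc,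
        sgn_mul_self, one_mul]
    · intro s hs hst
      rw [cone, if_neg, mul_zero]
      rw [Finset.mem_insert]
      rintro (h | h)
      exacts [hst h.symm, ht h]
    · intro h
      exact absurd (Finset.mem_compl.2 ht) h

/-- A cycle that is divisible by `φ ^ w`, for a weight `w` that is monotone and invariant under
a graded family of toggles, bounds a chain divisible by `φ ^ w`. -/
theorem exists_dBdry_eq {φ : A} {k : ℕ} (st w : Finset B → ℕ)
    (hst : ∀ (σ : Finset B) (s : B), st σ ≤ st (insert s σ))
    (hw : ∀ (σ : Finset B) (s : B), σ.card = k → s ∉ σ → w σ ≤ w (insert s σ))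
    (htog : ∀ σ₀ : Finset B, σ₀.card = k → ∃ t : B, ∀ σ : Finset B, st σ ≤ st σ₀ →
      st (insert t σ) = st σ ∧ (st σ = st σ₀ → w (insert t σ) = w σ))
    (F : Finset B → A) (hF : ∀ σ, F σ ≠ 0 → σ.card = k) (hφ : ∀ σ, φ ^ w σ ∣ F σ)
    (hcyc : dBdry F = 0) :
    ∃ G : Finset B → A, (∀ σ, G σ ≠ 0 → σ.card = k + 1) ∧ (∀ σ, φ ^ w σ ∣ G σ) ∧ dBdry G = F := by
  obtain ⟨r, hr⟩ : ∃ r, ∀ σ, F σ ≠ 0 → st σ < r :=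
    ⟨(Finset.univ.sup st) + 1, fun σ _ => Nat.lt_succ_of_le (Finset.le_sup (Finset.mem_univ σ))⟩
  induction r generalizing F with
  | zero =>
    refine ⟨0, by simp, by simp, ?_⟩
    funext σ
    by_contra h
    exact absurd (hr σ (fun h' => h (by simp [dBdry, h']))) (by omega)
  | succ r ih =>
    by_cases hex : ∃ σ₀ : Finset B, σ₀.card = k ∧ st σ₀ = r
    · obtain ⟨σ₀, h0, rfl⟩ := hex
      obtain ⟨t, ht⟩ := htog σ₀ h0
      let P : Finset B → A := fun σ => if st σ = st σ₀ then F σ else 0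
      have hG1 : ∀ σ, cone t P σ ≠ 0 → σ.card = k + 1 := by
        intro σ h
        by_cases hσ : t ∈ σ
        · rw [cone, if_pos hσ] at h
          have h1 : P (σ.erase t) ≠ 0 := right_ne_zero_of_mul h
          have h2 : F (σ.erase t) ≠ 0 := by
            intro h'
            simp [P, h'] at h1
          have := hF _ h2
          rw [Finset.card_erase_of_mem hσ] at this
          have := Finset.card_pos.2 ⟨t, hσ⟩
          omega
        · rw [cone, if_neg hσ] at h
          exact absurd rfl h
      have hG2 : ∀ σ, φ ^ w σ ∣ cone t P σ := by
        intro σ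
        by_cases hσ : t ∈ σ
        · rw [cone, if_pos hσ]
          apply Dvd.dvd.mul_left
          by_cases h : st (σ.erase t) = st σ₀
          · simp only [P, if_pos h]
            have := (ht (σ.erase t) h.le).2 h
            rw [Finset.insert_erase hσ] at this
            rw [this]
            exact hφ _
          · simp [P, h]
        · simp [cone, hσ]
      have hB : ∀ τ, dBdry (cone t P) τ ≠ 0 → τ.card = k := by
        intro τ h
        by_contra hne
        apply h
        refine Finset.sum_eq_zero fun s hs => ?_
        have : cone t P (insert s τ) = 0 := by
          by_contra h1
          have h2 := hG1 _ h1
          rw [Finset.card_insert_of_notMem (Finset.mem_compl.1 hs)] at h2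
          omega
        rw [this, mul_zero]
      have hF' : ∀ σ, (F - dBdry (cone t P)) σ ≠ 0 → σ.card = k := by
        intro σ h
        by_contra hne
        apply h
        rw [Pi.sub_apply, not_imp_comm.1 (hF σ) hne, not_imp_comm.1 (hB σ) hne, sub_zero]
      have hφ' : ∀ σ, φ ^ w σ ∣ (F - dBdry (cone t P)) σ := by
        intro τ
        by_cases hτ : τ.card = k
        · refine dvd_sub (hφ τ) (Finset.dvd_sum fun s hs => Dvd.dvd.mul_left ?_ _)
          exact (pow_dvd_pow φ (hw τ s hτ (Finset.mem_compl.1 hs))).trans (hG2 _)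
        · rw [Pi.sub_apply, not_imp_comm.1 (hF τ) hτ, not_imp_comm.1 (hB τ) hτ, sub_zero]
          exact dvd_zero _
      have hcyc' : dBdry (F - dBdry (cone t P)) = 0 := by
        rw [dBdry_sub, hcyc, dBdry_dBdry, sub_zero]
      have hr' : ∀ σ, (F - dBdry (cone t P)) σ ≠ 0 → st σ < st σ₀ := by
        intro σ h
        by_contra! hlt
        apply h
        rw [dBdry_cone]
        simp only [Pi.sub_apply]
        have h1 : F σ = P σ := by
          by_cases h : st σ = st σ₀
          · simp [P, h]
          · simp only [P, if_neg h]
            by_contra h'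
            have := hr σ h'
            omega
        have h2 : cone t (dBdry P) σ = 0 := by
          by_cases hσ : t ∈ σ
          · rw [cone, if_pos hσ]
            have hins : insert t (σ.erase t) = σ := Finset.insert_erase hσ
            have h3 : st σ₀ ≤ st (σ.erase t) := by
              by_contra! h'
              have := (ht _ h'.le).1
              rw [hins] at this
              omega
            have h4 : dBdry P (σ.erase t) = dBdry F (σ.erase t) := by
              refine Finset.sum_congr rfl fun s _ => ?_
              congr 1
              by_cases h : st (insert s (σ.erase t)) = st σ₀
              · simp [P, h]
              · simp only [P, if_neg h]
                by_contra h'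
                have := hr _ (Ne.symm h')
                have := hst (σ.erase t) s
                omega
            rw [h4, hcyc]
            simp
          · rw [cone, if_neg hσ]
        rw [h1, h2]
        simp
      obtain ⟨G, h1, h2, h3⟩ := ih (F - dBdry (cone t P)) hF' hφ' hcyc' hr'
      refine ⟨G + cone t P, ?_, fun σ => dvd_add (h2 σ) (hG2 σ), ?_⟩
      · intro σ h
        by_contra hne
        apply h
        rw [Pi.add_apply, not_imp_comm.1 (h1 σ) hne, not_imp_comm.1 (hG1 σ) hne, add_zero]
      · rw [dBdry_add, h3, sub_add_cancel]
    · refine ih F hF hφ hcyc fun σ hσ => ?_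
      have := hr σ hσ
      have : st σ ≠ r := fun h => hex ⟨σ, hF σ hσ, h⟩
      omega

end SubsetChains

section Monotonicity

variable {n : ℕ} {W : Type*} [Group W] {Mat : CoxeterMatrix (Fin (n + 1))}
  (cs : CoxeterSystem Mat W)

theorem toFin_mono {τ τ' : Finset ℕ} (h : τ ⊆ τ') : toFin n τ ⊆ toFin n τ' := fun _ hi =>
  mem_toFin.2 (h (mem_toFin.1 hi))

theorem vmult_mono (cs : CoxeterSystem Mat W) (hn : 3 ≤ n)
    (hM : ∀ i j : Fin (n + 1), i.val < j.val → Mat.M i j = affBEntry n i.val j.val)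
    {d : ℕ} (hd : 2 ≤ d) {σ σ' : Finset ℕ} (h : σ ⊆ σ') (hσ' : σ' ⊂ Finset.range (n + 1)) :
    vmult n d σ ≤ vmult n d σ' := by
  obtain ⟨h1, h2⟩ := poin_hasMult cs hn hM hd hσ'
  obtain ⟨_, h4⟩ := poin_hasMult cs hn hM hd (h.trans_ssubset hσ')
  exact h4.le_of_dvd (by omega) h2 (poin_dvd cs (toFin_mono h) h1).2

theorem card_hits_filter (n d : ℕ) (σ : Finset ℕ) (lo : ℕ) :
    hits n d (σ.filter fun x => lo < x ∧ x ≤ n) 0 = hits n d σ lo := by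
  rw [← hits_congr (n := n) (d := d) (lo := lo) (τ := σ.filter fun x => lo < x ∧ x ≤ n) (τ' := σ)]
  · ext x
    simp only [mem_hits]
    refine ⟨fun ⟨_, h2, h3⟩ => ⟨?_, h2, h3⟩, fun ⟨h1, h2, h3⟩ => ⟨by omega, h2, h3⟩⟩
    exact (Finset.mem_filter.1 (h3.mem h2)).2.1
  · intro y h1 h2
    simp [h1, h2]

theorem card_hits_mono (cs : CoxeterSystem Mat W) (hn : 3 ≤ n)
    (hM : ∀ i j : Fin (n + 1), i.val < j.val → Mat.M i j = affBEntry n i.val j.val)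
    {d : ℕ} (hd : 2 ≤ d) {σ σ' : Finset ℕ} (h : σ ⊆ σ') (lo : ℕ) :
    (hits n d σ lo).card ≤ (hits n d σ' lo).card := by
  rw [← card_hits_filter n d σ, ← card_hits_filter n d σ']
  obtain ⟨h1, h2⟩ := poin_hasMult_path cs hn hM (b := 1) le_rfl hd
    (σ.filter fun x => lo < x ∧ x ≤ n) fun y hy => by
      have := (Finset.mem_filter.1 hy).2
      omega
  obtain ⟨h3, h4⟩ := poin_hasMult_path cs hn hM (b := 1) le_rfl hd
    (σ'.filter fun x => lo < x ∧ x ≤ n) fun y hy => by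
      have := (Finset.mem_filter.1 hy).2
      omega
  exact h2.le_of_dvd (by omega) h4
    (poin_dvd cs (toFin_mono (Finset.image_mono _ (Finset.filter_subset_filter _ h))) h3).2

end Monotonicity

section Windows

variable {n e : ℕ} {σ : Finset ℕ}

theorem card_hits_window {d lo hi : ℕ} (h : lo ≤ hi) : (hits n d σ lo).card =
    ((hits n d σ lo).filter (· ≤ hi)).card + (hits n d σ hi).card := by
  rw [← Finset.card_filter_add_card_filter_not (s := hits n d σ lo) (· ≤ hi)]
  congr 2
  ext x
  simp only [mem_hits, Finset.mem_filter, not_le]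
  exact ⟨fun h => ⟨h.2, h.1.2⟩, fun h' => ⟨⟨by omega, h'.2⟩, h'.1⟩⟩

theorem hit_pair {x y : ℕ} (hxy : x < y) (hy : y < x + 2 * e) (hyn : y ≤ n)
    (h1 : hit n (2 * e) σ x) (h2 : hit n (2 * e) σ y) : y = x + e := by
  have hyσ := h2.mem hyn
  rcases h1 with ⟨g, h3, h4, h5, h6, h7⟩ | ⟨h3, h4⟩
  · have hg : x + 2 * e ≤ g + 1 := by
      have := Nat.le_of_dvd (by omega) h7
      omega
    have hgy : g ≠ y := fun h => h5 (h ▸ hyσ)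
    rw [hit_iff_of_gap (g := g) (by omega) h4 h5 fun z hz hz' => h6 z (by omega) hz'] at h2
    have := Nat.le_of_dvd (by omega) ((Nat.dvd_sub h7 h2))
    omega
  · rw [hit_iff_of_tail fun z hz hz' => h3 z (by omega) hz'] at h2
    have he : 0 < e := by omega
    rw [Nat.mul_dvd_mul_iff_left two_pos] at h2 h4
    obtain ⟨c, hc⟩ := Nat.dvd_sub h4 h2
    have hc2 : c < 2 := by
      by_contra! h
      have := Nat.mul_le_mul_left e h
      omega
    interval_cases c <;> omega

theorem card_window_le_two {lo : ℕ} :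
    ((hits n (2 * e) σ lo).filter (· ≤ lo + 2 * e)).card ≤ 2 := by
  by_contra! h
  obtain ⟨a, ha, b, hb, c, hc, hab, hac, hbc⟩ := Finset.two_lt_card.1 h
  have key : ∀ x y, x ∈ (hits n (2 * e) σ lo).filter (· ≤ lo + 2 * e) →
      y ∈ (hits n (2 * e) σ lo).filter (· ≤ lo + 2 * e) → x ≠ y → (y = x + e ∨ x = y + e) := by
    intro x y hx hy hne
    simp only [Finset.mem_filter, mem_hits] at hx hy
    rcases lt_or_gt_of_ne hne with h | h
    · exact Or.inl (hit_pair h (by omega) hy.1.2.1 hx.1.2.2 hy.1.2.2)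
    · exact Or.inr (hit_pair h (by omega) hx.1.2.1 hy.1.2.2 hx.1.2.2)
  have h1 := key a b ha hb hab
  have h2 := key a c ha hc hac
  have h3 := key b c hb hc hbc
  omega

theorem card_window_eq_one (he : 1 ≤ e) {lo g : ℕ} (hg : lo + 2 * e ≤ g) (hgn : g ≤ n) (hgσ : g ∉ σ)
    (hrun : ∀ y, lo < y → y < lo + 2 * e → y ∈ σ) :
    ((hits n (2 * e) σ lo).filter (· ≤ lo + 2 * e)).card = 1 := by
  obtain h | ⟨g, hg1, hgn, hgσ, hrun'⟩ := exists_gap n σ lo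
  · exact absurd (h g (by omega) hgn) hgσ
  have hg : lo + 2 * e ≤ g := by
    by_contra! h
    exact hgσ (hrun g hg1 h)
  have hiff : ∀ x, lo < x → x < g → (hit n (2 * e) σ x ↔ 2 * e ∣ g - x + 1) := fun x h1 h2 =>
    hit_iff_of_gap h2 hgn hgσ fun y h3 h4 => hrun' y (by omega) h4
  have hdm := Nat.div_add_mod (g - lo) (2 * e)
  have hlt := Nat.mod_lt (g - lo) (show 0 < 2 * e by omega)
  have hq : 1 ≤ (g - lo) / (2 * e) := (Nat.one_le_div_iff (by omega)).2 (by omega)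
  have hq' := Nat.mul_le_mul_left (2 * e) hq
  rw [mul_one] at hq'
  rw [Finset.card_eq_one]
  have hx0 : 2 * e ∣ g - (lo + (g - lo) % (2 * e) + 1) + 1 := ⟨(g - lo) / (2 * e), by omega⟩
  refine ⟨lo + (g - lo) % (2 * e) + 1, ?_⟩
  ext x
  simp only [Finset.mem_filter, mem_hits, Finset.mem_singleton]
  constructor
  · rintro ⟨⟨h1, h2, h3⟩, h4⟩
    have h5 : x ≠ g := fun h => hgσ (h ▸ h3.mem h2)
    have h6 : 2 * e ∣ g - x + 1 := (hiff x h1 (by omega)).1 h3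
    have h7 := Nat.dvd_sub hx0 h6
    have h8 := Nat.dvd_sub h6 hx0
    have h9 := fun h => Nat.le_of_dvd h h7
    have h10 := fun h => Nat.le_of_dvd h h8
    omega
  · rintro rfl
    exact ⟨⟨by omega, by omega, (hiff _ (by omega) (by omega)).2 hx0⟩, by omega⟩

theorem forkMult_even (e m : ℕ) :
    forkMult (2 * e) m = (m - 1) / e + dvdInd (2 * e) m := by
  rw [forkMult, ← Nat.Ioc_filter_dvd_card_eq_div]
  congr 3
  ext i
  exact Nat.mul_dvd_mul_iff_left two_pos

end Windows

section Stages

variable {n d : ℕ} {σ : Finset ℕ}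

/-- The class of a position: the multiple `d * j` has class `2 * j + 1` and the positions strictly
between `d * j` and `d * (j + 1)` have class `2 * j`. -/
def cls (d x : ℕ) : ℕ := 2 * (x / d) + dvdInd d x

theorem cls_mul (hd : 0 < d) (j : ℕ) : cls d (d * j) = 2 * j + 1 := by
  simp [cls, dvdInd, Nat.mul_div_cancel_left _ hd]

theorem cls_block {x j : ℕ} (h1 : d * j < x) (h2 : x < d * (j + 1)) : cls d x = 2 * j := by
  have hj : x / d = j := Nat.div_eq_of_lt_le (by rw [mul_comm]; exact h1.le) (by rwa [mul_comm])
  rw [cls, hj, dvdInd, if_neg, add_zero]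
  intro h
  have := Nat.mul_div_cancel' h
  rw [hj] at this
  omega

theorem cls_lt {x j : ℕ} (hd : 0 < d) (h : x < d * j) : cls d x < 2 * j := by
  have h1 : x / d < j := (Nat.div_lt_iff_lt_mul hd).2 (by rwa [mul_comm])
  have h2 : dvdInd d x ≤ 1 := by
    unfold dvdInd
    split_ifs <;> omega
  unfold cls
  omega

theorem le_cls {x j : ℕ} (hd : 0 < d) (h : d * j ≤ x) : 2 * j ≤ cls d x := by
  have h1 : j ≤ x / d := (Nat.le_div_iff_mul_le hd).2 (by rwa [mul_comm])
  unfold cls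
  omega

theorem cls_le {x : ℕ} (hx : x ≤ n) : cls d x ≤ 2 * n + 1 := by
  have h1 : x / d ≤ x := Nat.div_le_self x d
  have h2 : dvdInd d x ≤ 1 := by
    unfold dvdInd
    split_ifs <;> omega
  unfold cls
  omega

/-- The smallest class of a position missing from `σ`. -/
def stage (n d : ℕ) (σ : Finset ℕ) : ℕ :=
  (insert (2 * n + 2) ((Finset.range (n + 1) \ σ).image (cls d))).min' (Finset.insert_nonempty _ _)

theorem stage_le {x : ℕ} (hx : x ≤ n) (hxσ : x ∉ σ) : stage n d σ ≤ cls d x := by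
  apply Finset.min'_le
  apply Finset.mem_insert_of_mem
  apply Finset.mem_image_of_mem
  simp only [Finset.mem_sdiff, Finset.mem_range]
  exact ⟨by omega, hxσ⟩

theorem stage_eq (n d : ℕ) (σ : Finset ℕ) :
    stage n d σ = 2 * n + 2 ∨ ∃ x ≤ n, x ∉ σ ∧ stage n d σ = cls d x := by
  have h := Finset.min'_mem (insert (2 * n + 2) ((Finset.range (n + 1) \ σ).image (cls d)))
    (Finset.insert_nonempty _ _)
  rw [← stage, Finset.mem_insert, Finset.mem_image] at h
  rcases h with h | ⟨x, h1, h2⟩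
  · exact Or.inl h
  · simp only [Finset.mem_sdiff, Finset.mem_range] at h1
    exact Or.inr ⟨x, by omega, h1.2, h2.symm⟩

theorem stage_mono {σ' : Finset ℕ} (h : σ ⊆ σ') : stage n d σ ≤ stage n d σ' := by
  rcases stage_eq n d σ' with h' | ⟨x, h1, h2, h3⟩
  · rw [h']
    rcases stage_eq n d σ with h'' | ⟨x, h1, h2, h3⟩
    · exact h''.le
    · rw [h3]
      exact (cls_le h1).trans (by omega)
  · rw [h3]
    exact stage_le h1 fun h4 => h2 (h h4)

theorem exists_stage {z : ℕ} (hz : z ≤ n) (hzσ : z ∉ σ) :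
    ∃ x ≤ n, x ∉ σ ∧ stage n d σ = cls d x := by
  rcases stage_eq n d σ with h | h
  · have := stage_le (d := d) hz hzσ
    have := cls_le (d := d) hz
    omega
  · exact h

theorem mem_of_lt_stage {x : ℕ} (hx : x ≤ n) (h : cls d x < stage n d σ) : x ∈ σ := by
  by_contra h'
  exact absurd (stage_le (d := d) hx h') (by omega)

theorem stage_insert {t : ℕ} (ht : t ≤ n) (h : stage n d σ < cls d t) :
    stage n d (insert t σ) = stage n d σ := by
  apply le_antisymm _ (stage_mono (Finset.subset_insert _ _))
  rcases stage_eq n d σ with h' | ⟨x, h1, h2, h3⟩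
  · have := cls_le (d := d) ht
    omega
  · rw [h3]
    refine stage_le h1 fun h4 => ?_
    rcases Finset.mem_insert.1 h4 with rfl | h5
    · omega
    · exact h2 h5

/-- The multiplicity bound attached to `σ` in the filtration by stages. -/
noncomputable def wt (n d : ℕ) (σ : Finset ℕ) : ℕ :=
  stage n d σ + (hits n d σ (d * ((stage n d σ + 1) / 2))).card

theorem wt_insert {t : ℕ} (hd : 0 < d) (ht : t = d * ((stage n d σ + 1) / 2)) (htn : t ≤ n) :
    wt n d (insert t σ) = wt n d σ := by
  have h : stage n d (insert t σ) = stage n d σ := stage_insert htn (by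
    rw [ht, cls_mul hd]
    omega)
  unfold wt
  rw [h]
  congr 2
  apply hits_congr
  intro y hy _
  simp [show y ≠ t by omega]

theorem card_ge_of_two_missing {a b : ℕ}
    (h : ∀ z ≤ n, z ∉ σ → z = a ∨ z = b) : n + 1 ≤ σ.card + ({a, b} : Finset ℕ).card := by
  have : Finset.range (n + 1) ⊆ σ ∪ {a, b} := by
    intro z hz
    simp only [Finset.mem_union, Finset.mem_insert, Finset.mem_singleton]
    by_cases hzσ : z ∈ σ
    · exact Or.inl hzσ
    · exact Or.inr (h z (by have := Finset.mem_range.1 hz; omega) hzσ)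
  have := (Finset.card_le_card this).trans (Finset.card_union_le _ _)
  rwa [Finset.card_range] at this

theorem exists_missing_ne (hc : σ.card + 1 ≤ n) (a : ℕ) :
    ∃ z ≤ n, z ∉ σ ∧ z ≠ a := by
  by_contra! h
  have := card_ge_of_two_missing (n := n) (σ := σ) (a := a) (b := a) fun z h1 h2 => Or.inl (h z h1 h2)
  simp at this
  omega

theorem stage_odd (hd : 0 < d) (hc : σ.card + 1 ≤ n) {j : ℕ}
    (hs : stage n d σ = 2 * j + 1) : d * j ≤ n ∧ d * j ∉ σ ∧
      (∀ y, y < d * j → y ∈ σ) ∧ (∀ y, d * j < y → y < d * (j + 1) → y ∈ σ) ∧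
      ∃ z, d * (j + 1) ≤ z ∧ z ≤ n ∧ z ∉ σ := by
  obtain ⟨z, hz1, hz2, -⟩ := exists_missing_ne hc 0
  obtain ⟨x, hx1, hx2, hx3⟩ := exists_stage (d := d) hz1 hz2
  have hxj : x = d * j := by
    rcases Nat.lt_trichotomy x (d * j) with h | h | h
    · have := cls_lt hd h
      omega
    · exact h
    · by_cases h' : x < d * (j + 1)
      · have := cls_block h h'
        omega
      · have := le_cls hd (not_lt.1 h')
        omega
  subst hxj
  obtain ⟨z, hz1, hz2, hz3⟩ := exists_missing_ne hc (d * j)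
  have h1 : ∀ y, y < d * j → y ∈ σ := fun y hy => mem_of_lt_stage (d := d) (n := n) (by omega) (by
    have := cls_lt hd hy
    omega)
  have h2 : ∀ y ≤ n, d * j < y → y < d * (j + 1) → y ∈ σ := fun y hyn hy hy' =>
    mem_of_lt_stage (d := d) (n := n) hyn (by
      have := cls_block hy hy'
      omega)
  have hz : d * (j + 1) ≤ z := by
    by_contra! h
    rcases lt_or_gt_of_ne hz3 with h' | h'
    · exact hz2 (h1 z h')
    · exact hz2 (h2 z hz1 h' h)
  exact ⟨hx1, hx2, h1, fun y hy hy' => h2 y (by omega) hy hy', z, hz, hz1, hz2⟩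

theorem stage_even (hd : 0 < d) {z : ℕ} (hz : z ≤ n) (hzσ : z ∉ σ) {j : ℕ}
    (hs : stage n d σ = 2 * j) : (∀ y, y < d * j → y ∈ σ) ∧
      ∃ x ≤ n, x ∉ σ ∧ d * j < x ∧ x < d * (j + 1) := by
  obtain ⟨x, hx1, hx2, hx3⟩ := exists_stage (d := d) hz hzσ
  have h1 : d * j < x := by
    by_contra! h
    rcases h.lt_or_eq with h | h
    · have := cls_lt hd h
      omega
    · rw [h, cls_mul hd] at hx3
      omega
  have h2 : x < d * (j + 1) := by
    by_contra! h
    have := le_cls hd h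
    omega
  refine ⟨fun y hy => mem_of_lt_stage (d := d) (n := n) (by omega) (by
    have := cls_lt hd hy
    omega), x, hx1, hx2, h1, h2⟩

end Stages

section EvenWeights

variable {n e : ℕ} {σ : Finset ℕ}

theorem wt_mono {W : Type*} [Group W] {Mat : CoxeterMatrix (Fin (n + 1))}
    (cs : CoxeterSystem Mat W) (hn : 3 ≤ n)
    (hM : ∀ i j : Fin (n + 1), i.val < j.val → Mat.M i j = affBEntry n i.val j.val)
    (he : 1 ≤ e) {σ' : Finset ℕ} (h : σ ⊆ σ') (hc : σ'.card + 1 ≤ n) :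
    wt n (2 * e) σ ≤ wt n (2 * e) σ' := by
  let f : ℕ → ℕ := fun r => r + (hits n (2 * e) σ' (2 * e * ((r + 1) / 2))).card
  have hd : 0 < 2 * e := by omega
  have heven : ∀ i, f (2 * i) = 2 * i + (hits n (2 * e) σ' (2 * e * i)).card := fun i => by
    simp only [f]
    rw [show (2 * i + 1) / 2 = i by omega]
  have hodd : ∀ i, f (2 * i + 1) = 2 * i + 1 + (hits n (2 * e) σ' (2 * e * (i + 1))).card :=
    fun i => by
    simp only [f]
    rw [show (2 * i + 1 + 1) / 2 = i + 1 by omega]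
  have hmul : ∀ i, 2 * e * (i + 1) = 2 * e * i + 2 * e := fun i => by ring
  have hstep : ∀ i, f (2 * i) ≤ f (2 * (i + 1)) := fun i => by
    rw [heven, heven, card_hits_window (lo := 2 * e * i) (hi := 2 * e * (i + 1)) (by rw [hmul]; omega),
      hmul]
    have := card_window_le_two (n := n) (e := e) (σ := σ') (lo := 2 * e * i)
    omega
  have hmono : Monotone fun i => f (2 * i) := monotone_nat_of_le_succ hstep
  have hodd_even : ∀ i, f (2 * i + 1) ≤ f (2 * (i + 1)) := fun i => by
    rw [heven, hodd]
    omega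
  have hle : stage n (2 * e) σ ≤ stage n (2 * e) σ' := stage_mono h
  have h1 : wt n (2 * e) σ ≤ f (stage n (2 * e) σ) :=
    Nat.add_le_add_left (card_hits_mono cs hn hM (by omega) h _) _
  refine h1.trans (show f (stage n (2 * e) σ) ≤ f (stage n (2 * e) σ') from ?_)
  have hlast : ∀ j, stage n (2 * e) σ' = 2 * j + 1 → f (2 * j + 1) = f (2 * j) := by
    intro j hj
    obtain ⟨-, -, -, h2, z, h3, h4, h5⟩ := stage_odd hd hc hj
    rw [heven, hodd, card_hits_window (lo := 2 * e * j) (hi := 2 * e * (j + 1)) (by rw [hmul]; omega)]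
    rw [hmul] at h2 h3 ⊢
    rw [card_window_eq_one he h3 h4 h5 h2]
    omega
  generalize hr : stage n (2 * e) σ = r at hle ⊢
  obtain ⟨i, hi⟩ := Nat.even_or_odd' r
  obtain ⟨j, hj⟩ := Nat.even_or_odd' (stage n (2 * e) σ')
  have hup : r < 2 * j → f r ≤ f (2 * j) := by
    intro hlt
    rcases hi with rfl | rfl
    · exact hmono (show i ≤ j by omega)
    · exact (hodd_even i).trans (hmono (show i + 1 ≤ j by omega))
  rcases hj with hj | hj
  · rcases hle.lt_or_eq with h | h
    · rw [hj] at h ⊢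
      exact hup h
    · rw [h]
  · have h2 := hlast j hj
    rw [hj] at hle ⊢
    rcases (show r < 2 * j ∨ r = 2 * j ∨ r = 2 * j + 1 by omega) with h | h | h
    · rw [h2]
      exact hup h
    · rw [h2, h]
    · rw [h]

theorem vmult_fork_block (he : 1 ≤ e) {g j : ℕ} (hg2 : 2 ≤ g) (hgn : g ≤ n) (h1 : g ∉ σ)
    (h2 : ∀ y < g, y ∈ σ) (hlo : 2 * e * j ≤ g) (hhi : g < 2 * e * j + 2 * e) :
    2 * j + (hits n (2 * e) σ (2 * e * j)).card ≤ vmult n (2 * e) σ ∧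
      vmult n (2 * e) σ ≤ 2 * j + (hits n (2 * e) σ (2 * e * j)).card + 1 := by
  have hh : hits n (2 * e) σ (2 * e * j) = hits n (2 * e) σ g := by
    ext x
    simp only [mem_hits]
    refine ⟨fun ⟨h3, h4, h5⟩ => ⟨?_, h4, h5⟩, fun ⟨h3, h4, h5⟩ => ⟨by omega, h4, h5⟩⟩
    by_contra! h6
    have h7 : x ≠ g := fun h => h1 (h ▸ h5.mem h4)
    rw [hit_iff_of_gap (g := g) (by omega) hgn h1 fun y _ h8 => h2 y h8] at h5
    have := Nat.le_of_dvd (by omega) h5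
    omega
  rw [vmult_of_fork hg2 h1 h2, forkMult_even, hh]
  have h3 : e * (2 * j) = 2 * e * j := by ring
  rcases hlo.lt_or_eq with hlt | heq
  · have h4 : dvdInd (2 * e) g = 0 := by
      refine if_neg fun h => ?_
      have h5 := Nat.dvd_sub h (Dvd.intro j rfl : 2 * e ∣ 2 * e * j)
      have := Nat.le_of_dvd (by omega) h5
      omega
    have h5 : 2 * j ≤ (g - 1) / e := (Nat.le_div_iff_mul_le he).2 (by rw [mul_comm]; omega)
    have h6 : (g - 1) / e < 2 * j + 2 :=
      (Nat.div_lt_iff_lt_mul he).2 (by rw [mul_comm, mul_add, h3]; omega)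
    omega
  · have h4 : dvdInd (2 * e) g = 1 := if_pos ⟨j, heq.symm⟩
    obtain ⟨i, rfl⟩ : ∃ i, j = i + 1 := Nat.exists_eq_succ_of_ne_zero (by
      rintro rfl
      omega)
    have h5 : (g - 1) / e = 2 * i + 1 := by
      have h7 : 2 * e * (i + 1) = e * (2 * i + 1) + e := by ring
      rw [Nat.div_eq_iff he]
      rw [mul_comm (2 * i + 1)]
      omega
    omega

theorem wt_le_vmult (he : 1 ≤ e) (hc : σ.card + 1 ≤ n) :
    wt n (2 * e) σ ≤ vmult n (2 * e) σ ∧ vmult n (2 * e) σ ≤ wt n (2 * e) σ + 1 := by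
  have hd : 0 < 2 * e := by omega
  have hmul : ∀ i, 2 * e * (i + 1) = 2 * e * i + 2 * e := fun i => by ring
  unfold wt
  obtain ⟨j, hj⟩ := Nat.even_or_odd' (stage n (2 * e) σ)
  rcases hj with hj | hj
  · obtain ⟨z, hz, hzσ, -⟩ := exists_missing_ne hc 0
    obtain ⟨h1, x, hxn, hxσ, hx1, hx2⟩ := stage_even hd hz hzσ hj
    rw [hj, show (2 * j + 1) / 2 = j by omega]
    rw [hmul] at hx2
    by_cases h0 : 0 ∈ σ
    · by_cases h01 : 1 ∈ σ
      · obtain h | ⟨g, h2, h3, h4, h5⟩ := exists_gap n σ 1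
        · refine absurd (h x ?_ hxn) hxσ
          by_contra! h'
          rcases (show x = 0 ∨ x = 1 by omega) with rfl | rfl
          exacts [hxσ h0, hxσ h01]
        · have h6 : ∀ y < g, y ∈ σ := fun y hy => by
            rcases (show y = 0 ∨ y = 1 ∨ 1 < y by omega) with rfl | rfl | h7
            exacts [h0, h01, h5 y h7 hy]
          refine vmult_fork_block he h2 h3 h4 h6 ?_ ?_
          · by_contra! h
            exact h4 (h1 g h)
          · by_contra! h
            exact hxσ (h6 x (by omega))
      · obtain rfl : j = 0 := by
          by_contra h
          apply h01
          apply h1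
          have := Nat.mul_le_mul_left (2 * e) (Nat.one_le_iff_ne_zero.2 h)
          omega
        rw [vmult_of_path fun h => h01 h.2, mul_zero, mul_zero, zero_add]
        have hw : ∀ τ : Finset ℕ, (hits n (2 * e) τ 0).card =
            ((hits n (2 * e) τ 0).filter (· ≤ 1)).card + (hits n (2 * e) τ 1).card := fun τ =>
          card_hits_window zero_le_one
        have h2 : hits n (2 * e) (σ.image (max 1)) 1 = hits n (2 * e) σ 1 := by
          apply hits_congr
          intro y hy _
          rw [Finset.mem_image]
          constructor
          · rintro ⟨x, hx, rfl⟩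
            rwa [max_eq_right]
            by_contra! h
            rw [max_eq_left h.le] at hy
            omega
          · exact fun h => ⟨y, h, max_eq_right (by omega)⟩
        have h3 : (hits n (2 * e) σ 0).filter (· ≤ 1) = ∅ := by
          ext x
          simp only [Finset.mem_filter, mem_hits, Finset.notMem_empty, iff_false]
          rintro ⟨⟨h4, h5, h6⟩, h7⟩
          obtain rfl : x = 1 := by omega
          exact h01 (h6.mem h5)
        have h4 : ((hits n (2 * e) (σ.image (max 1)) 0).filter (· ≤ 1)).card ≤ 1 := by
          rw [Finset.card_le_one]
          intro a ha b hb
          simp only [Finset.mem_filter, mem_hits] at ha hb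
          omega
        rw [hw, hw, h2, h3, Finset.card_empty]
        omega
    · obtain rfl : j = 0 := by
        by_contra h
        exact h0 (h1 0 (Nat.mul_pos hd (Nat.pos_of_ne_zero h)))
      rw [vmult_of_zero_notMem h0]
      simp
  · obtain ⟨h1, h2, h3, h4, z, h5, h6, h7⟩ := stage_odd hd hc hj
    rw [hj, show (2 * j + 1 + 1) / 2 = j + 1 by omega]
    have h8 := card_hits_window (n := n) (d := 2 * e) (σ := σ) (lo := 2 * e * j)
      (hi := 2 * e * (j + 1)) (by rw [hmul]; omega)
    rw [hmul] at h4 h5 h8 ⊢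
    rw [card_window_eq_one he h5 h6 h7 h4] at h8
    rcases Nat.eq_zero_or_pos j with rfl | hj0
    · rw [mul_zero] at h2 h8
      rw [vmult_of_zero_notMem h2, h8]
      simp only [mul_zero]
      omega
    · have h9 := Nat.mul_le_mul_left (2 * e) hj0
      obtain ⟨i, rfl⟩ : ∃ i, j = i + 1 := Nat.exists_eq_succ_of_ne_zero (by omega)
      have h10 : (2 * e * (i + 1) - 1) / e = 2 * i + 1 := by
        have h7 : 2 * e * (i + 1) = e * (2 * i + 1) + e := by ring
        rw [Nat.div_eq_iff he]
        rw [mul_comm (2 * i + 1)]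
        omega
      rw [vmult_of_fork (by omega) h2 h3, forkMult_even, h10, h8,
        show dvdInd (2 * e) (2 * e * (i + 1)) = 1 from if_pos (Dvd.intro _ rfl)]
      omega

end EvenWeights

section OddWeights

variable {n d : ℕ}

theorem hits_erase_of_odd (hd : 2 ≤ d) (hodd : Odd d) {τ : Finset ℕ} (hτ : n ∈ τ) (lo : ℕ) :
    hits n d (τ.erase n) lo = hits n d τ lo := by
  ext x
  simp only [mem_hits]
  refine and_congr_right fun _ => and_congr_right fun hxn => ?_
  rcases hxn.lt_or_eq with hlt | rfl
  · by_cases hx : x ∈ τ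
    · rcases exists_gap n τ x with h | ⟨g, h1, h2, h3, h4⟩
      · have hall : ∀ y, x ≤ y → y ≤ n → y ∈ τ := fun y h1 h2 =>
          h1.lt_or_eq.elim (fun h3 => h y h3 h2) fun h3 => h3 ▸ hx
        rw [hit_iff_of_tail hall, hit_iff_of_gap hlt le_rfl (Finset.notMem_erase n τ)
          fun y h1 h2 => Finset.mem_erase.2 ⟨h2.ne, hall y h1 h2.le⟩,
          (Nat.coprime_two_right.2 hodd).dvd_mul_left, show n + 1 - x = n - x + 1 by omega]
      · have hgn : g ≠ n := fun h => h3 (h ▸ hτ)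
        have hall : ∀ y, x ≤ y → y < g → y ∈ τ := fun y h1 h2 =>
          h1.lt_or_eq.elim (fun h3 => h4 y h3 h2) fun h3 => h3 ▸ hx
        rw [hit_iff_of_gap h1 h2 h3 hall, hit_iff_of_gap h1 h2
          (fun h => h3 (Finset.mem_of_mem_erase h))
          fun y h5 h6 => Finset.mem_erase.2 ⟨by omega, hall y h5 h6⟩]
    · exact ⟨fun h => absurd (Finset.mem_of_mem_erase (h.mem hxn)) hx, fun h => absurd (h.mem hxn) hx⟩
  · refine ⟨fun h => absurd (h.mem le_rfl) (Finset.notMem_erase x τ), fun h => ?_⟩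
    rw [hit_iff_of_tail fun y h1 h2 => (le_antisymm h1 h2) ▸ hτ] at h
    have := Nat.le_of_dvd (by omega) h
    obtain ⟨k, rfl⟩ := hodd
    omega

theorem vmult_erase_of_odd (hn : 3 ≤ n) (hd : 2 ≤ d) (hodd : Odd d) {σ : Finset ℕ}
    (hc : σ.card ≤ n) : vmult n d (σ.erase n) = vmult n d σ := by
  by_cases hnσ : n ∈ σ
  swap
  · rw [Finset.erase_eq_of_notMem hnσ]
  obtain ⟨z, hz, hzσ⟩ : ∃ z ≤ n, z ∉ σ := by
    by_contra! h
    have : Finset.range (n + 1) ⊆ σ := fun z hz => h z (by have := Finset.mem_range.1 hz; omega)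
    have := Finset.card_le_card this
    rw [Finset.card_range] at this
    omega
  by_cases h01 : 0 ∈ σ ∧ 1 ∈ σ
  · obtain h | ⟨g, h2, h3, h4, h5⟩ := exists_gap n σ 1
    · refine absurd (h z ?_ hz) hzσ
      by_contra! h'
      rcases (show z = 0 ∨ z = 1 by omega) with rfl | rfl
      exacts [hzσ h01.1, hzσ h01.2]
    · have h6 : ∀ y < g, y ∈ σ := fun y hy => by
        rcases (show y = 0 ∨ y = 1 ∨ 1 < y by omega) with rfl | rfl | h7
        exacts [h01.1, h01.2, h5 y h7 hy]
      rw [vmult_of_fork h2 h4 h6, vmult_of_fork h2 (fun h => h4 (Finset.mem_of_mem_erase h))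
        fun y hy => Finset.mem_erase.2 ⟨by omega, h6 y hy⟩, hits_erase_of_odd hd hodd hnσ]
  · have h1 : (σ.erase n).image (max 1) = (σ.image (max 1)).erase n := by
      ext y
      simp only [Finset.mem_image, Finset.mem_erase]
      constructor
      · rintro ⟨x, ⟨h1, h2⟩, rfl⟩
        exact ⟨by omega, x, h2, rfl⟩
      · rintro ⟨h1, x, h2, rfl⟩
        exact ⟨x, ⟨by omega, h2⟩, rfl⟩
    rw [vmult_of_path h01, vmult_of_path fun h => h01
      ⟨Finset.mem_of_mem_erase h.1, Finset.mem_of_mem_erase h.2⟩, h1, hits_erase_of_odd hd hodd]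
    exact Finset.mem_image.2 ⟨n, hnσ, by omega⟩

end OddWeights

section TopWeights

variable {n e : ℕ} {σ : Finset ℕ}

theorem card_hits_tail {lo : ℕ} (h : ∀ y, lo < y → y ≤ n → y ∈ σ) :
    (hits n (2 * e) σ lo).card = (n - lo) / e := by
  rw [← Nat.Ioc_filter_dvd_card_eq_div]
  refine Finset.card_nbij' (fun x => n + 1 - x) (fun x => n + 1 - x) ?_ ?_ ?_ ?_
  · intro x hx
    simp only [Finset.mem_coe, mem_hits] at hx
    obtain ⟨h1, h2, h3⟩ := hx
    rw [hit_iff_of_tail fun y h4 h5 => h y (by omega) h5, Nat.mul_dvd_mul_iff_left two_pos] at h3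
    simp only [Finset.mem_coe, Finset.mem_filter, Finset.mem_Ioc]
    exact ⟨by omega, h3⟩
  · intro x hx
    simp only [Finset.mem_coe, Finset.mem_filter, Finset.mem_Ioc] at hx
    simp only [Finset.mem_coe, mem_hits]
    refine ⟨by omega, by omega, ?_⟩
    rw [hit_iff_of_tail fun y h4 h5 => h y (by omega) h5, Nat.mul_dvd_mul_iff_left two_pos,
      show n + 1 - (n + 1 - x) = x by omega]
    exact hx.2
  · intro x hx
    simp only [Finset.mem_coe, mem_hits] at hx
    simp only
    omega
  · intro x hx
    simp only [Finset.mem_coe, Finset.mem_filter, Finset.mem_Ioc] at hx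
    simp only
    omega

theorem card_hits_gap (he : 1 ≤ e) {a b : ℕ} (hab : a ≤ b) (hbn : b ≤ n) (hb : b ∉ σ)
    (h : ∀ y, a < y → y < b → y ∈ σ) (h' : ∀ y, b < y → y ≤ n → y ∈ σ) :
    (b - a) / (2 * e) + (n - b) / e ≤ (hits n (2 * e) σ a).card := by
  rw [card_hits_window hab, card_hits_tail h']
  apply Nat.add_le_add_right
  rw [← Nat.Ioc_filter_dvd_card_eq_div]
  refine Finset.card_le_card_of_injOn (fun x => b + 1 - x) ?_ ?_
  · intro x hx
    simp only [Finset.mem_coe, Finset.mem_filter, Finset.mem_Ioc] at hx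
    have := Nat.le_of_dvd (by omega) hx.2
    simp only [Finset.mem_coe, Finset.mem_filter, mem_hits]
    refine ⟨⟨by omega, by omega, ?_⟩, by omega⟩
    rw [hit_iff_of_gap (g := b) (by omega) hbn hb fun y h1 h2 => h y (by omega) h2,
      show b - (b + 1 - x) + 1 = x by omega]
    exact hx.2
  · intro x hx y hy hxy
    simp only [Finset.mem_coe, Finset.mem_filter, Finset.mem_Ioc] at hx hy
    simp only at hxy
    omega

theorem vmult_compl_one :
    vmult n (2 * e) ((Finset.range (n + 1)).erase 1) = n / e := by
  rw [vmult_of_path (by simp), card_hits_tail, Nat.sub_zero]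
  intro y h1 h2
  rw [Finset.mem_image]
  rcases (show y = 1 ∨ 1 < y by omega) with rfl | h
  · exact ⟨0, by simp, rfl⟩
  · exact ⟨y, by simp; omega, by omega⟩

theorem vmult_compl_single {i : ℕ} (hi : 2 ≤ i) (hin : i ≤ n) :
    vmult n (2 * e) ((Finset.range (n + 1)).erase i) =
      (i - 1) / e + dvdInd (2 * e) i + (n - i) / e := by
  rw [vmult_of_fork hi (by simp) (fun y hy => by simp; omega), forkMult_even, card_hits_tail]
  intro y h1 h2
  simp
  omega

theorem le_vmult_compl_zero (he : 1 ≤ e) {b : ℕ} (hb : 1 ≤ b) (hbn : b ≤ n) :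
    b / (2 * e) + (n - b) / e ≤ vmult n (2 * e) (((Finset.range (n + 1)).erase 0).erase b) := by
  rw [vmult_of_zero_notMem (by simp)]
  have := card_hits_gap (σ := ((Finset.range (n + 1)).erase 0).erase b) he (a := 0) (b := b)
    (Nat.zero_le _) hbn (by simp) (fun y h1 h2 => by simp; omega) (fun y h1 h2 => by simp; omega)
  simpa using this

theorem le_vmult_compl_pair (he : 1 ≤ e) {a b : ℕ} (ha : 2 ≤ a) (hab : a < b) (hbn : b ≤ n) :
    (a - 1) / e + dvdInd (2 * e) a + ((b - a) / (2 * e) + (n - b) / e) ≤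
      vmult n (2 * e) (((Finset.range (n + 1)).erase a).erase b) := by
  rw [vmult_of_fork ha (by simp) (fun y hy => by simp; omega), forkMult_even]
  apply Nat.add_le_add_left
  exact card_hits_gap he hab.le hbn (by simp) (fun y h1 h2 => by simp; omega)
    (fun y h1 h2 => by simp; omega)

/-- The divisibility exponents of the chains missing `0` and `i` are within one of those of the
chains missing `i`, as soon as they can be propagated along the pairs missing `a` and `b`. -/
theorem top_induction (he : 1 ≤ e) {P : ℕ → ℕ → Prop}
    (hP : ∀ i m m', m ≤ m' → P i m' → P i m)
    (h0 : ∀ i, 1 ≤ i → i ≤ n →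
      P i (vmult n (2 * e) (((Finset.range (n + 1)).erase 0).erase i)))
    (hpair : ∀ a b m, 1 ≤ a → a < b → b ≤ n →
      m ≤ vmult n (2 * e) (((Finset.range (n + 1)).erase a).erase b) → P a m → P b m)
    (i : ℕ) (hi : 1 ≤ i) (hin : i ≤ n) :
    P i (vmult n (2 * e) ((Finset.range (n + 1)).erase i) - 1) := by
  induction i using Nat.strong_induction_on with
  | _ i ih =>
    rcases hi.eq_or_lt with rfl | hi2
    · refine hP _ _ _ ?_ (h0 1 le_rfl hin)
      refine le_trans ?_ (le_vmult_compl_zero he le_rfl hin)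
      rw [vmult_compl_one]
      have : n / e ≤ (n - 1 + e) / e := Nat.div_le_div_right (by omega)
      rw [Nat.add_div_right _ he] at this
      lia
    · have hi2 : 2 ≤ i := hi2
      rw [vmult_compl_single hi2 hin]
      by_cases hdvd : 2 * e ∣ i
      · have h1 : dvdInd (2 * e) i = 1 := if_pos hdvd
        obtain ⟨j, rfl⟩ := hdvd
        obtain ⟨j, rfl⟩ : ∃ l, j = l + 1 := Nat.exists_eq_succ_of_ne_zero (by
          rintro rfl
          omega)
        have hdiv : ∀ j, (2 * e * (j + 1) - 1) / e = 2 * j + 1 := by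
          intro j
          have h7 : 2 * e * (j + 1) = e * (2 * j + 1) + e := by ring
          rw [Nat.div_eq_iff he, mul_comm (2 * j + 1)]
          omega
        have hmul : 2 * e * (j + 1) = 2 * e * j + 2 * e := by ring
        rw [h1, hdiv]
        rcases Nat.eq_zero_or_pos j with rfl | hj
        · refine hP _ _ _ ?_ (h0 _ hi hin)
          refine le_trans ?_ (le_vmult_compl_zero he hi hin)
          rw [zero_add, mul_one, Nat.div_self (by omega)]
          lia
        · obtain ⟨l, rfl⟩ : ∃ l, j = l + 1 := Nat.exists_eq_succ_of_ne_zero (by omega)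
          have hmul2 : 2 * e * (l + 1) = 2 * e * l + 2 * e := by ring
          have ha : 2 ≤ 2 * e * (l + 1) := by omega
          have h2 : dvdInd (2 * e) (2 * e * (l + 1)) = 1 := if_pos (Dvd.intro _ rfl)
          refine hpair (2 * e * (l + 1)) _ _ (by omega) (by omega) hin ?_ ?_
          · refine le_trans ?_ (le_vmult_compl_pair he ha (by omega) hin)
            rw [h2, hdiv, show 2 * e * (l + 1 + 1) - 2 * e * (l + 1) = 2 * e by omega,
              Nat.div_self (by omega)]
            lia
          · have h3 := ih (2 * e * (l + 1)) (by omega) (by omega) (by omega)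
            rw [vmult_compl_single ha (by omega), h2, hdiv] at h3
            have h4 : n - 2 * e * (l + 1) = n - 2 * e * (l + 1 + 1) + e * 2 := by
              have := mul_comm e 2
              omega
            rw [h4, Nat.add_mul_div_left _ _ he] at h3
            exact hP _ _ _ (by omega) h3
      · rw [show dvdInd (2 * e) i = 0 from if_neg hdvd]
        by_cases hie : i ≤ e + 1
        · refine hP _ _ _ ?_ (h0 i hi hin)
          refine le_trans ?_ (le_vmult_compl_zero he hi hin)
          have : (i - 1) / e ≤ e / e := Nat.div_le_div_right (by omega)
          rw [Nat.div_self he] at this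
          lia
        · have h1 : (i - 1) / e = (i - e - 1) / e + 1 := by
            rw [← Nat.add_div_right _ he]
            congr 1
            omega
          refine hpair (i - e) i _ (by omega) (by omega) hin ?_ ?_
          · refine le_trans ?_ (le_vmult_compl_pair he (by omega) (by omega) hin)
            lia
          · have h3 := ih (i - e) (by omega) (by omega) (by omega)
            rw [vmult_compl_single (by omega) (by omega), show n - (i - e) = n - i + e by omega,
              Nat.add_div_right _ he] at h3
            exact hP _ _ _ (by omega) h3

end TopWeights

section Filling

variable {n : ℕ}

/-- The underlying natural numbers of a set of nodes. -/
def vals (σ : Finset (Fin (n + 1))) : Finset ℕ := σ.map Fin.valEmbedding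

theorem mem_vals {σ : Finset (Fin (n + 1))} {x : ℕ} :
    x ∈ vals σ ↔ ∃ h : x < n + 1, (⟨x, h⟩ : Fin (n + 1)) ∈ σ := by
  simp only [vals, Finset.mem_map, Fin.valEmbedding_apply]
  constructor
  · rintro ⟨i, hi, rfl⟩
    exact ⟨i.isLt, hi⟩
  · rintro ⟨h, hi⟩
    exact ⟨_, hi, rfl⟩

theorem val_mem_vals {σ : Finset (Fin (n + 1))} {i : Fin (n + 1)} : i.val ∈ vals σ ↔ i ∈ σ :=
  mem_vals.trans ⟨fun ⟨_, h⟩ => h, fun h => ⟨i.isLt, h⟩⟩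

theorem toFin_vals (σ : Finset (Fin (n + 1))) : toFin n (vals σ) = σ := by
  ext i
  rw [mem_toFin, val_mem_vals]

theorem vals_toFin {τ : Finset ℕ} (h : τ ⊆ Finset.range (n + 1)) : vals (toFin n τ) = τ := by
  ext x
  rw [mem_vals]
  constructor
  · rintro ⟨h1, h2⟩
    exact mem_toFin.1 h2
  · exact fun h1 => ⟨Finset.mem_range.1 (h h1), mem_toFin.2 h1⟩

theorem card_vals (σ : Finset (Fin (n + 1))) : (vals σ).card = σ.card := Finset.card_map _

theorem vals_insert (s : Fin (n + 1)) (σ : Finset (Fin (n + 1))) :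
    vals (insert s σ) = insert s.val (vals σ) := Finset.map_insert _ _ _

theorem vals_ssubset {σ : Finset (Fin (n + 1))} (h : σ.card ≤ n) :
    vals σ ⊂ Finset.range (n + 1) := by
  refine (Finset.ssubset_iff_subset_ne).2 ⟨fun x hx => ?_, fun he => ?_⟩
  · obtain ⟨h1, -⟩ := mem_vals.1 hx
    exact Finset.mem_range.2 h1
  · have := congrArg Finset.card he
    rw [card_vals, Finset.card_range] at this
    omega

theorem dvd_of_dBdry_eq_zero {B A : Type*} [LinearOrder B] [Fintype B] [CommRing A]
    {F : Finset B → A} {τ : Finset B} {s : B} {D : A} (h : dBdry F τ = 0) (hs : s ∉ τ)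
    (hD : ∀ t, t ∉ τ → t ≠ s → D ∣ F (insert t τ)) : D ∣ F (insert s τ) := by
  rw [dBdry, ← Finset.add_sum_erase _ _ (Finset.mem_compl.2 hs)] at h
  have h1 : F (insert s τ) = -(sgn A s τ * ∑ t ∈ τᶜ.erase s, sgn A t τ * F (insert t τ)) := by
    linear_combination sgn A s τ * h - F (insert s τ) * sgn_mul_self (A := A) s τ
  rw [h1, dvd_neg]
  refine Dvd.dvd.mul_left (Finset.dvd_sum fun t ht => Dvd.dvd.mul_left (hD t ?_ ?_) _) _
  · exact Finset.mem_compl.1 (Finset.mem_of_mem_erase ht)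
  · exact Finset.ne_of_mem_erase ht

theorem exists_filling_of_weight {B A : Type*} [LinearOrder B] [Fintype B] [CommRing A] {φ : A}
    {k : ℕ} (v st w : Finset B → ℕ)
    (hst : ∀ (σ : Finset B) (s : B), st σ ≤ st (insert s σ))
    (hw : ∀ (σ : Finset B) (s : B), σ.card = k → s ∉ σ → w σ ≤ w (insert s σ))
    (htog : ∀ σ₀ : Finset B, σ₀.card = k → ∃ t : B, ∀ σ : Finset B, st σ ≤ st σ₀ →
      st (insert t σ) = st σ ∧ (st σ = st σ₀ → w (insert t σ) = w σ))
    (hwv : ∀ σ, σ.card = k → w σ ≤ v σ) (hvw : ∀ σ, σ.card = k + 1 → v σ ≤ w σ + 1)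
    (F : Finset B → A) (hF : ∀ σ, F σ ≠ 0 → σ.card = k) (hφ : ∀ σ, φ ^ v σ ∣ F σ)
    (hcyc : dBdry F = 0) :
    ∃ G : Finset B → A, (∀ σ, G σ ≠ 0 → σ.card = k + 1) ∧ (∀ σ, φ ^ v σ ∣ G σ) ∧
      dBdry G = φ • F := by
  have hφ' : ∀ σ, φ ^ w σ ∣ F σ := by
    intro σ
    by_cases h : σ.card = k
    · exact (pow_dvd_pow φ (hwv σ h)).trans (hφ σ)
    · rw [not_imp_comm.1 (hF σ) h]
      exact dvd_zero _
  obtain ⟨G, h1, h2, h3⟩ := exists_dBdry_eq st w hst hw htog F hF hφ' hcyc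
  refine ⟨φ • G, fun σ h => h1 σ (right_ne_zero_of_mul h), fun σ => ?_, by rw [dBdry_smul, h3]⟩
  rw [Pi.smul_apply, smul_eq_mul]
  by_cases h : σ.card = k + 1
  · refine (pow_dvd_pow φ (hvw σ h)).trans ?_
    rw [pow_succ']
    exact mul_dvd_mul_left φ (h2 σ)
  · rw [not_imp_comm.1 (h1 σ) h, mul_zero]
    exact dvd_zero _

theorem exists_filling_top {A : Type*} [CommRing A] {φ : A} {e : ℕ} (he : 1 ≤ e) (hn : 1 ≤ n)
    (F : Finset (Fin (n + 1)) → A) (hF : ∀ σ, F σ ≠ 0 → σ.card + 1 = n)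
    (hφ : ∀ σ, φ ^ vmult n (2 * e) (vals σ) ∣ F σ) (hcyc : dBdry F = 0) :
    ∃ G : Finset (Fin (n + 1)) → A, (∀ σ, G σ ≠ 0 → σ.card = n) ∧
      (∀ σ, φ ^ vmult n (2 * e) (vals σ) ∣ G σ) ∧ dBdry G = φ • F := by
  have hcone : ∀ σ, cone 0 F σ ≠ 0 → σ.card = n := by
    intro σ h
    by_cases h0 : 0 ∈ σ
    · rw [cone, if_pos h0] at h
      exact (Finset.card_erase_add_one h0).symm.trans (hF _ (right_ne_zero_of_mul h))
    · exact absurd (by rw [cone, if_neg h0]) h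
  have hsub : ∀ a b : ℕ, ((Finset.range (n + 1)).erase a).erase b ⊆ Finset.range (n + 1) :=
    fun a b => (Finset.erase_subset _ _).trans (Finset.erase_subset _ _)
  have key := top_induction (n := n) he
    (P := fun i m => φ ^ m ∣ F (toFin n (((Finset.range (n + 1)).erase 0).erase i)))
    (fun i m m' h h' => (pow_dvd_pow φ h).trans h')
    (fun i _ _ => by
      have := hφ (toFin n (((Finset.range (n + 1)).erase 0).erase i))
      rwa [vals_toFin (hsub 0 i)] at this)
    (fun a b m ha hab hbn hm hPa => by
      have hins : ∀ x y z : ℕ, ∀ hz : z < n + 1, ({x, y, z} : Finset ℕ) = {0, a, b} → z ≠ x → z ≠ y →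
          insert (⟨z, hz⟩ : Fin (n + 1)) (toFin n (Finset.range (n + 1) \ {0, a, b})) =
            toFin n (((Finset.range (n + 1)).erase x).erase y) := by
        intro x y z hz hset hzx hzy
        rw [← hset]
        ext i
        simp only [Finset.mem_insert, mem_toFin, Finset.mem_sdiff, Finset.mem_range,
          Finset.mem_erase, Finset.mem_singleton, Fin.ext_iff]
        have := i.isLt
        omega
      have h0a : insert (⟨b, by omega⟩ : Fin (n + 1)) (toFin n (Finset.range (n + 1) \ {0, a, b})) =
          toFin n (((Finset.range (n + 1)).erase 0).erase a) :=
        hins 0 a b (by omega) rfl (by omega) (by omega)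
      have h0b : insert (⟨a, by omega⟩ : Fin (n + 1)) (toFin n (Finset.range (n + 1) \ {0, a, b})) =
          toFin n (((Finset.range (n + 1)).erase 0).erase b) :=
        hins 0 b a (by omega) (by rw [Finset.pair_comm]) (by omega) (by omega)
      have hab' : insert (⟨0, by omega⟩ : Fin (n + 1)) (toFin n (Finset.range (n + 1) \ {0, a, b})) =
          toFin n (((Finset.range (n + 1)).erase a).erase b) :=
        hins a b 0 (by omega) (by
          ext x
          simp only [Finset.mem_insert, Finset.mem_singleton]
          tauto) (by omega) (by omega)
      rw [← h0b]
      refine dvd_of_dBdry_eq_zero (congrFun hcyc _) (by simp [mem_toFin]) fun t ht hta => ?_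
      have ht' : t.val = 0 ∨ t.val = b := by
        have h1 := t.isLt
        have h2 : t.val ≠ a := fun h => hta (Fin.ext h)
        simp only [mem_toFin, Finset.mem_sdiff, Finset.mem_range, Finset.mem_insert,
          Finset.mem_singleton] at ht
        omega
      rcases ht' with h | h
      · rw [show t = ⟨0, Nat.succ_pos n⟩ from Fin.ext h, hab']
        refine (pow_dvd_pow φ hm).trans ?_
        have := hφ (toFin n (((Finset.range (n + 1)).erase a).erase b))
        rwa [vals_toFin (hsub a b)] at this
      · rw [show t = ⟨b, Nat.lt_succ_of_le hbn⟩ from Fin.ext h, h0a]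
        exact hPa)
  refine ⟨φ • cone 0 F, fun σ h => hcone σ (right_ne_zero_of_mul h), fun σ => ?_, ?_⟩
  · rw [Pi.smul_apply, smul_eq_mul]
    by_cases hσ : σ.card = n
    swap
    · rw [not_imp_comm.1 (hcone σ) hσ, mul_zero]
      exact dvd_zero _
    by_cases h0 : 0 ∈ σ
    swap
    · rw [cone, if_neg h0, mul_zero]
      exact dvd_zero _
    rw [cone, if_pos h0]
    obtain ⟨i, hi⟩ : ∃ i, σᶜ = {i} := Finset.card_eq_one.1 (by
      rw [Finset.card_compl, Fintype.card_fin]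
      omega)
    have hmem : ∀ j, j ∈ σ ↔ j ≠ i := fun j => by
      rw [← not_iff_not, ← Finset.mem_compl, hi, Finset.mem_singleton, not_not]
    have hvals : vals σ = (Finset.range (n + 1)).erase i.val := by
      ext x
      simp only [mem_vals, hmem, Finset.mem_erase, Finset.mem_range, ne_eq, Fin.ext_iff]
      exact ⟨fun ⟨h, h'⟩ => ⟨h', h⟩, fun ⟨h, h'⟩ => ⟨h', h⟩⟩
    have herase : σ.erase 0 = toFin n (((Finset.range (n + 1)).erase 0).erase i.val) := by
      ext j
      have := j.isLt
      simp only [mem_toFin, hmem, Finset.mem_erase, Finset.mem_range, ne_eq, Fin.ext_iff,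
        Fin.val_zero]
      omega
    have hi0 : i ≠ 0 := fun h => (hmem 0).1 h0 h.symm
    have h1 := key i.val (Nat.one_le_iff_ne_zero.2 fun h => hi0 (Fin.ext h)) (by have := i.isLt; omega)
    rw [hvals, herase]
    refine (pow_dvd_pow φ (show vmult n (2 * e) ((Finset.range (n + 1)).erase i.val) ≤
      vmult n (2 * e) ((Finset.range (n + 1)).erase i.val) - 1 + 1 by omega)).trans ?_
    rw [pow_succ']
    exact mul_dvd_mul_left φ (h1.mul_left _)
  · rw [dBdry_smul, dBdry_cone, hcyc]
    congr 1
    funext σ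
    simp [cone]

variable {W : Type*} [Group W] {Mat : CoxeterMatrix (Fin (n + 1))} (cs : CoxeterSystem Mat W)

/-- A cycle all of whose coefficients are divisible by the `φ`-parts of the Poincaré polynomials
bounds, after multiplication by `φ`, a chain with the same property. -/
theorem exists_filling (cs : CoxeterSystem Mat W) (hn : 3 ≤ n)
    (hM : ∀ i j : Fin (n + 1), i.val < j.val → Mat.M i j = affBEntry n i.val j.val)
    {A : Type*} [CommRing A] {φ : A} {d k : ℕ} (hd : 2 ≤ d) (hk : k < n)
    (F : Finset (Fin (n + 1)) → A) (hF : ∀ σ, F σ ≠ 0 → σ.card = k)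
    (hφ : ∀ σ, φ ^ vmult n d (vals σ) ∣ F σ) (hcyc : dBdry F = 0) :
    ∃ G : Finset (Fin (n + 1)) → A, (∀ σ, G σ ≠ 0 → σ.card = k + 1) ∧
      (∀ σ, φ ^ vmult n d (vals σ) ∣ G σ) ∧ dBdry G = φ • F := by
  rcases Nat.even_or_odd' d with ⟨e, rfl | rfl⟩
  · have he : 1 ≤ e := by omega
    by_cases hkn : k + 1 = n
    · subst hkn
      exact exists_filling_top he (by omega) F (fun σ h => by rw [hF σ h]) hφ hcyc
    · refine exists_filling_of_weight _ (fun σ => stage n (2 * e) (vals σ))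
        (fun σ => wt n (2 * e) (vals σ)) (fun σ s => ?_) (fun σ s hσ hs => ?_) (fun σ₀ hσ₀ => ?_)
        (fun σ hσ => ?_) (fun σ hσ => ?_) F hF hφ hcyc
      · rw [vals_insert]
        exact stage_mono (Finset.subset_insert _ _)
      · refine wt_mono cs hn hM he ?_ ?_
        · rw [vals_insert]
          exact Finset.subset_insert _ _
        · rw [card_vals, Finset.card_insert_of_notMem hs]
          omega
      · have hc : (vals σ₀).card + 1 ≤ n := by
          rw [card_vals]
          omega
        have ht : 2 * e * ((stage n (2 * e) (vals σ₀) + 1) / 2) ≤ n := by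
          obtain ⟨j, hj | hj⟩ := Nat.even_or_odd' (stage n (2 * e) (vals σ₀))
          · obtain ⟨z, hz, hzσ, -⟩ := exists_missing_ne hc 0
            obtain ⟨-, x, hx1, hx2, hx3, hx4⟩ := stage_even (by omega) hz hzσ hj
            rw [hj, show (2 * j + 1) / 2 = j by omega]
            omega
          · obtain ⟨-, -, -, -, z, hz1, hz2, -⟩ := stage_odd (by omega) hc hj
            rw [hj, show (2 * j + 1 + 1) / 2 = j + 1 by omega]
            omega
        refine ⟨⟨_, Nat.lt_succ_of_le ht⟩, fun σ hσ => ?_⟩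
        simp only [vals_insert]
        refine ⟨stage_insert ht ?_, fun h => wt_insert (by omega) (by rw [h]) ht⟩
        rw [cls_mul (by omega)]
        omega
      · exact (wt_le_vmult he (by rw [card_vals]; omega)).1
      · exact (wt_le_vmult he (by rw [card_vals]; omega)).2
  · have hodd : Odd (2 * e + 1) := ⟨e, rfl⟩
    refine exists_filling_of_weight _ (fun _ => 0)
      (fun σ => vmult n (2 * e + 1) ((vals σ).erase n)) (fun _ _ => le_rfl)
      (fun σ s hσ hs => ?_) (fun σ₀ hσ₀ => ?_) (fun σ hσ => ?_) (fun σ hσ => ?_) F hF hφ hcyc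
    · refine vmult_mono cs hn hM hd ?_ ?_
      · rw [vals_insert]
        exact Finset.erase_subset_erase _ (Finset.subset_insert _ _)
      · refine (Finset.erase_subset _ _).trans_ssubset (vals_ssubset ?_)
        rw [Finset.card_insert_of_notMem hs]
        omega
    · refine ⟨Fin.last n, fun σ _ => ⟨rfl, fun _ => ?_⟩⟩
      simp only [vals_insert, Fin.val_last]
      rw [Finset.erase_insert_eq_erase]
    · rw [vmult_erase_of_odd hn hd hodd (by rw [card_vals]; omega)]
    · rw [vmult_erase_of_odd hn hd hodd (by rw [card_vals]; omega)]
      exact Nat.le_succ _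

end Filling

section Transfer

variable {B : Type*} {W : Type*} [Group W] {M : CoxeterMatrix B}
  (cs : CoxeterSystem M W)

open Classical in
/-- A chain of the weighted complex as a function on all simplices, rescaled by the Poincaré
polynomials so that the boundary becomes that of the full simplex. -/
noncomputable def rescale (k : ℕ) (x : KW cs k → R) (σ : Finset B) : R :=
  if h : σ.card = k ∧ (parabolic cs σ : Set W).Finite then toLaurent (poin cs σ) * x ⟨σ, h⟩ else 0

theorem rescale_coe {k : ℕ} (x : KW cs k → R) (σ : KW cs k) :
    rescale cs k x σ.1 = toLaurent (poin cs σ.1) * x σ := dif_pos σ.2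

theorem rescale_of_not {k : ℕ} (x : KW cs k → R) {σ : Finset B}
    (h : ¬(σ.card = k ∧ (parabolic cs σ : Set W).Finite)) : rescale cs k x σ = 0 := dif_neg h

theorem rescale_smul {k : ℕ} (a : R) (x : KW cs k → R) : rescale cs k (a • x) = a • rescale cs k x := by
  funext σ
  rw [Pi.smul_apply, smul_eq_mul]
  by_cases h : σ.card = k ∧ (parabolic cs σ : Set W).Finite
  · have h1 := rescale_coe cs (a • x) ⟨σ, h⟩
    have h2 := rescale_coe cs x ⟨σ, h⟩
    simp only at h1 h2
    rw [h1, h2, Pi.smul_apply, smul_eq_mul]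
    ring
  · rw [rescale_of_not cs _ h, rescale_of_not cs _ h, mul_zero]

variable [LinearOrder B]

theorem HasMult.ne_zero {d k : ℕ} (hd : 0 < d) {p : ℚ[X]} (h : HasMult d p k) : p ≠ 0 := by
  rintro rfl
  obtain ⟨u, h1, h2⟩ := h
  have hu : u = 0 := by
    rcases mul_eq_zero.1 h1.symm with h | h
    · exact absurd (eq_zero_of_pow_eq_zero h) (cyclotomic_ne_zero d ℚ)
    · exact h
  have := HasMult.le_of_dvd hd (k := k + 1) (l := k) ⟨u, by simp [hu], h2⟩ ⟨u, h1, h2⟩ dvd_rfl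
  omega

theorem poin_mul_bcoeff {σ τ : Finset B} (hσ : (parabolic cs σ : Set W).Finite) :
    toLaurent (poin cs τ) * bcoeff cs σ τ =
      (∑ s ∈ σ, if τ = σ.erase s then sgn R s τ else 0) * toLaurent (poin cs σ) := by
  unfold bcoeff
  rw [Finset.mul_sum, Finset.sum_mul]
  refine Finset.sum_congr rfl fun s hs => ?_
  split_ifs with h
  · have h1 : poin cs τ * (poin cs σ / poin cs τ) = poin cs σ := by
      obtain ⟨c, hc⟩ := (poin_dvd cs (h ▸ Finset.erase_subset s σ : τ ⊆ σ) hσ).2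
      by_cases h0 : poin cs τ = 0
      · rw [hc, h0, zero_mul, zero_mul]
      · exact EuclideanDomain.mul_div_cancel' h0 ⟨c, hc⟩
    have h2 : (σ.filter fun t => t < s) = τ.filter fun t => t < s := by
      rw [h]
      ext t
      simp only [Finset.mem_filter, Finset.mem_erase]
      exact ⟨fun ⟨h1, h2⟩ => ⟨⟨h2.ne, h1⟩, h2⟩, fun ⟨h1, h2⟩ => ⟨h1.2, h2⟩⟩
    rw [h2, sgn]
    conv_rhs => rw [← h1, map_mul]
    ring
  · simp

variable [Fintype B]

theorem poin_mul_bdry {k : ℕ} (y : KW cs (k + 1) → R) (τ : KW cs k) :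
    toLaurent (poin cs τ.1) * bdry cs k y τ = dBdry (rescale cs (k + 1) y) τ.1 := by
  have h1 : bdry cs k y τ = ∑ σ : KW cs (k + 1), bcoeff cs σ.1 τ.1 * y σ := rfl
  let f : Finset B → R := fun σ =>
    (∑ s ∈ σ, if τ.1 = σ.erase s then sgn R s τ.1 else 0) * rescale cs (k + 1) y σ
  have h2 : toLaurent (poin cs τ.1) * bdry cs k y τ = ∑ σ : KW cs (k + 1), f σ.1 := by
    rw [h1, Finset.mul_sum]
    refine Finset.sum_congr rfl fun σ _ => ?_
    simp only [f]
    rw [← mul_assoc, poin_mul_bcoeff cs σ.2.2, rescale_coe, mul_assoc]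
  classical
  have h3 : ∑ σ : KW cs (k + 1), f σ.1 = ∑ σ : Finset B, f σ := by
    rw [← Finset.sum_subtype (Finset.univ.filter fun σ : Finset B =>
      σ.card = k + 1 ∧ (parabolic cs σ : Set W).Finite) (by simp) f]
    refine Finset.sum_subset (Finset.filter_subset _ _) fun σ _ hσ => ?_
    simp only [f]
    rw [rescale_of_not cs y (by simpa using hσ), mul_zero]
  rw [h2, h3]
  have h4 : ∀ σ : Finset B, f σ =
      ∑ s, if s ∉ τ.1 ∧ σ = insert s τ.1 then sgn R s τ.1 * rescale cs (k + 1) y σ else 0 := by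
    intro σ
    simp only [f]
    rw [Finset.sum_mul, ← Finset.sum_subset (Finset.subset_univ σ)]
    · refine Finset.sum_congr rfl fun s hs => ?_
      have h5 : τ.1 = σ.erase s ↔ s ∉ τ.1 ∧ σ = insert s τ.1 := by
        constructor
        · intro h
          rw [h]
          exact ⟨Finset.notMem_erase s σ, (Finset.insert_erase hs).symm⟩
        · rintro ⟨h, h'⟩
          rw [h', Finset.erase_insert h]
      simp only [h5, ite_mul, zero_mul]
    · intro s _ hs
      rw [if_neg]
      rintro ⟨-, rfl⟩
      exact hs (Finset.mem_insert_self _ _)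
  simp only [h4]
  rw [Finset.sum_comm, dBdry, ← Finset.sum_subset (Finset.subset_univ τ.1ᶜ)]
  · refine Finset.sum_congr rfl fun s hs => ?_
    simp only [Finset.mem_compl.1 hs, not_false_eq_true, true_and]
    rw [Finset.sum_ite_eq' Finset.univ (insert s τ.1)]
    simp
  · intro s _ hs
    have hs' : s ∈ τ.1 := by simpa using hs
    simp [hs']

theorem dBdry_rescale_of_mem_cycles {k : ℕ} {x : KW cs k → R} (hx : x ∈ cycles cs k) :
    dBdry (rescale cs k x) = 0 := by
  funext τ
  have hzero : (∀ s, s ∉ τ → rescale cs k x (insert s τ) = 0) → dBdry (rescale cs k x) τ = 0 := fun h =>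
    Finset.sum_eq_zero fun s hs => by rw [h s (Finset.mem_compl.1 hs), mul_zero]
  cases k with
  | zero =>
    refine hzero fun s hs => rescale_of_not cs x fun h => ?_
    rw [Finset.card_insert_of_notMem hs] at h
    omega
  | succ k =>
    by_cases hτ : τ.card = k ∧ (parabolic cs τ : Set W).Finite
    · have h1 := poin_mul_bdry cs x ⟨τ, hτ⟩
      have h2 : bdry cs k x = 0 := hx
      rw [h2] at h1
      simpa using h1.symm
    · refine hzero fun s hs => rescale_of_not cs x fun h => hτ ⟨?_, ?_⟩
      · have := h.1
        rw [Finset.card_insert_of_notMem hs] at this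
        omega
      · exact h.2.subset (parabolic_mono cs (Finset.subset_insert s τ))

theorem isCoprime_toLaurent {d : ℕ} {u : ℚ[X]} (h : IsCoprime u (cyclotomic d ℚ)) :
    IsCoprime (toLaurent u) (cyc d) :=
  h.map (toLaurent : ℚ[X] →+* R)

/-- A filling of the rescaled chain gives, up to a factor prime to `Φ_d`, a filling in the weighted
complex. -/
theorem exists_coprime_smul_mem_range {d k : ℕ} (hd : 0 < d) (v : Finset B → ℕ)
    (hv : ∀ σ, (parabolic cs σ : Set W).Finite → HasMult d (poin cs σ) (v σ))
    (hfin : ∀ σ : Finset B, σ.card = k + 1 → (parabolic cs σ : Set W).Finite)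
    {z : KW cs k → R} (G : Finset B → R) (hG : ∀ σ, G σ ≠ 0 → σ.card = k + 1)
    (hφ : ∀ σ, cyc d ^ v σ ∣ G σ) (hbd : dBdry G = rescale cs k z) :
    ∃ U : R, IsCoprime U (cyc d) ∧ U • z ∈ LinearMap.range (bdry cs k) := by
  have hu : ∀ σ : Finset B, ∃ u : R, IsCoprime u (cyc d) ∧
      ((parabolic cs σ : Set W).Finite → toLaurent (poin cs σ) = cyc d ^ v σ * u) := by
    intro σ
    by_cases h : (parabolic cs σ : Set W).Finite
    · obtain ⟨u, h1, h2⟩ := hv σ h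
      exact ⟨toLaurent u, isCoprime_toLaurent h2, fun _ => by rw [h1, map_mul, map_pow, cyc]⟩
    · exact ⟨1, isCoprime_one_left, fun h' => absurd h' h⟩
  choose u hcop hpoin using hu
  choose g hg using hφ
  have hc : ∀ σ, ∃ c, ∏ ρ, u ρ = u σ * c := fun σ => Finset.dvd_prod_of_mem u (Finset.mem_univ σ)
  choose c hc using hc
  refine ⟨∏ σ, u σ, IsCoprime.prod_left fun σ _ => hcop σ, fun σ => c σ.1 * g σ.1, ?_⟩
  have hresc : rescale cs (k + 1) (fun σ => c σ.1 * g σ.1) = (∏ σ, u σ) • G := by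
    funext σ
    rw [Pi.smul_apply, smul_eq_mul]
    by_cases h : σ.card = k + 1
    · have := rescale_coe cs (fun σ : KW cs (k + 1) => c σ.1 * g σ.1) ⟨σ, h, hfin σ h⟩
      simp only at this
      rw [this, hpoin σ (hfin σ h), hc σ, hg σ]
      ring
    · rw [rescale_of_not cs _ fun h' => h h'.1, not_imp_comm.1 (hG σ) h, mul_zero]
  funext τ
  have h1 := poin_mul_bdry cs (fun σ : KW cs (k + 1) => c σ.1 * g σ.1) τ
  rw [hresc, dBdry_smul, hbd, Pi.smul_apply, smul_eq_mul, rescale_coe, mul_left_comm] at h1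
  refine mul_left_cancel₀ ?_ h1
  rw [Ne, ← map_zero toLaurent]
  exact fun h => (hv τ.1 τ.2.2).ne_zero hd (toLaurent_injective h)

end Transfer

/-- The local homology of the Artin group of affine type `B̃ₙ` (`n ≥ 3`) has square-free
torsion: for every `k` and every `d ≥ 2`, the homology `H_k` of the weighted complex has
no `Φ_d²`-torsion. -/
theorem squarefree_torsion_affine_Bn (n : ℕ) (hn : 3 ≤ n) {W : Type*} [Group W]
    {Mat : CoxeterMatrix (Fin (n + 1))} (cs : CoxeterSystem Mat W)
    (hM : ∀ i j : Fin (n + 1), i.val < j.val →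
      Mat.M i j =
        (if (i.val = 0 ∧ j.val = 2) ∨ (i.val = 1 ∧ j.val = 2) ∨
            (2 ≤ i.val ∧ i.val ≤ n - 2 ∧ j.val = i.val + 1) then 3
         else if i.val = n - 1 ∧ j.val = n then 4
         else 2)) :
    ∀ k : ℕ, ∀ d : ℕ, 2 ≤ d → ∀ x : Hgy cs k, cyc d ^ 2 • x = 0 → cyc d • x = 0 := by
  intro k d hd x hx
  obtain ⟨⟨x, hxc⟩, rfl⟩ := Submodule.Quotient.mk_surjective _ x
  rw [← Submodule.Quotient.mk_smul, Submodule.Quotient.mk_eq_zero, Submodule.mem_comap] at hx ⊢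
  replace hx : cyc d ^ 2 • x ∈ LinearMap.range (bdry cs k) := hx
  show cyc d • x ∈ LinearMap.range (bdry cs k)
  have hM' : ∀ i j : Fin (n + 1), i.val < j.val → Mat.M i j = affBEntry n i.val j.val := hM
  have hcard : ∀ σ : Finset (Fin (n + 1)), (parabolic cs σ : Set W).Finite → σ.card ≤ n := by
    intro σ hσ
    by_contra! h
    have h1 : σ = Finset.univ := Finset.eq_univ_of_card σ (by
      have := Finset.card_le_univ σ
      rw [Fintype.card_fin] at this ⊢
      omega)
    exact parabolic_univ_infinite cs hn hM' (h1 ▸ hσ)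
  have hmult : ∀ σ : Finset (Fin (n + 1)), σ.card ≤ n → (parabolic cs σ : Set W).Finite ∧
      HasMult d (poin cs σ) (vmult n d (vals σ)) := fun σ h => by
    have := poin_hasMult cs hn hM' hd (vals_ssubset h)
    rwa [toFin_vals] at this
  by_cases hk : k < n
  · have hdvd : ∀ σ, cyc d ^ vmult n d (vals σ) ∣ rescale cs k x σ := by
      intro σ
      by_cases h : σ.card = k ∧ (parabolic cs σ : Set W).Finite
      · have h1 := rescale_coe cs x ⟨σ, h⟩
        simp only at h1
        obtain ⟨u, h2, -⟩ := (hmult σ (hcard σ h.2)).2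
        rw [h1, h2, map_mul, map_pow, mul_assoc]
        exact Dvd.intro _ rfl
      · rw [rescale_of_not cs x h]
        exact dvd_zero _
    have hsupp : ∀ σ, rescale cs k x σ ≠ 0 → σ.card = k := fun σ h => by
      by_contra h'
      exact h (rescale_of_not cs x fun h'' => h' h''.1)
    obtain ⟨G, h1, h2, h3⟩ := exists_filling cs hn hM' hd hk (rescale cs k x) hsupp hdvd
      (dBdry_rescale_of_mem_cycles cs hxc)
    rw [← rescale_smul] at h3
    obtain ⟨U, ⟨a, b, hab⟩, hU⟩ := exists_coprime_smul_mem_range cs (by omega)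
      (fun σ => vmult n d (vals σ)) (fun σ h => (hmult σ (hcard σ h)).2)
      (fun σ h => (hmult σ (by omega)).1) G h1 h2 h3
    have h4 : cyc d • x = a • U • cyc d • x + b • cyc d ^ 2 • x := by
      simp only [smul_smul, ← add_smul]
      congr 1
      linear_combination (-cyc d) * hab
    rw [h4]
    exact add_mem (Submodule.smul_mem _ a hU) (Submodule.smul_mem _ b hx)
  · obtain ⟨y, hy⟩ := hx
    have hempty : IsEmpty (KW cs (k + 1)) := ⟨fun σ => by
      have h1 := hcard σ.1 σ.2.2
      have h2 := σ.2.1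
      omega⟩
    have hy0 : y = 0 := Subsingleton.elim _ _
    rw [hy0, map_zero] at hy
    have hcyc : cyc d ^ 2 ≠ 0 := pow_ne_zero 2 fun h =>
      cyclotomic_ne_zero d ℚ (toLaurent_injective (h.trans (map_zero toLaurent).symm))
    rw [(smul_eq_zero.1 hy.symm).resolve_left hcyc, smul_zero]
    exact zero_mem _
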